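/- Let (A, (·,·), R) be an infinite irreducible locally finite root supersystem over a field F of characteristic zero. Then there exist a base Π of R and a family {R_γ}_{γ∈Γ} of finite irreducible ℤ-linearly closed sub-supersystems of R, directed under inclusion, such that R is the union of the R_γ and for each γ ∈ Γ the set Π ∩ R_γ is a base of R_γ. In particular, every finite subset of R is contained in a finite ℤ-linearly closed sub-supersystem of R. -/

import Mathlib

open Pointwise

/-- A symmetric biadditive form with values in `F`. -/
structure IsSymForm {F : Type*} [Field F] {A : Type*} [AddCommGroup A]
    (form : A → A → F) : Prop where
  symm : ∀ a b, form a b = form b a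
  add_left : ∀ a b c, form (a + b) c = form a c + form b c

/-- The radical `A⁰` of a form. -/
def formRadical {F : Type*} [Field F] {A : Type*} [AddCommGroup A]
    (form : A → A → F) : Set A := {a | ∀ b, form a b = 0}

/-- The set of real roots `R_re = {α ∈ R | (α,α) ≠ 0} ∪ {0}`. -/
def reRoots {F : Type*} [Field F] {A : Type*} [AddCommGroup A]
    (form : A → A → F) (R : Set A) : Set A :=
  {α | α ∈ R ∧ form α α ≠ 0} ∪ {0}

/-- The set of nonsingular roots `R_ns = {α ∈ R \ A⁰ | (α,α) = 0} ∪ {0}`. -/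
def nsRoots {F : Type*} [Field F] {A : Type*} [AddCommGroup A]
    (form : A → A → F) (R : Set A) : Set A :=
  {α | α ∈ R ∧ form α α = 0 ∧ α ∉ formRadical form} ∪ {0}

/-- Extended affine root supersystem. -/
structure IsEARS {F : Type*} [Field F] [CharZero F] {A : Type*} [AddCommGroup A]
    (form : A → A → F) (R : Set A) extends IsSymForm form : Prop where
  zero_mem : (0 : A) ∈ R
  closure_eq_top : AddSubgroup.closure R = ⊤
  neg_mem : ∀ α ∈ R, -α ∈ R
  cartan : ∀ α ∈ R, form α α ≠ 0 → ∀ β ∈ R, ∃ k : ℤ, 2 * form α β = (k : F) * form α α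
  string : ∀ α ∈ R, form α α ≠ 0 → ∀ β ∈ R, ∃ p q : ℕ,
      2 * form β α = ((p : F) - (q : F)) * form α α ∧
      (∀ k : ℤ, β + k • α ∈ R ↔ -(p : ℤ) ≤ k ∧ k ≤ (q : ℤ))
  ns_string : ∀ α ∈ R, form α α = 0 → ∀ β ∈ R, form α β ≠ 0 →
      (β - α ∈ R ∨ β + α ∈ R)

/-- Locally finite root supersystem: an EARS with nondegenerate form. -/
def IsLFRSS {F : Type*} [Field F] [CharZero F] {A : Type*} [AddCommGroup A]
    (form : A → A → F) (R : Set A) : Prop :=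
  IsEARS form R ∧ ∀ a : A, (∀ b, form a b = 0) → a = 0

/-- `α` and `β` are connected in `X` by a finite chain with consecutive
elements non-orthogonal. -/
def ConnectedIn {F : Type*} [Field F] {A : Type*} [AddCommGroup A]
    (form : A → A → F) (X : Set A) (α β : A) : Prop :=
  ∃ (n : ℕ) (c : Fin (n + 1) → A), (∀ i, c i ∈ X) ∧ c 0 = α ∧ c (Fin.last n) = β ∧
    ∀ i : Fin n, form (c i.castSucc) (c i.succ) ≠ 0

/-- A connected subset. -/
def IsConnectedSet {F : Type*} [Field F] {A : Type*} [AddCommGroup A]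
    (form : A → A → F) (X : Set A) : Prop :=
  ∀ α ∈ X, ∀ β ∈ X, ConnectedIn form X α β

/-- Irreducibility: `R_re ≠ {0}` and `R \ R⁰` is connected. -/
def IsIrreducibleRSS {F : Type*} [Field F] {A : Type*} [AddCommGroup A]
    (form : A → A → F) (R : Set A) : Prop :=
  reRoots form R ≠ {0} ∧ IsConnectedSet form (R \ formRadical form)

/-- Sub-supersystem of a locally finite root supersystem. -/
def IsSubSupersystem {F : Type*} [Field F] {A : Type*} [AddCommGroup A]
    (form : A → A → F) (R S : Set A) : Prop :=
  S ⊆ R ∧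
  (∀ a ∈ AddSubgroup.closure S, (∀ b ∈ AddSubgroup.closure S, form a b = 0) → a = 0) ∧
  (0 : A) ∈ S ∧
  (∀ α ∈ S, form α α ≠ 0 → ∀ β ∈ S, ∀ k : ℤ,
      2 * form β α = (k : F) * form α α → β - k • α ∈ S) ∧
  (∀ γ ∈ S, form γ γ = 0 → ∀ β ∈ S, form β γ ≠ 0 → (γ - β ∈ S ∨ γ + β ∈ S))

/-- `Π` is an integral base of `R` (a `ℤ`-basis of the group generated by `R`). -/
def IsIntegralBase {F : Type*} [Field F] {A : Type*} [AddCommGroup A]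
    (form : A → A → F) (R P : Set A) : Prop :=
  P ⊆ R ∧ LinearIndependent ℤ (fun p : P => (p : A)) ∧
    Submodule.span ℤ P = Submodule.span ℤ R

/-- `Π` is a base of `R`. -/
def IsBase {F : Type*} [Field F] {A : Type*} [AddCommGroup A]
    (form : A → A → F) (R P : Set A) : Prop :=
  IsIntegralBase form R P ∧
  ∀ α ∈ R \ formRadical form, ∃ (n : ℕ) (a : Fin n → A) (r : Fin n → ℤ),
    (∀ i, a i ∈ P) ∧ (∀ i, r i = 1 ∨ r i = -1) ∧
    α = ∑ i, r i • a i ∧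
    ∀ t : Fin n, (∑ i ∈ Finset.Iic t, r i • a i) ∈ R \ formRadical form



set_option linter.unusedSimpArgs false
set_option linter.unusedVariables false

section RankTwo

variable {F : Type*} [Field F] {A : Type*} [AddCommGroup A] {form : A → A → F} {R : Set A}

theorem IsSymForm.add_right (h : IsSymForm form) (a b c : A) :
    form a (b + c) = form a b + form a c := by
  rw [h.symm a, h.add_left, h.symm b, h.symm c]

theorem IsSymForm.zero_left (h : IsSymForm form) (b : A) : form 0 b = 0 := by
  have := h.add_left 0 0 b
  simpa using this

theorem IsSymForm.zero_right (h : IsSymForm form) (b : A) : form b 0 = 0 := by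
  rw [h.symm, h.zero_left]

theorem IsSymForm.neg_left (h : IsSymForm form) (a b : A) : form (-a) b = - form a b := by
  have := h.add_left (-a) a b
  rw [neg_add_cancel, h.zero_left] at this
  linear_combination -this

theorem IsSymForm.neg_right (h : IsSymForm form) (a b : A) : form a (-b) = - form a b := by
  rw [h.symm, h.neg_left, h.symm]

theorem IsSymForm.sub_left (h : IsSymForm form) (a b c : A) :
    form (a - b) c = form a c - form b c := by
  rw [sub_eq_add_neg, h.add_left, h.neg_left, sub_eq_add_neg]

theorem IsSymForm.sub_right (h : IsSymForm form) (a b c : A) :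
    form c (a - b) = form c a - form c b := by
  rw [sub_eq_add_neg, h.add_right, h.neg_right, sub_eq_add_neg]

theorem IsSymForm.nsmul_left (h : IsSymForm form) (n : ℕ) (a b : A) :
    form (n • a) b = (n : F) * form a b := by
  induction n with
  | zero => simp [h.zero_left]
  | succ n ih => rw [succ_nsmul, h.add_left, ih]; push_cast; ring

theorem IsSymForm.zsmul_left (h : IsSymForm form) (n : ℤ) (a b : A) :
    form (n • a) b = (n : F) * form a b := by
  obtain ⟨m, rfl | rfl⟩ := n.eq_nat_or_neg
  · simp [h.nsmul_left]
  · simp [h.nsmul_left, h.neg_left]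

theorem IsSymForm.zsmul_right (h : IsSymForm form) (n : ℤ) (a b : A) :
    form a (n • b) = (n : F) * form a b := by
  rw [h.symm, h.zsmul_left, h.symm]

theorem IsSymForm.sum_left (h : IsSymForm form) {ι : Type*} (s : Finset ι) (f : ι → A) (b : A) :
    form (∑ i ∈ s, f i) b = ∑ i ∈ s, form (f i) b := by
  classical
  induction s using Finset.induction_on with
  | empty => simp [h.zero_left]
  | insert i s hi ih => rw [Finset.sum_insert hi, Finset.sum_insert hi, h.add_left, ih]

theorem IsSymForm.sum_right (h : IsSymForm form) {ι : Type*} (s : Finset ι) (f : ι → A) (b : A) :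
    form b (∑ i ∈ s, f i) = ∑ i ∈ s, form b (f i) := by
  rw [h.symm, h.sum_left]
  exact Finset.sum_congr rfl fun i _ => h.symm _ _

variable [CharZero F]

theorem IsLFRSS.sf (h : IsLFRSS form R) : IsSymForm form := h.1.toIsSymForm

theorem IsLFRSS.eq_zero (h : IsLFRSS form R) {a : A} (ha : ∀ b ∈ R, form a b = 0) : a = 0 := by
  apply h.2
  intro b
  have hb : b ∈ AddSubgroup.closure R := by rw [h.1.closure_eq_top]; trivial
  induction hb using AddSubgroup.closure_induction with
  | mem x hx => exact ha x hx
  | zero => exact h.sf.zero_right _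
  | add x y _ _ hx hy => rw [h.sf.add_right, hx, hy, add_zero]
  | neg x _ hx => rw [h.sf.neg_right, hx, neg_zero]

theorem IsLFRSS.zsmul_eq_zero (h : IsLFRSS form R) {a : A} {n : ℤ} (hn : n ≠ 0)
    (ha : n • a = 0) : a = 0 := by
  apply h.2
  intro b
  have := h.sf.zsmul_left n a b
  rw [ha, h.sf.zero_left] at this
  have hn' : (n : F) ≠ 0 := by exact_mod_cast hn
  exact (mul_eq_zero.1 this.symm).resolve_left hn'

theorem IsLFRSS.neg (h : IsLFRSS form R) {a : A} (ha : a ∈ R) : -a ∈ R := h.1.neg_mem a ha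

theorem IsLFRSS.sub_comm (h : IsLFRSS form R) {a b : A} (ha : a - b ∈ R) : b - a ∈ R := by
  have := h.neg ha
  rwa [neg_sub] at this

/-- existence of Cartan integer -/
theorem IsLFRSS.car (h : IsLFRSS form R) {α β : A} (hα : α ∈ R) (hr : form α α ≠ 0) (hβ : β ∈ R) :
    ∃ n : ℤ, 2 * form β α = (n : F) * form α α := by
  obtain ⟨k, hk⟩ := h.1.cartan α hα hr β hβ
  exact ⟨k, by rw [h.sf.symm β α, hk]⟩

theorem IsLFRSS.str (h : IsLFRSS form R) {α β : A} (hα : α ∈ R) (hr : form α α ≠ 0) (hβ : β ∈ R)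
    {n : ℤ} (hn : 2 * form β α = (n : F) * form α α) (k : ℤ)
    (hk : (0 ≤ k ∧ k ≤ n) ∨ (n ≤ k ∧ k ≤ 0)) : β - k • α ∈ R := by
  obtain ⟨p, q, h1, h2⟩ := h.1.string α hα hr β hβ
  have h3 : ((n : ℤ) : F) = (((p : ℤ) - (q : ℤ) : ℤ) : F) := by
    apply mul_right_cancel₀ hr
    rw [← hn, h1]; push_cast; ring
  have h4 : n = (p : ℤ) - q := by exact_mod_cast h3
  have := (h2 (-k)).2 (by omega)
  rwa [neg_smul, ← sub_eq_add_neg] at this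

theorem IsLFRSS.refl_mem (h : IsLFRSS form R) {α β : A} (hα : α ∈ R) (hr : form α α ≠ 0)
    (hβ : β ∈ R) {n : ℤ} (hn : 2 * form β α = (n : F) * form α α) : β - n • α ∈ R :=
  h.str hα hr hβ hn n (by omega)

theorem IsLFRSS.str_sub (h : IsLFRSS form R) {α β : A} (hα : α ∈ R) (hr : form α α ≠ 0)
    (hβ : β ∈ R) {n : ℤ} (hn : 2 * form β α = (n : F) * form α α) (hp : 1 ≤ n) : β - α ∈ R := by
  have := h.str hα hr hβ hn 1 (by omega)
  rwa [one_smul] at this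

theorem IsLFRSS.str_add (h : IsLFRSS form R) {α β : A} (hα : α ∈ R) (hr : form α α ≠ 0)
    (hβ : β ∈ R) {n : ℤ} (hn : 2 * form β α = (n : F) * form α α) (hp : n ≤ -1) : β + α ∈ R := by
  have := h.str hα hr hβ hn (-1) (by omega)
  rwa [neg_smul, one_smul, sub_neg_eq_add] at this

/-- two non-orthogonal roots: sum or difference is a root -/
theorem IsLFRSS.add_or_sub (h : IsLFRSS form R) {α β : A} (hα : α ∈ R) (hβ : β ∈ R)
    (hne : form α β ≠ 0) : α + β ∈ R ∨ α - β ∈ R := by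
  by_cases hr : form α α = 0
  · rcases h.1.ns_string α hα hr β hβ hne with h1 | h1
    · right; exact h.sub_comm h1
    · left; rwa [add_comm]
  · obtain ⟨n, hn⟩ := h.car hα hr hβ
    have hn0 : n ≠ 0 := by
      rintro rfl
      rw [h.sf.symm] at hne
      simp at hn; exact hne hn
    rcases lt_or_gt_of_ne hn0 with h1 | h1
    · left; rw [add_comm]; exact h.str_add hα hr hβ hn (by omega)
    · right; exact h.sub_comm (h.str_sub hα hr hβ hn (by omega))

theorem IsLFRSS.ns_bound_aux (h : IsLFRSS form R) {α γ : A} (hα : α ∈ R) (hr : form α α ≠ 0)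
    (hγ : γ ∈ R) (hn : form γ γ = 0) {n : ℤ} (hc : 2 * form γ α = (n : F) * form α α) :
    n ≤ 2 := by
  by_contra hcon
  have h1 : γ - α ∈ R := h.str_sub hα hr hγ hc (by omega)
  have h2 : form (γ - α) (γ - α) = ((1 - n : ℤ) : F) * form α α := by
    simp only [h.sf.sub_left, h.sf.sub_right, hn, h.sf.symm α γ]
    push_cast; linear_combination -hc
  have h3 : form (γ - α) (γ - α) ≠ 0 := by
    rw [h2]; exact mul_ne_zero (by exact_mod_cast (by omega)) hr
  obtain ⟨k, hk⟩ := h.car h1 h3 hγ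
  rw [h2, h.sf.sub_right, hn] at hk
  have h4 : ((-n : ℤ) : F) = ((k * (1 - n) : ℤ) : F) := by
    apply mul_right_cancel₀ hr
    push_cast at hk ⊢; linear_combination hk + hc
  have h5 : -n = k * (1 - n) := by exact_mod_cast h4
  have h6 : (k - 1) * (n - 1) = 1 := by linarith
  have := Int.eq_one_or_neg_one_of_mul_eq_one' h6
  omega

theorem IsLFRSS.ns_bound (h : IsLFRSS form R) {α γ : A} (hα : α ∈ R) (hr : form α α ≠ 0)
    (hγ : γ ∈ R) (hn : form γ γ = 0) {n : ℤ} (hc : 2 * form γ α = (n : F) * form α α) :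
    |n| ≤ 2 := by
  rw [abs_le]
  constructor
  · have := h.ns_bound_aux hα hr (h.neg hγ) (by simp [h.sf.neg_left, h.sf.neg_right, hn])
      (n := -n) (by rw [h.sf.neg_left]; push_cast; linear_combination -hc)
    omega
  · exact h.ns_bound_aux hα hr hγ hn hc

theorem IsLFRSS.opp_aux (h : IsLFRSS form R) {α β : A} (hα : α ∈ R) (hr : form α α ≠ 0)
    (hβ : β ∈ R) (hs : form β β ≠ 0) {m j : ℤ} (hm : 2 * form β α = (m : F) * form α α)
    (hj : 2 * form β α = (j : F) * form β β) (hm0 : 0 < m) (hj0 : j < 0) : m ≤ 2 := by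
  by_contra hcon
  have h1 : β - α ∈ R := h.str_sub hα hr hβ hm (by omega)
  have h2 : (j : F) * form (β - α) (β - α) = ((m + j * (1 - m) : ℤ) : F) * form α α := by
    simp only [h.sf.sub_left, h.sf.sub_right, h.sf.symm α β]
    push_cast; linear_combination (1 - j) * hm - hj
  have h3 : form (β - α) (β - α) ≠ 0 := by
    intro h0
    rw [h0, mul_zero] at h2
    have h4 := (mul_eq_zero.1 h2.symm).resolve_right hr
    have h5 : m + j * (1 - m) = 0 := by exact_mod_cast h4
    nlinarith
  obtain ⟨k, hk⟩ := h.car h1 h3 hα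
  rw [h.sf.sub_right, h.sf.symm α β] at hk
  have h4 : ((j * (m - 2) : ℤ) : F) = ((k * (m + j * (1 - m)) : ℤ) : F) := by
    apply mul_right_cancel₀ hr
    push_cast at hk h2 ⊢; linear_combination k * h2 + j * hk - j * hm
  have h5 : j * (m - 2) = k * (m + j * (1 - m)) := by exact_mod_cast h4
  have hk0 : k ≤ -1 := by
    by_contra hk0
    have : 0 ≤ k := by omega
    nlinarith [mul_nonneg this (by nlinarith : (0:ℤ) ≤ m + j * (1 - m))]
  have hM : 0 ≤ m + j * (1 - m) := by nlinarith
  nlinarith [mul_nonneg (by omega : (0:ℤ) ≤ -1 - k) hM]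

theorem IsLFRSS.opp_bound (h : IsLFRSS form R) {α β : A} (hα : α ∈ R) (hr : form α α ≠ 0)
    (hβ : β ∈ R) (hs : form β β ≠ 0) {m j : ℤ} (hm : 2 * form β α = (m : F) * form α α)
    (hj : 2 * form β α = (j : F) * form β β) (hmj : m * j < 0) : |m| ≤ 2 := by
  rcases lt_trichotomy m 0 with h0 | h0 | h0
  · have hj0 : 0 < j := by nlinarith
    have := h.opp_aux (h.neg hα) (by simpa [h.sf.neg_left, h.sf.neg_right] using hr) hβ hs
      (m := -m) (j := -j) (by simp only [h.sf.neg_left, h.sf.neg_right]; push_cast; linear_combination -hm)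
      (by simp only [h.sf.neg_left, h.sf.neg_right]; push_cast; linear_combination -hj)
      (by omega) (by omega)
    rw [abs_le]; omega
  · subst h0; simp
  · have hj0 : j < 0 := by nlinarith
    have := h.opp_aux hα hr hβ hs hm hj h0 hj0
    rw [abs_le]; omega

theorem IsLFRSS.opp_12 (h : IsLFRSS form R) {α β : A} (hα : α ∈ R) (hr : form α α ≠ 0)
    (hβ : β ∈ R) (hs : form β β ≠ 0) (hm : 2 * form β α = form α α)
    (hj : 2 * form β α = -2 * form β β) : False := by
  have hu : β - α ∈ R := h.str_sub hα hr hβ (n := 1) (by simpa using hm) le_rfl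
  have hv : α + β ∈ R := h.str_add hβ hs hα (n := -2)
    (by rw [h.sf.symm]; push_cast; exact hj) (by omega)
  have e1 : 2 * form (β - α) (β - α) = - form α α := by
    simp only [h.sf.sub_left, h.sf.sub_right, h.sf.symm α β]
    linear_combination hj - 3*hm
  have e2 : 2 * form (α + β) (α + β) = 3 * form α α := by
    simp only [h.sf.add_left, h.sf.add_right, h.sf.symm α β]
    linear_combination hj + hm
  have e3 : 2 * form (α + β) (β - α) = - 3 * form α α := by
    simp only [h.sf.add_left, h.sf.sub_right, h.sf.symm α β]
    linear_combination hj - hm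
  have h2 : (2 : F) ≠ 0 := two_ne_zero
  have := h.opp_bound hu (m := 6) (j := -2) (by
      intro h0; rw [h0] at e1; apply hr; linear_combination e1) hv (by
      intro h0; rw [h0] at e2; apply hr
      have h3 : (3 : F) ≠ 0 := three_ne_zero
      apply mul_left_cancel₀ h3; linear_combination -e2)
      (by apply mul_left_cancel₀ h2; push_cast; linear_combination 2 * e3 - 6 * e1)
      (by apply mul_left_cancel₀ h2; push_cast; linear_combination 2 * e3 + 2 * e2)
      (by norm_num)
  norm_num at this

theorem IsLFRSS.opp_11 (h : IsLFRSS form R) {α β : A} (hα : α ∈ R) (hr : form α α ≠ 0)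
    (hβ : β ∈ R) (hs : form β β ≠ 0) (hm : 2 * form β α = form α α)
    (hj : 2 * form β α = - form β β) : False := by
  have hu : β - α ∈ R := h.str_sub hα hr hβ (n := 1) (by simpa using hm) le_rfl
  have hv : α + β ∈ R := h.str_add hβ hs hα (n := -1)
    (by rw [h.sf.symm]; push_cast; linear_combination hj) (by omega)
  have e1 : form (β - α) (β - α) = - form α α := by
    simp only [h.sf.sub_left, h.sf.sub_right, h.sf.symm α β]
    linear_combination hj - 2 * hm
  have e2 : form (α + β) (α + β) = form α α := by
    simp only [h.sf.add_left, h.sf.add_right, h.sf.symm α β]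
    linear_combination hj
  have e3 : form (α + β) (β - α) = - 2 * form α α := by
    simp only [h.sf.add_left, h.sf.sub_right, h.sf.symm α β]
    linear_combination hj - hm
  have := h.opp_bound hu (m := 4) (j := -4) (by rw [e1]; simpa using hr) hv (by rwa [e2])
      (by rw [e3, e1]; push_cast; ring)
      (by rw [e3, e2]; push_cast; ring) (by norm_num)
  norm_num at this

theorem IsLFRSS.opp_22 (h : IsLFRSS form R) {α β : A} (hα : α ∈ R) (hr : form α α ≠ 0)
    (hβ : β ∈ R) (hs : form β β ≠ 0) (hm : 2 * form β α = 2 * form α α)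
    (hj : 2 * form β α = -2 * form β β) : False := by
  have h2 : (2 : F) ≠ 0 := two_ne_zero
  have hm' : form β α = form α α := mul_left_cancel₀ h2 hm
  have hj' : form β β = - form α α := by
    apply mul_left_cancel₀ h2; linear_combination hj - hm
  have hu : α - (-2 : ℤ) • β ∈ R := h.refl_mem hβ hs hα (by
    rw [h.sf.symm]; push_cast; exact hj)
  set u := α - (-2 : ℤ) • β with hudef
  have e1 : form u u = form α α := by
    simp only [hudef, h.sf.sub_left, h.sf.sub_right, h.sf.zsmul_left, h.sf.zsmul_right,
      h.sf.symm α β, hm', hj']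
    push_cast; ring
  have e2 : form β u = - form α α := by
    simp only [hudef, h.sf.sub_left, h.sf.sub_right, h.sf.zsmul_left, h.sf.zsmul_right,
      h.sf.symm α β, hm', hj']
    push_cast; ring
  have e2' : form u β = - form α α := by rw [h.sf.symm, e2]
  have e3 : form u α = 3 * form α α := by
    simp only [hudef, h.sf.sub_left, h.sf.sub_right, h.sf.zsmul_left, h.sf.zsmul_right,
      h.sf.symm α β, hm', hj']
    push_cast; ring
  have hv : β - (-2 : ℤ) • u ∈ R := h.refl_mem hu (by rwa [e1]) hβ (by
    rw [e2, e1]; push_cast; ring)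
  have e4 : form (β - (-2 : ℤ) • u) (β - (-2 : ℤ) • u) = - form α α := by
    simp only [h.sf.sub_left, h.sf.sub_right, h.sf.zsmul_left, h.sf.zsmul_right, e2, e2', hj', e1]
    push_cast; ring
  have e5 : form (β - (-2 : ℤ) • u) α = 7 * form α α := by
    simp only [h.sf.sub_left, h.sf.sub_right, h.sf.zsmul_left, h.sf.zsmul_right, e3, hm']
    push_cast; ring
  have := h.opp_bound hα (m := 14) (j := -14) hr hv (by rw [e4]; simpa using hr)
      (by rw [e5]; push_cast; ring)
      (by rw [e5, e4]; push_cast; ring) (by norm_num)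
  norm_num at this

theorem IsLFRSS.opp_pos (h : IsLFRSS form R) {α β : A} (hα : α ∈ R) (hr : form α α ≠ 0)
    (hβ : β ∈ R) (hs : form β β ≠ 0) {m j : ℤ} (hm : 2 * form β α = (m : F) * form α α)
    (hj : 2 * form β α = (j : F) * form β β) (hm0 : 0 < m) (hj0 : j < 0) : False := by
  have hmj : m * j < 0 := by nlinarith
  have h1 := h.opp_bound hα hr hβ hs hm hj hmj
  have h2 := h.opp_bound (m := j) (j := m) hβ hs hα hr (by rw [h.sf.symm, hj])
    (by rw [h.sf.symm, hm]) (by linarith)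
  rw [abs_le] at h1 h2
  have hm1 : m = 1 ∨ m = 2 := by omega
  have hj1 : j = -1 ∨ j = -2 := by omega
  rcases hm1 with rfl | rfl <;> rcases hj1 with rfl | rfl
  · exact h.opp_11 hα hr hβ hs (by simpa using hm) (by simpa using hj)
  · exact h.opp_12 hα hr hβ hs (by simpa using hm) (by simpa using hj)
  · refine h.opp_12 (h.neg hβ) (by simpa [h.sf.neg_left, h.sf.neg_right] using hs) hα hr ?_ ?_
    · simp only [h.sf.neg_left, h.sf.neg_right, h.sf.symm α β]
      push_cast at hj; linear_combination -hj
    · simp only [h.sf.neg_left, h.sf.neg_right, h.sf.symm α β]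
      push_cast at hm; linear_combination -hm
  · exact h.opp_22 hα hr hβ hs (by simpa using hm) (by simpa using hj)

theorem IsLFRSS.opp (h : IsLFRSS form R) {α β : A} (hα : α ∈ R) (hr : form α α ≠ 0)
    (hβ : β ∈ R) (hs : form β β ≠ 0) {m j : ℤ} (hm : 2 * form β α = (m : F) * form α α)
    (hj : 2 * form β α = (j : F) * form β β) : 0 ≤ m * j := by
  by_contra hmj
  push Not at hmj
  rcases lt_trichotomy m 0 with h0 | h0 | h0
  · have hj0 : 0 < j := by nlinarith
    exact h.opp_pos (h.neg hα) (by simpa [h.sf.neg_left, h.sf.neg_right] using hr) hβ hs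
      (m := -m) (j := -j) (by simp only [h.sf.neg_left, h.sf.neg_right]; push_cast; linear_combination -hm)
      (by simp only [h.sf.neg_left, h.sf.neg_right]; push_cast; linear_combination -hj)
      (by omega) (by omega)
  · subst h0; simp at hmj
  · have hj0 : j < 0 := by nlinarith
    exact h.opp_pos hα hr hβ hs hm hj h0 hj0

theorem IsLFRSS.prod_aux (h : IsLFRSS form R) {α β : A} (hα : α ∈ R) (hr : form α α ≠ 0)
    (hβ : β ∈ R) (hs : form β β ≠ 0) {m j : ℤ} (hm : 2 * form β α = (m : F) * form α α)
    (hj : 2 * form β α = (j : F) * form β β) (hj0 : 0 < j) (hmj : j ≤ m) : m * j ≤ 4 := by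
  by_contra hcon
  push Not at hcon
  have hm3 : 3 ≤ m := by nlinarith
  have hjF : (j : F) ≠ 0 := by exact_mod_cast hj0.ne'
  obtain ⟨k, hk | hk⟩ := m.even_or_odd'
  · have h1 : β - k • α ∈ R := h.str hα hr hβ hm k (by omega)
    have e1 : (j : F) * form (β - k • α) (β - k • α) = ((2 * k - j * k * k : ℤ) : F) * form α α := by
      simp only [h.sf.sub_left, h.sf.sub_right, h.sf.zsmul_left, h.sf.zsmul_right, h.sf.symm α β]
      subst hk
      push_cast at hm ⊢; linear_combination  -hj + hm - j * k * hm
    have e2 : form β (β - k • α) = form (β - k • α) (β - k • α) := by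
      simp only [h.sf.sub_left, h.sf.sub_right, h.sf.zsmul_left, h.sf.zsmul_right, h.sf.symm α β]
      subst hk
      push_cast at hm ⊢; linear_combination (k/2 : F) * hm
    have hneg : 2 * k - j * k * k < 0 := by subst hk; nlinarith
    have hne : form (β - k • α) (β - k • α) ≠ 0 := by
      intro h0
      rw [h0, mul_zero] at e1
      have := (mul_eq_zero.1 e1.symm).resolve_right hr
      have : 2 * k - j * k * k = 0 := by exact_mod_cast this
      omega
    have := h.opp h1 hne hβ hs (m := 2) (j := 2 - j * k) (by rw [e2]; push_cast; ring)
      (by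
        apply mul_left_cancel₀ hjF
        rw [e2]
        subst hk
        push_cast at e1 hm ⊢
        linear_combination 2 * e1 + (2 - j * k) * (hj  - hm))
    subst hk
    nlinarith
  · have h1 : β - k • α ∈ R := h.str hα hr hβ hm k (by omega)
    have e1 : (j : F) * form (β - k • α) (β - k • α)
        = ((m - j * k * (k + 1) : ℤ) : F) * form α α := by
      simp only [h.sf.sub_left, h.sf.sub_right, h.sf.zsmul_left, h.sf.zsmul_right, h.sf.symm α β]
      subst hk
      push_cast at hm ⊢; linear_combination  -hj + hm - j * k * hm
    have e2 : 2 * form (β - k • α) α = form α α := by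
      simp only [h.sf.sub_left, h.sf.zsmul_left]
      subst hk
      push_cast at hm ⊢; linear_combination hm
    have hneg : m - j * k * (k + 1) < 0 := by
      subst hk
      have : 1 ≤ k := by omega
      rcases this.lt_or_eq with h2 | rfl
      · have : k * (k+1) ≤ j * (k * (k + 1)) := by nlinarith [mul_nonneg (by omega : 0 ≤ k) (by omega : 0 ≤ k+1)]
        nlinarith
      · omega
    have hne : form (β - k • α) (β - k • α) ≠ 0 := by
      intro h0
      rw [h0, mul_zero] at e1
      have := (mul_eq_zero.1 e1.symm).resolve_right hr
      have : m - j * k * (k + 1) = 0 := by exact_mod_cast this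
      omega
    obtain ⟨l, hl⟩ := h.car h1 hne hα
    rw [h.sf.symm] at hl
    have h5 := h.opp hα hr h1 hne (m := 1) (by rw [e2]; simp) hl
    have h6 : ((j : ℤ) : F) = ((l * (m - j * k * (k + 1)) : ℤ) : F) := by
      apply mul_right_cancel₀ hr
      push_cast at e1 ⊢
      linear_combination j * hl - j * e2 + l * e1
    have h7 : j = l * (m - j * k * (k + 1)) := by exact_mod_cast h6
    nlinarith

theorem IsLFRSS.prod_le (h : IsLFRSS form R) {α β : A} (hα : α ∈ R) (hr : form α α ≠ 0)
    (hβ : β ∈ R) (hs : form β β ≠ 0) {m j : ℤ} (hm : 2 * form β α = (m : F) * form α α)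
    (hj : 2 * form β α = (j : F) * form β β) : m * j ≤ 4 := by
  have hpos := h.opp hα hr hβ hs hm hj
  have key : ∀ {α β : A} (hα : α ∈ R) (hr : form α α ≠ 0)
    (hβ : β ∈ R) (hs : form β β ≠ 0) {m j : ℤ} (hm : 2 * form β α = (m : F) * form α α)
    (hj : 2 * form β α = (j : F) * form β β), 0 < j → 0 < m → m * j ≤ 4 := by
    intro α β hα hr hβ hs m j hm hj h1 h2
    rcases le_total j m with h3 | h3
    · exact h.prod_aux hα hr hβ hs hm hj h1 h3
    · have := h.prod_aux hβ hs hα hr (m := j) (j := m) (by rw [h.sf.symm, hj])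
        (by rw [h.sf.symm, hm]) h2 h3
      linarith
  rcases lt_trichotomy j 0 with h0 | h0 | h0
  · rcases lt_trichotomy m 0 with h1 | h1 | h1
    · have := key (h.neg hα) (by simpa [h.sf.neg_left, h.sf.neg_right] using hr) hβ hs
        (m := -m) (j := -j) (by simp only [h.sf.neg_left, h.sf.neg_right]; push_cast; linear_combination -hm)
        (by simp only [h.sf.neg_left, h.sf.neg_right]; push_cast; linear_combination -hj)
        (by omega) (by omega)
      linarith
    · subst h1; simp
    · nlinarith
  · subst h0; simp
  · rcases lt_trichotomy m 0 with h1 | h1 | h1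
    · nlinarith
    · subst h1; simp
    · exact key hα hr hβ hs hm hj h0 h1

/-- nonzero Cartan integers of two real roots have product at least one -/
theorem IsLFRSS.prod_ge (h : IsLFRSS form R) {α β : A} (hα : α ∈ R) (hr : form α α ≠ 0)
    (hβ : β ∈ R) (hs : form β β ≠ 0) {m j : ℤ} (hm : 2 * form β α = (m : F) * form α α)
    (hj : 2 * form β α = (j : F) * form β β) (hne : form β α ≠ 0) : 1 ≤ m * j := by
  have hpos := h.opp hα hr hβ hs hm hj
  have h1 : m * j ≠ 0 := by
    intro h0
    have h2 : (2 : F) * form β α ≠ 0 := mul_ne_zero two_ne_zero hne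
    rcases mul_eq_zero.1 h0 with rfl | rfl
    · apply h2; rw [hm]; simp
    · apply h2; rw [hj]; simp
  omega

theorem IsLFRSS.car_bound (h : IsLFRSS form R) {α β : A} (hα : α ∈ R) (hr : form α α ≠ 0)
    (hβ : β ∈ R) {m : ℤ} (hm : 2 * form β α = (m : F) * form α α) : |m| ≤ 4 := by
  by_cases hs : form β β = 0
  · have := h.ns_bound hα hr hβ hs hm; omega
  by_cases hne : form β α = 0
  · rw [hne, mul_zero] at hm
    have := (mul_eq_zero.1 hm.symm).resolve_right hr
    have : m = 0 := by exact_mod_cast this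
    simp [this]
  obtain ⟨j, hj⟩ := h.car hβ hs hα
  rw [h.sf.symm] at hj
  have h1 := h.prod_ge hα hr hβ hs hm hj hne
  have h2 := h.prod_le hα hr hβ hs hm hj
  have : j ≠ 0 := by rintro rfl; simp at h1
  rw [abs_le]
  rcases lt_or_gt_of_ne this with h3 | h3 <;> constructor <;> nlinarith

theorem IsLFRSS.delta_zero (h : IsLFRSS form R) {β δ : A} (hβ : β ∈ R) (hr : form β β ≠ 0)
    (h1 : form β δ = 0) (h2 : form δ δ = 0)
    (hstep : ∀ j : ℤ, β + j • δ ∈ R → β - (j + 2) • δ ∈ R) : δ = 0 := by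
  have hnorm : ∀ j : ℤ, form (β + j • δ) (β + j • δ) = form β β := by
    intro j
    simp only [h.sf.add_left, h.sf.add_right, h.sf.zsmul_left, h.sf.zsmul_right, h1, h2,
      h.sf.symm δ β]
    ring
  have hflip : ∀ j : ℤ, β + j • δ ∈ R → β - j • δ ∈ R := by
    intro j hj
    have := h.refl_mem hβ hr hj (n := 2) (by
      simp only [h.sf.add_left, h.sf.zsmul_left, h.sf.symm δ β, h1]; push_cast; ring)
    have := h.neg this
    have e : -(β + j • δ - (2 : ℤ) • β) = β - j • δ := by
      rw [two_smul]; abel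
    rwa [e] at this
  have hall : ∀ k : ℕ, β + (2 * k : ℤ) • δ ∈ R := by
    intro k
    induction k with
    | zero => simpa using hβ
    | succ k ih =>
      have h3 := hstep _ ih
      have h4 := hflip (-(2 * k + 2)) (by rwa [neg_smul, ← sub_eq_add_neg])
      have e : β - (-(2 * (k : ℤ) + 2)) • δ = β + (2 * ((k + 1 : ℕ) : ℤ)) • δ := by
        rw [neg_smul, sub_neg_eq_add]; congr 2
      rwa [e] at h4
  apply h.eq_zero
  intro η hη
  have hc : ∀ k : ℕ, ∃ n : ℤ, 2 * form η (β + (2 * k : ℤ) • δ) = (n : F) * form β β ∧ |n| ≤ 4 := by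
    intro k
    have hk := hall k
    have hnk := hnorm (2 * k)
    obtain ⟨n, hn⟩ := h.car hk (by rwa [hnk]) hη
    refine ⟨n, by rw [hn, hnk], h.car_bound hk (by rwa [hnk]) hη hn⟩
  obtain ⟨n0, a0, b0⟩ := hc 0
  obtain ⟨n1, a1, b1⟩ := hc 1
  obtain ⟨n9, a9, b9⟩ := hc 9
  simp only [h.sf.add_right, h.sf.zsmul_right] at a0 a1 a9
  have e : ((n9 - n0 : ℤ) : F) = ((9 * (n1 - n0) : ℤ) : F) := by
    apply mul_right_cancel₀ hr
    push_cast at a0 a1 a9 ⊢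
    linear_combination -a9 + 9 * a1 - 8 * a0
  have e' : n9 - n0 = 9 * (n1 - n0) := by exact_mod_cast e
  rw [abs_le] at b0 b1 b9
  have e2 : n1 = n0 := by omega
  subst e2
  have h4 : (4 : F) ≠ 0 := by norm_num
  apply mul_left_cancel₀ h4
  rw [h.sf.symm]
  push_cast at a0 a1
  linear_combination a1 - a0

/-- real roots of the same norm with Cartan integer `2` agree -/
theorem IsLFRSS.eq_of_two (h : IsLFRSS form R) {α β : A} (hα : α ∈ R) (hr : form α α ≠ 0)
    (hβ : β ∈ R) (hs : form β β = form α α) (hm : form β α = form α α) : β = α := by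
  have key : α - β = 0 := by
    apply h.delta_zero hα hr (δ := α - β)
    · rw [h.sf.sub_right, h.sf.symm α β, hm, sub_self]
    · simp only [h.sf.sub_right, h.sf.sub_left, h.sf.symm α β, hm, hs]; ring
    · intro j hj
      have := h.refl_mem hβ (by rwa [hs]) hj (n := 2) (by
        simp only [h.sf.add_left, h.sf.sub_left, h.sf.zsmul_left, h.sf.symm α β, hm, hs]
        push_cast; ring)
      have := h.neg this
      have e : -(α + j • (α - β) - (2 : ℤ) • β) = α - (j + 2) • (α - β) := by
        rw [add_smul, two_smul, two_smul]; abel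
      rwa [e] at this
  exact (sub_eq_zero.1 key).symm

theorem IsLFRSS.eq_of_neg_two (h : IsLFRSS form R) {α β : A} (hα : α ∈ R) (hr : form α α ≠ 0)
    (hβ : β ∈ R) (hs : form β β = form α α) (hm : form β α = -form α α) : β = -α := by
  have := h.eq_of_two hα hr (h.neg hβ) (by simp [h.sf.neg_left, h.sf.neg_right, hs])
    (by simp [h.sf.neg_left, hm])
  rw [← this, neg_neg]

/-- real roots of the same norm -/
theorem IsLFRSS.same_norm (h : IsLFRSS form R) {α β : A} (hα : α ∈ R) (hr : form α α ≠ 0)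
    (hβ : β ∈ R) (hs : form β β = form α α) {m : ℤ} (hm : 2 * form β α = (m : F) * form α α) :
    β = α ∨ β = -α ∨ m = -1 ∨ m = 0 ∨ m = 1 := by
  have h1 := h.prod_le hα hr hβ (by rwa [hs]) hm (j := m) (by rw [hs, hm])
  have h2 : -2 ≤ m ∧ m ≤ 2 := by constructor <;> nlinarith
  have h3 : m = -2 ∨ m = -1 ∨ m = 0 ∨ m = 1 ∨ m = 2 := by omega
  have h0 : (2 : F) ≠ 0 := two_ne_zero
  rcases h3 with rfl | h3 | h3 | h3 | rfl
  · right; left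
    apply h.eq_of_neg_two hα hr hβ hs
    apply mul_left_cancel₀ h0; rw [hm]; push_cast; ring
  · simp [h3]
  · simp [h3]
  · simp [h3]
  · left
    apply h.eq_of_two hα hr hβ hs
    apply mul_left_cancel₀ h0; rw [hm]; push_cast; ring

end RankTwo


set_option linter.unusedSimpArgs false
set_option linter.unusedVariables false

section Ramsey

variable {α β : Type*}

theorem pigeon {X : Set α} (hX : X.Infinite) {T : Set β} (hT : T.Finite) (P : α → β → Prop)
    (hP : ∀ x ∈ X, ∃ b ∈ T, P x b) : ∃ b ∈ T, ∃ Y ⊆ X, Y.Infinite ∧ ∀ y ∈ Y, P y b := by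
  by_contra hcon
  push Not at hcon
  apply hX
  refine (hT.biUnion (t := fun b => {x ∈ X | P x b}) ?_).subset ?_
  · intro b hb
    by_contra hinf
    obtain ⟨y, hy, hy'⟩ := hcon b hb {x ∈ X | P x b} (fun x hx => hx.1) hinf
    exact hy' hy.2
  · intro x hx
    obtain ⟨b, hb, hPb⟩ := hP x hx
    exact Set.mem_biUnion hb ⟨hx, hPb⟩

theorem ramsey_aux (r : α → α → Prop) (hr : ∀ x y, r x y → r y x) (U : Ultrafilter α)
    (hU : (U : Filter α) ≤ Filter.cofinite) {G : Set α} (hG : G ∈ U)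
    (hGr : ∀ x ∈ G, {y | r x y} ∈ U) : ∃ Y ⊆ G, Y.Infinite ∧ Y.Pairwise r := by
  obtain ⟨Y, hY⟩ := zorn_subset {Y : Set α | Y ⊆ G ∧ Y.Pairwise r} (by
    intro c hc hchain
    refine ⟨⋃₀ c, ⟨Set.sUnion_subset fun s hs => (hc hs).1, ?_⟩, fun s hs => Set.subset_sUnion_of_mem hs⟩
    exact (Set.pairwise_sUnion hchain.directedOn).2 fun s hs => (hc hs).2)
  refine ⟨Y, hY.prop.1, ?_, hY.prop.2⟩
  intro hfin
  have h1 : (⋂ y ∈ Y, {z | r y z}) ∈ U :=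
    (Filter.biInter_mem hfin).2 fun y hy => hGr y (hY.prop.1 hy)
  have h2 : Yᶜ ∈ U := hU hfin.compl_mem_cofinite
  obtain ⟨z, ⟨hzG, hz1⟩, hz2⟩ := U.nonempty_of_mem (Filter.inter_mem (Filter.inter_mem hG h1) h2)
  have hz1' : ∀ y ∈ Y, r y z := by
    intro y hy
    exact Set.mem_iInter₂.1 hz1 y hy
  have := hY.le_of_ge (y := insert z Y) ⟨Set.insert_subset hzG hY.prop.1, by
    apply hY.prop.2.insert
    intro b hb _
    exact ⟨hr _ _ (hz1' b hb), hz1' b hb⟩⟩ (Set.subset_insert _ _)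
  exact hz2 (this (Set.mem_insert _ _))

theorem ramsey (r : α → α → Prop) (hr : ∀ x y, r x y → r y x) {X : Set α} (hX : X.Infinite) :
    ∃ Y ⊆ X, Y.Infinite ∧ (Y.Pairwise r ∨ Y.Pairwise fun x y => ¬ r x y) := by
  haveI : (Filter.cofinite ⊓ Filter.principal X).NeBot := hX.cofinite_inf_principal_neBot
  let U := Ultrafilter.of (Filter.cofinite ⊓ Filter.principal X)
  have hle : (U : Filter α) ≤ Filter.cofinite ⊓ Filter.principal X := Ultrafilter.of_le _
  have hc : (U : Filter α) ≤ Filter.cofinite := hle.trans inf_le_left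
  have hXU : X ∈ U := (hle.trans inf_le_right) (Filter.mem_principal_self X)
  rcases U.mem_or_compl_mem {x | {y | r x y} ∈ U} with h1 | h1
  · obtain ⟨Y, h2, h3, h4⟩ := ramsey_aux r hr U hc (Filter.inter_mem hXU h1) (fun x hx => hx.2)
    exact ⟨Y, fun y hy => (h2 hy).1, h3, Or.inl h4⟩
  · obtain ⟨Y, h2, h3, h4⟩ := ramsey_aux (fun x y => ¬ r x y) (fun x y hxy hyx => hxy (hr _ _ hyx))
      U hc (Filter.inter_mem hXU h1) (fun x hx => by
        have := hx.2
        simp only [Set.mem_compl_iff, Set.mem_setOf_eq] at this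
        exact U.compl_mem_iff_notMem.2 this)
    exact ⟨Y, fun y hy => (h2 hy).1, h3, Or.inr h4⟩

theorem inf_avoid {X : Set α} (hX : X.Infinite) (s : Finset α) : ∃ x ∈ X, x ∉ s := by
  obtain ⟨x, hx⟩ := (hX.diff s.finite_toSet).nonempty
  exact ⟨x, hx.1, by simpa using hx.2⟩

end Ramsey

section Frames

variable {F : Type*} [Field F] [CharZero F] {A : Type*} [AddCommGroup A] {form : A → A → F}
  {R : Set A}

theorem IsLFRSS.reflMany (h : IsLFRSS form R) {ι : Type*} (s : Finset ι) (g : ι → A) (n : ι → ℤ)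
    {β : A} (hβ : β ∈ R) (hg : ∀ i ∈ s, g i ∈ R) (hr : ∀ i ∈ s, form (g i) (g i) ≠ 0)
    (ho : ∀ i ∈ s, ∀ j ∈ s, i ≠ j → form (g i) (g j) = 0)
    (hn : ∀ i ∈ s, 2 * form β (g i) = (n i : F) * form (g i) (g i)) :
    β - ∑ i ∈ s, n i • g i ∈ R := by
  classical
  induction s using Finset.induction_on with
  | empty => simpa using hβ
  | insert i s hi ih =>
    have h1 := ih (fun j hj => hg j (Finset.mem_insert_of_mem hj))
      (fun j hj => hr j (Finset.mem_insert_of_mem hj))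
      (fun j hj k hk => ho j (Finset.mem_insert_of_mem hj) k (Finset.mem_insert_of_mem hk))
      (fun j hj => hn j (Finset.mem_insert_of_mem hj))
    have hi' := Finset.mem_insert_self i s
    have h2 := h.refl_mem (hg i hi') (hr i hi') h1 (n := n i) (by
      rw [h.sf.sub_left, h.sf.sum_left, Finset.sum_eq_zero, sub_zero, hn i hi']
      intro j hj
      rw [h.sf.zsmul_left, ho j (Finset.mem_insert_of_mem hj) i hi', mul_zero]
      rintro rfl; exact hi hj)
    rw [Finset.sum_insert hi]
    convert h2 using 1
    abel

theorem IsLFRSS.mem_rad (h : IsLFRSS form R) {a : A} : a ∈ formRadical form ↔ a = 0 := by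
  constructor
  · exact h.2 a
  · rintro rfl; exact fun b => h.sf.zero_left b

theorem IsLFRSS.exists_nb (h : IsLFRSS form R) {a : A} (ha : a ≠ 0) : ∃ b ∈ R, form a b ≠ 0 := by
  by_contra hcon
  push Not at hcon
  exact ha (h.eq_zero hcon)

theorem IsLFRSS.diam (h : IsLFRSS form R) (hc : IsConnectedSet form (R \ formRadical form))
    {a x : A} (ha : a ∈ R) (ha0 : a ≠ 0) (hx : x ∈ R) (hx0 : x ≠ 0) :
    ∃ t ∈ R, form a t ≠ 0 ∧ form t x ≠ 0 := by
  obtain ⟨n, c, h1, h2, h3, h4⟩ := hc a ⟨ha, by rwa [h.mem_rad]⟩ x ⟨hx, by rwa [h.mem_rad]⟩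
  have key : ∀ k (hk : k < n + 1), ∃ t ∈ R, form a t ≠ 0 ∧ form t (c ⟨k, hk⟩) ≠ 0 := by
    intro k
    induction k with
    | zero =>
      intro hk
      obtain ⟨b, hb, hb'⟩ := h.exists_nb ha0
      refine ⟨b, hb, hb', ?_⟩
      have : (⟨0, hk⟩ : Fin (n + 1)) = 0 := rfl
      rw [this, h2, h.sf.symm]; exact hb'
    | succ k ih =>
      intro hk
      obtain ⟨t, ht, ht1, ht2⟩ := ih (by omega)
      have h5 := h4 ⟨k, by omega⟩
      have e1 : (⟨k, by omega⟩ : Fin n).castSucc = ⟨k, by omega⟩ := rfl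
      have e2 : (⟨k, by omega⟩ : Fin n).succ = ⟨k + 1, hk⟩ := rfl
      rw [e1, e2] at h5
      have hy := (h1 ⟨k, by omega⟩).1
      set y := c ⟨k, by omega⟩
      set z := c ⟨k + 1, hk⟩
      by_cases h6 : form t z = 0
      · by_cases h7 : form a y = 0
        · rcases h.add_or_sub ht hy ht2 with h8 | h8
          · exact ⟨_, h8, by rwa [h.sf.add_right, h7, add_zero], by rwa [h.sf.add_left, h6, zero_add]⟩
          · exact ⟨_, h8, by rwa [h.sf.sub_right, h7, sub_zero], by
              rw [h.sf.sub_left, h6, zero_sub]; exact neg_ne_zero.2 h5⟩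
        · exact ⟨y, hy, h7, h5⟩
      · exact ⟨t, ht, ht1, h6⟩
  obtain ⟨t, ht⟩ := key n (by omega)
  have : (⟨n, by omega⟩ : Fin (n + 1)) = Fin.last n := rfl
  rw [this, h3] at ht
  exact ⟨t, ht⟩

theorem IsLFRSS.inf_deg (h : IsLFRSS form R) (hc : IsConnectedSet form (R \ formRadical form))
    (hinf : R.Infinite) : ∃ t ∈ R, {β ∈ R | form t β ≠ 0}.Infinite := by
  classical
  obtain ⟨a, ha, ha0⟩ := inf_avoid hinf {0}
  rw [Finset.mem_singleton] at ha0
  by_contra hcon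
  push Not at hcon
  apply hinf
  refine (((hcon a ha).biUnion (t := fun t => {β ∈ R | form t β ≠ 0})
    fun t ht => hcon t ht.1).insert 0).subset ?_
  intro x hx
  by_cases hx0 : x = 0
  · simp [hx0]
  · right
    obtain ⟨t, ht, h1, h2⟩ := h.diam hc ha ha0 hx hx0
    exact Set.mem_biUnion (x := t) ⟨ht, h1⟩ ⟨hx, h2⟩

/-- a frame: a set whose differences are real roots of norm `2 c` -/
def IsFrame (form : A → A → F) (R : Set A) (c : F) (V : Set A) : Prop :=
  c ≠ 0 ∧ ∀ x ∈ V, ∀ y ∈ V, x ≠ y → x - y ∈ R ∧ form (x - y) (x - y) = 2 * c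

def HasFrame (form : A → A → F) (R : Set A) : Prop :=
  ∃ c : F, ∃ V : Set A, IsFrame form R c V ∧ V.Infinite

theorem IsLFRSS.tri (h : IsLFRSS form R) {N : F} (hN : N ≠ 0) {b0 b1 b2 b3 : A} (h0 : b0 ∈ R)
    (h1 : b1 ∈ R) (h2 : b2 ∈ R) (h3 : b3 ∈ R) (n0 : form b0 b0 = N) (n1 : form b1 b1 = N)
    (n2 : form b2 b2 = N) (n3 : form b3 b3 = N) (p01 : 2 * form b0 b1 = -N)
    (p02 : 2 * form b2 b0 = -N) (p12 : 2 * form b2 b1 = -N) (p03 : 2 * form b3 b0 = -N)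
    (p13 : 2 * form b3 b1 = -N) : b2 = b3 := by
  have hs : b0 + b1 ∈ R := h.str_add h1 (by rwa [n1]) h0 (n := -1)
    (by rw [p01, n1]; push_cast; ring) le_rfl
  have hn : form (b0 + b1) (b0 + b1) = N := by
    simp only [h.sf.add_left, h.sf.add_right, n0, n1, h.sf.symm b1 b0]
    linear_combination p01
  have h20 : (2 : F) ≠ 0 := two_ne_zero
  have e2 := h.eq_of_neg_two hs (by rwa [hn]) h2 (by rw [hn, n2]) (by
    rw [hn, h.sf.add_right]; apply mul_left_cancel₀ h20; linear_combination p02 + p12)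
  have e3 := h.eq_of_neg_two hs (by rwa [hn]) h3 (by rw [hn, n3]) (by
    rw [hn, h.sf.add_right]; apply mul_left_cancel₀ h20; linear_combination p03 + p13)
  rw [e2, e3]

theorem IsLFRSS.frameA (h : IsLFRSS form R) {X : Set A} (hX : X.Infinite) (hXR : X ⊆ R)
    (hre : ∀ x ∈ X, form x x ≠ 0) (hno : ∀ x ∈ X, ∀ y ∈ X, x ≠ y → form x y ≠ 0) :
    HasFrame form R := by
  classical
  have h20 : (2 : F) ≠ 0 := two_ne_zero
  obtain ⟨x0, hx0⟩ := hX.nonempty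
  obtain ⟨⟨m, j⟩, -, Y, hYX, hY, hYP⟩ := pigeon hX
    (T := (Set.Icc (-4) 4 ×ˢ Set.Icc (-4) 4 : Set (ℤ × ℤ)))
    ((Set.finite_Icc _ _).prod (Set.finite_Icc _ _))
    (fun x p => 2 * form x x0 = (p.1 : F) * form x0 x0 ∧ 2 * form x x0 = (p.2 : F) * form x x) (by
      intro x hx
      obtain ⟨m, hm⟩ := h.car (hXR hx0) (hre _ hx0) (hXR hx)
      obtain ⟨j, hj⟩ := h.car (hXR hx) (hre _ hx) (hXR hx0)
      have b1 := h.car_bound (hXR hx0) (hre _ hx0) (hXR hx) hm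
      have b2 := h.car_bound (hXR hx) (hre _ hx) (hXR hx0) hj
      rw [abs_le] at b1 b2
      exact ⟨(m, j), ⟨b1, b2⟩, hm, by rw [h.sf.symm, hj]⟩)
  obtain ⟨y0, hy0⟩ := hY.nonempty
  set N := form y0 y0 with hNdef
  have hN : N ≠ 0 := hre _ (hYX hy0)
  have hj0 : (j : F) ≠ 0 := by
    intro h0
    have := (hYP y0 hy0).2
    simp only at this
    rw [h0, zero_mul] at this
    have h1 : form y0 x0 ≠ 0 := by
      by_cases e : y0 = x0
      · rw [e]; exact hre _ hx0
      · exact hno _ (hYX hy0) _ hx0 e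
    exact mul_ne_zero h20 h1 this
  have hYN : ∀ y ∈ Y, form y y = N := by
    intro y hy
    apply mul_left_cancel₀ hj0
    have h1 := hYP y hy
    have h2 := hYP y0 hy0
    simp only at h1 h2
    rw [← h1.2, ← h2.2, h1.1, h2.1]
  have hpair : ∀ x ∈ Y, ∀ y ∈ Y, x ≠ y → x = -y ∨ 2 * form x y = -N ∨ 2 * form x y = N := by
    intro x hx y hy hxy
    have hyr : form y y ≠ 0 := by rw [hYN y hy]; exact hN
    obtain ⟨m, hm⟩ := h.car (hXR (hYX hy)) hyr (hXR (hYX hx))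
    rcases h.same_norm (hXR (hYX hy)) hyr (hXR (hYX hx)) (by rw [hYN y hy, hYN x hx]) hm with
      h1 | h1 | h1 | h1 | h1
    · exact absurd h1 hxy
    · exact Or.inl h1
    · right; left; rw [hm, h1, hYN y hy]; push_cast; ring
    · exfalso
      rw [h1] at hm
      simp at hm
      exact hno _ (hYX hx) _ (hYX hy) hxy hm
    · right; right; rw [hm, h1, hYN y hy]; push_cast; ring
  obtain ⟨Z, hZY, hZ, hZr⟩ := ramsey (fun x y => 2 * form x y = N)
    (fun x y hxy => by rw [h.sf.symm]; exact hxy) hY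
  rcases hZr with hZr | hZr
  · refine ⟨N / 2, Z, ⟨div_ne_zero hN h20, ?_⟩, hZ⟩
    intro x hx y hy hxy
    have h1 := hZr hx hy hxy
    simp only at h1
    constructor
    · exact h.str_sub (hXR (hYX (hZY hy))) (by rwa [hYN _ (hZY hy)]) (hXR (hYX (hZY hx))) (n := 1)
        (by rw [h1, hYN _ (hZY hy)]; simp) le_rfl
    · simp only [h.sf.sub_left, h.sf.sub_right, hYN _ (hZY hx), hYN _ (hZY hy), h.sf.symm y x]
      field_simp
      linear_combination -h1
  · exfalso
    obtain ⟨b0, hb0⟩ := hZ.nonempty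
    obtain ⟨b1, hb1, hn1⟩ := inf_avoid hZ {b0, -b0}
    obtain ⟨b2, hb2, hn2⟩ := inf_avoid hZ {b0, -b0, b1, -b1}
    obtain ⟨b3, hb3, hn3⟩ := inf_avoid hZ {b0, -b0, b1, -b1, b2}
    simp only [Finset.mem_insert, Finset.mem_singleton, not_or] at hn1 hn2 hn3
    have key : ∀ x ∈ Z, ∀ y ∈ Z, x ≠ y → x ≠ -y → 2 * form x y = -N := by
      intro x hx y hy h1 h2
      rcases hpair x (hZY hx) y (hZY hy) h1 with h3 | h3 | h3
      · exact absurd h3 h2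
      · exact h3
      · exact absurd h3 (hZr hx hy h1)
    have hR : ∀ z ∈ Z, z ∈ R := fun z hz => hXR (hYX (hZY hz))
    have hNN : ∀ z ∈ Z, form z z = N := fun z hz => hYN _ (hZY hz)
    have := h.tri hN (hR _ hb0) (hR _ hb1) (hR _ hb2) (hR _ hb3) (hNN _ hb0) (hNN _ hb1)
      (hNN _ hb2) (hNN _ hb3) (by rw [h.sf.symm]; exact key _ hb1 _ hb0 hn1.1 hn1.2)
      (key _ hb2 _ hb0 hn2.1 hn2.2.1) (key _ hb2 _ hb1 hn2.2.2.1 hn2.2.2.2)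
      (key _ hb3 _ hb0 hn3.1 hn3.2.1) (key _ hb3 _ hb1 hn3.2.2.1 hn3.2.2.2.1)
    exact hn3.2.2.2.2 this.symm

theorem IsLFRSS.s2a (h : IsLFRSS form R) {α : A} (hα : α ∈ R) (hr : form α α ≠ 0) {X : Set A}
    (hX : X.Infinite) (hXR : X ⊆ R) (hre : ∀ x ∈ X, form x x ≠ 0)
    (hno : ∀ x ∈ X, form α x ≠ 0) : HasFrame form R := by
  classical
  obtain ⟨Y, hYX, hY, hYr⟩ := ramsey (fun x y => form x y ≠ 0)
    (fun x y hxy => by rw [h.sf.symm]; exact hxy) hX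
  rcases hYr with hYr | hYr
  · exact h.frameA hY (hYX.trans hXR) (fun x hx => hre x (hYX hx))
      (fun x hx y hy hxy => hYr hx hy hxy)
  · exfalso
    obtain ⟨s, hs, hcard⟩ := hY.exists_subset_card_eq 7
    have hex : ∀ b : A, ∃ n n' : ℤ, b ∈ s → 2 * form α b = (n : F) * form b b ∧
        2 * form α b = (n' : F) * form α α ∧ 1 ≤ n * n' := by
      intro b
      by_cases hb : b ∈ s
      · have hb' := hYX (hs hb)
        obtain ⟨n, hn⟩ := h.car (hXR hb') (hre _ hb') hα
        obtain ⟨n', hn'⟩ := h.car hα hr (hXR hb')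
        rw [h.sf.symm] at hn'
        exact ⟨n, n', fun _ => ⟨hn, hn', h.prod_ge (hXR hb') (hre _ hb') hα hr hn hn' (hno _ hb')⟩⟩
      · exact ⟨0, 0, fun h => absurd h hb⟩
    choose n n' hn using hex
    have h1 := h.reflMany s id n hα (fun i hi => hXR (hYX (hs hi))) (fun i hi => hre _ (hYX (hs hi)))
      (fun i hi j hj hij => by
        have := hYr (hs hi) (hs hj) hij
        simp only [not_not] at this
        exact this) (fun i hi => (hn i hi).1)
    have h2 : 2 * form (α - ∑ i ∈ s, n i • id i) α
        = ((2 - ∑ i ∈ s, n i * n' i : ℤ) : F) * form α α := by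
      rw [h.sf.sub_left, h.sf.sum_left]
      push_cast
      rw [sub_mul, mul_sub, Finset.mul_sum, Finset.sum_mul]
      congr 1
      apply Finset.sum_congr rfl
      intro i hi
      rw [h.sf.zsmul_left, id, h.sf.symm]
      linear_combination (n i : F) * (hn i hi).2.1
    have h3 := h.car_bound hα hr h1 h2
    have h4 : ∑ i ∈ s, (1 : ℤ) ≤ ∑ i ∈ s, n i * n' i := Finset.sum_le_sum fun i hi => (hn i hi).2.2
    rw [abs_le] at h3
    simp [hcard] at h4
    omega

end Frames


set_option linter.unusedSimpArgs false
set_option linter.unusedVariables false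

section Frames2

variable {F : Type*} [Field F] [CharZero F] {A : Type*} [AddCommGroup A] {form : A → A → F}
  {R : Set A}

theorem IsLFRSS.s2b_orth2 (h : IsLFRSS form R) {α : A} (hα : α ∈ R) (hr : form α α ≠ 0)
    {b1 b2 : A} (h1 : b1 ∈ R) (h2 : b2 ∈ R) (n1 : form b1 b1 = 0) (n2 : form b2 b2 = 0)
    (p1 : form b1 α = form α α) (p2 : form b2 α = form α α) (p12 : form b1 b2 = 0) : b1 = b2 := by
  have g1 : b1 - α ∈ R := h.str_sub hα hr h1 (n := 2) (by rw [p1]; push_cast; ring) (by norm_num)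
  have g2 : b2 - α ∈ R := h.str_sub hα hr h2 (n := 2) (by rw [p2]; push_cast; ring) (by norm_num)
  have e1 : form (b1 - α) (b1 - α) = - form α α := by
    simp only [h.sf.sub_left, h.sf.sub_right, h.sf.symm α b1, n1, p1]; ring
  have e2 : form (b2 - α) (b2 - α) = - form α α := by
    simp only [h.sf.sub_left, h.sf.sub_right, h.sf.symm α b2, n2, p2]; ring
  have e3 : form (b1 - α) (b2 - α) = - form α α := by
    simp only [h.sf.sub_left, h.sf.sub_right, h.sf.symm α b2, p12, p1, p2]; ring
  have := h.eq_of_two g2 (by rw [e2]; simpa using hr) g1 (by rw [e1, e2]) (by rw [e3, e2])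
  simpa using this

theorem IsLFRSS.s2b_eta (h : IsLFRSS form R) {α : A} (hα : α ∈ R) (hr : form α α ≠ 0)
    {b1 b2 : A} (h1 : b1 ∈ R) (h2 : b2 ∈ R) (n1 : form b1 b1 = 0) (n2 : form b2 b2 = 0)
    (p1 : 2 * form b1 α = form α α) (p2 : 2 * form b2 α = form α α) (p12 : form b1 b2 = 0)
    (hne : b1 ≠ b2) : b1 + b2 - α ∈ R := by
  have h20 : (2 : F) ≠ 0 := two_ne_zero
  have g1 : b1 - α ∈ R := h.str_sub hα hr h1 (n := 1) (by rw [p1]; push_cast; ring) (by norm_num)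
  have e1 : 2 * form (b1 - α) b2 = - form α α := by
    simp only [h.sf.sub_left, h.sf.symm α b2, p12]; linear_combination -p2
  have e1' : form (b1 - α) b2 ≠ 0 := by
    intro h0; rw [h0] at e1; apply hr; linear_combination e1
  rcases h.add_or_sub g1 h2 e1' with h3 | h3
  · convert h3 using 1; abel
  · exfalso
    have e2 : form (b1 - α - b2) (b1 - α - b2) = form α α := by
      simp only [h.sf.sub_left, h.sf.sub_right, h.sf.symm α b2, h.sf.symm α b1, h.sf.symm b2 b1,
        n1, n2, p12]
      linear_combination -p1 + p2
    have e3 : form (b1 - α - b2) α = - form α α := by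
      simp only [h.sf.sub_left, h.sf.sub_right]
      apply mul_left_cancel₀ h20
      linear_combination p1 - p2
    have := h.eq_of_neg_two hα hr h3 e2 e3
    apply hne
    have e4 : b1 - b2 = 0 := by
      have : b1 - α - b2 + α = 0 := by rw [this]; simp
      rw [← this]; abel
    exact sub_eq_zero.1 e4

theorem IsLFRSS.s2b_orth1 (h : IsLFRSS form R) {α : A} (hα : α ∈ R) (hr : form α α ≠ 0)
    {b1 b2 b3 : A} (h1 : b1 ∈ R) (h2 : b2 ∈ R) (h3 : b3 ∈ R) (n1 : form b1 b1 = 0)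
    (n2 : form b2 b2 = 0) (n3 : form b3 b3 = 0)
    (p1 : 2 * form b1 α = form α α) (p2 : 2 * form b2 α = form α α) (p3 : 2 * form b3 α = form α α)
    (p12 : form b1 b2 = 0) (p13 : form b1 b3 = 0) (p23 : form b2 b3 = 0)
    (hne2 : b1 ≠ b2) (hne3 : b1 ≠ b3) : b2 = b3 := by
  have g2 := h.s2b_eta hα hr h1 h2 n1 n2 p1 p2 p12 hne2
  have g3 := h.s2b_eta hα hr h1 h3 n1 n3 p1 p3 p13 hne3
  have e2 : form (b1 + b2 - α) (b1 + b2 - α) = - form α α := by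
    simp only [h.sf.sub_left, h.sf.sub_right, h.sf.add_left, h.sf.add_right, h.sf.symm α b1,
      h.sf.symm α b2, h.sf.symm b2 b1, n1, n2, p12]
    linear_combination -p1 - p2
  have e3 : form (b1 + b3 - α) (b1 + b3 - α) = - form α α := by
    simp only [h.sf.sub_left, h.sf.sub_right, h.sf.add_left, h.sf.add_right, h.sf.symm α b1,
      h.sf.symm α b3, h.sf.symm b3 b1, n1, n3, p13]
    linear_combination -p1 - p3
  have e4 : 2 * form (b1 + b2 - α) (b1 + b3 - α) = - 2 * form α α := by
    simp only [h.sf.sub_left, h.sf.sub_right, h.sf.add_left, h.sf.add_right, h.sf.symm α b1,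
      h.sf.symm α b3, h.sf.symm b2 b1, n1, n3, p12, p13, p23]
    linear_combination -2 * p1 - p3 - p2
  have h20 : (2 : F) ≠ 0 := two_ne_zero
  have := h.eq_of_two g3 (by rw [e3]; simpa using hr) g2 (by rw [e2, e3]) (by
    rw [e3]; apply mul_left_cancel₀ h20; rw [e4]; ring)
  simpa using this

theorem IsLFRSS.s2b_aux (h : IsLFRSS form R) {α : A} (hα : α ∈ R) (hr : form α α ≠ 0) {X : Set A}
    (hX : X.Infinite) (hXR : X ⊆ R) (hns : ∀ x ∈ X, form x x = 0) {n : ℤ} (hn : n = 1 ∨ n = 2)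
    (hno : ∀ x ∈ X, 2 * form x α = (n : F) * form α α) : HasFrame form R := by
  classical
  have h20 : (2 : F) ≠ 0 := two_ne_zero
  obtain ⟨Y, hYX, hY, hYr⟩ := ramsey (fun x y => form x y ≠ 0)
    (fun x y hxy => by rw [h.sf.symm]; exact hxy) hX
  have hYR : ∀ y ∈ Y, y ∈ R := fun y hy => hXR (hYX hy)
  have hYn : ∀ y ∈ Y, form y y = 0 := fun y hy => hns _ (hYX hy)
  have hYp : ∀ y ∈ Y, 2 * form y α = (n : F) * form α α := fun y hy => hno _ (hYX hy)
  rcases hYr with hYr | hYr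
  · obtain ⟨Z, hZY, hZ, hZr⟩ := ramsey (fun x y => x - y ∈ R)
      (fun x y hxy => h.sub_comm hxy) hY
    obtain ⟨g, hg⟩ := hZ.nonempty
    have hgY := hZY hg
    rcases hZr with hZr | hZr
    · have hZ1 : (Z \ {g}).Infinite := hZ.diff (Set.finite_singleton g)
      have hd : ∀ x ∈ Z \ {g}, g - x ∈ R ∧ form (g - x) (g - x) = - 2 * form g x ∧ form g x ≠ 0 := by
        intro x hx
        have hne : g ≠ x := fun e => hx.2 e.symm
        refine ⟨hZr hg hx.1 hne, ?_, hYr hgY (hZY hx.1) hne⟩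
        simp only [h.sf.sub_left, h.sf.sub_right, hYn _ hgY, hYn _ (hZY hx.1), h.sf.symm x g]
        ring
      have hd' : ∀ x ∈ Z \ {g}, form (g - x) (g - x) ≠ 0 := by
        intro x hx
        rw [(hd x hx).2.1]
        exact mul_ne_zero (by norm_num) (hd x hx).2.2
      obtain ⟨W, hWZ, hW, hWr⟩ := ramsey (fun x y => form (g - x) (g - y) ≠ 0)
        (fun x y hxy => by rw [h.sf.symm]; exact hxy) hZ1
      rcases hWr with hWr | hWr
      · refine h.frameA (X := (fun x => g - x) '' W) (hW.image (fun x _ y _ e => by simpa using e))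
          ?_ ?_ ?_
        · rintro _ ⟨x, hx, rfl⟩; exact (hd x (hWZ hx)).1
        · rintro _ ⟨x, hx, rfl⟩; exact hd' x (hWZ hx)
        · rintro _ ⟨x, hx, rfl⟩ _ ⟨y, hy, rfl⟩ hxy
          exact hWr hx hy (fun e => hxy (by rw [e]))
      · have hkey : ∀ x ∈ W, ∀ y ∈ W, x ≠ y → x - y ∈ R ∧
            form (x - y) (x - y) = form (g - x) (g - x) + form (g - y) (g - y) ∧
            form (x - y) (x - y) ≠ 0 ∧ form (g - y) (x - y) = form (g - y) (g - y) := by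
          intro x hx y hy hxy
          have o := hWr hx hy hxy
          simp only [not_not] at o
          have exy : x - y = (g - y) - (g - x) := by abel
          refine ⟨hZr (hWZ hx).1 (hWZ hy).1 hxy, ?_, ?_, ?_⟩
          · conv_lhs => rw [exy, h.sf.sub_left, h.sf.sub_right, h.sf.sub_right _ _ (g - x), h.sf.symm (g - y) (g - x), o]
            ring
          · have := hYr (hZY (hWZ hx).1) (hZY (hWZ hy).1) hxy
            simp only [h.sf.sub_left, h.sf.sub_right, hYn _ (hZY (hWZ hx).1), hYn _ (hZY (hWZ hy).1),
              h.sf.symm y x]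
            intro h0
            apply this
            apply mul_left_cancel₀ h20
            linear_combination -h0
          · conv_lhs => rw [exy, h.sf.sub_right, h.sf.symm (g - y) (g - x), o, sub_zero]
        have heq : ∀ x ∈ W, ∀ y ∈ W, form (g - x) (g - x) = form (g - y) (g - y) := by
          have hk : ∀ x ∈ W, ∀ y ∈ W, x ≠ y → ∃ k : ℤ, 1 ≤ k ∧
              2 * form (g - y) (g - y) = (k : F) * form (x - y) (x - y) := by
            intro x hx y hy hxy
            obtain ⟨k1, k2, k3, k4⟩ := hkey x hx y hy hxy
            obtain ⟨k, hk⟩ := h.car k1 k3 (hd y (hWZ hy)).1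
            have := h.prod_ge k1 k3 (hd y (hWZ hy)).1 (hd' y (hWZ hy)) hk (j := 2)
              (by rw [k4]; push_cast; ring) (by rw [k4]; exact hd' y (hWZ hy))
            exact ⟨k, by omega, by rw [← hk, k4]⟩
          intro x hx y hy
          by_cases hxy : x = y
          · rw [hxy]
          obtain ⟨k, hk1, hk2⟩ := hk x hx y hy hxy
          obtain ⟨l, hl1, hl2⟩ := hk y hy x hx (Ne.symm hxy)
          obtain ⟨k1, k2, k3, k4⟩ := hkey x hx y hy hxy
          obtain ⟨l1, l2, l3, l4⟩ := hkey y hy x hx (Ne.symm hxy)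
          have e : ((k + l : ℤ) : F) = ((2 : ℤ) : F) := by
            apply mul_right_cancel₀ k3
            push_cast
            rw [l2] at hl2; rw [k2] at hk2 ⊢
            linear_combination -hk2 - hl2
          have e' : k + l = 2 := by exact_mod_cast e
          have ek : k = 1 := by omega
          rw [ek, k2] at hk2
          push_cast at hk2
          linear_combination -hk2
        obtain ⟨w, hw⟩ := hW.nonempty
        refine ⟨form (g - w) (g - w), W, ⟨hd' w (hWZ hw), ?_⟩, hW⟩
        intro x hx y hy hxy
        obtain ⟨k1, k2, k3, k4⟩ := hkey x hx y hy hxy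
        refine ⟨k1, ?_⟩
        rw [k2, heq x hx w hw, heq y hy w hw]; ring
    · refine h.s2a hα hr (X := (fun x => g + x) '' (Z \ {g}))
        ((hZ.diff (Set.finite_singleton g)).image (fun x _ y _ e => by simpa using e)) ?_ ?_ ?_
      · rintro _ ⟨x, hx, rfl⟩
        have hne : g ≠ x := fun e => hx.2 e.symm
        rcases h.add_or_sub (hYR _ hgY) (hYR _ (hZY hx.1)) (hYr hgY (hZY hx.1) hne) with h1 | h1
        · exact h1
        · exact absurd h1 (hZr hg hx.1 hne)
      · rintro _ ⟨x, hx, rfl⟩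
        have hne : g ≠ x := fun e => hx.2 e.symm
        simp only [h.sf.add_left, h.sf.add_right, hYn _ hgY, hYn _ (hZY hx.1), h.sf.symm x g]
        intro h0
        apply hYr hgY (hZY hx.1) hne
        apply mul_left_cancel₀ h20
        linear_combination h0
      · rintro _ ⟨x, hx, rfl⟩
        have e1 := hYp _ hgY
        have e2 := hYp _ (hZY hx.1)
        rw [h.sf.symm, h.sf.add_left]
        intro h0
        have : ((2 * n : ℤ) : F) * form α α = 0 := by push_cast; linear_combination -e1 - e2 + 2 * h0
        have := (mul_eq_zero.1 this).resolve_right hr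
        have : 2 * n = 0 := by exact_mod_cast this
        omega
  · exfalso
    have o : ∀ x ∈ Y, ∀ y ∈ Y, x ≠ y → form x y = 0 := by
      intro x hx y hy hxy
      have := hYr hx hy hxy
      simpa using this
    obtain ⟨b1, h1⟩ := hY.nonempty
    obtain ⟨b2, h2, m2⟩ := inf_avoid hY {b1}
    obtain ⟨b3, h3, m3⟩ := inf_avoid hY {b1, b2}
    simp only [Finset.mem_insert, Finset.mem_singleton, not_or] at m2 m3
    rcases hn with rfl | rfl
    · simp only [Int.cast_one, one_mul] at hYp
      exact m3.2 (h.s2b_orth1 hα hr (hYR _ h1) (hYR _ h2) (hYR _ h3) (hYn _ h1) (hYn _ h2) (hYn _ h3)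
        (hYp _ h1) (hYp _ h2) (hYp _ h3) (o _ h1 _ h2 (Ne.symm m2)) (o _ h1 _ h3 (Ne.symm m3.1))
        (o _ h2 _ h3 (Ne.symm m3.2)) (Ne.symm m2) (Ne.symm m3.1)).symm
    · exact m2 (h.s2b_orth2 hα hr (hYR _ h1) (hYR _ h2) (hYn _ h1) (hYn _ h2)
        (by apply mul_left_cancel₀ h20; rw [hYp _ h1]; push_cast; ring)
        (by apply mul_left_cancel₀ h20; rw [hYp _ h2]; push_cast; ring)
        (o _ h1 _ h2 (Ne.symm m2))).symm

theorem IsLFRSS.s2b (h : IsLFRSS form R) {α : A} (hα : α ∈ R) (hr : form α α ≠ 0) {X : Set A}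
    (hX : X.Infinite) (hXR : X ⊆ R) (hns : ∀ x ∈ X, form x x = 0)
    (hno : ∀ x ∈ X, form α x ≠ 0) : HasFrame form R := by
  obtain ⟨n, hnT, Y, hYX, hY, hYP⟩ := pigeon hX (T := ({-2, -1, 1, 2} : Set ℤ)) (by simp)
    (fun x n => 2 * form x α = (n : F) * form α α) (by
      intro x hx
      obtain ⟨m, hm⟩ := h.car hα hr (hXR hx)
      have b1 := h.ns_bound hα hr (hXR hx) (hns x hx) hm
      refine ⟨m, ?_, hm⟩
      have : m ≠ 0 := by
        rintro rfl
        simp at hm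
        exact hno x hx (by rw [h.sf.symm, hm])
      rw [abs_le] at b1
      simp only [Set.mem_insert_iff, Set.mem_singleton_iff]
      omega)
  simp only [Set.mem_insert_iff, Set.mem_singleton_iff] at hnT
  by_cases hn : n = 1 ∨ n = 2
  · exact h.s2b_aux hα hr hY (hYX.trans hXR) (fun x hx => hns _ (hYX hx)) hn hYP
  · refine h.s2b_aux (h.neg hα) (by simpa [h.sf.neg_left, h.sf.neg_right] using hr) hY
      (hYX.trans hXR) (fun x hx => hns _ (hYX hx)) (n := -n) (by omega) ?_
    intro x hx
    have := hYP x hx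
    simp only [h.sf.neg_left, h.sf.neg_right]
    push_cast
    linear_combination -this

theorem IsLFRSS.s2c (h : IsLFRSS form R) {α : A} (hα : α ∈ R) (hr : form α α = 0) {X : Set A}
    (hX : X.Infinite) (hXR : X ⊆ R) (hre : ∀ x ∈ X, form x x ≠ 0)
    (hno : ∀ x ∈ X, form α x ≠ 0) : HasFrame form R := by
  obtain ⟨Y, hYX, hY, hYr⟩ := ramsey (fun x y => form x y ≠ 0)
    (fun x y hxy => by rw [h.sf.symm]; exact hxy) hX
  rcases hYr with hYr | hYr
  · exact h.frameA hY (hYX.trans hXR) (fun x hx => hre x (hYX hx))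
      (fun x hx y hy hxy => hYr hx hy hxy)
  · have o : ∀ x ∈ Y, ∀ y ∈ Y, x ≠ y → form x y = 0 := by
      intro x hx y hy hxy
      have := hYr hx hy hxy
      simpa using this
    have hex : ∀ b : A, ∃ n : ℤ, b ∈ Y → 2 * form α b = (n : F) * form b b ∧ n ≠ 0 := by
      intro b
      by_cases hb : b ∈ Y
      · obtain ⟨n, hn⟩ := h.car (hXR (hYX hb)) (hre _ (hYX hb)) hα
        refine ⟨n, fun _ => ⟨hn, ?_⟩⟩
        rintro rfl
        simp at hn
        exact hno _ (hYX hb) hn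
      · exact ⟨0, fun h => absurd h hb⟩
    choose n hn using hex
    obtain ⟨b1, h1⟩ := hY.nonempty
    refine h.s2b (hXR (hYX h1)) (hre _ (hYX h1)) (X := (fun b => α - n b • b) '' (Y \ {b1}))
      ((hY.diff (Set.finite_singleton _)).image ?_) ?_ ?_ ?_
    · intro x hx y hy e
      by_contra hxy
      have e' : n x • x = n y • y := by simpa using e
      have : form (n x • x) x = form (n y • y) x := by rw [e']
      rw [h.sf.zsmul_left, h.sf.zsmul_left, o _ hy.1 _ hx.1 (Ne.symm hxy), mul_zero] at this
      refine mul_ne_zero ?_ (hre _ (hYX hx.1)) this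
      exact_mod_cast (hn x hx.1).2
    · rintro _ ⟨x, hx, rfl⟩
      exact h.refl_mem (hXR (hYX hx.1)) (hre _ (hYX hx.1)) hα (hn x hx.1).1
    · rintro _ ⟨x, hx, rfl⟩
      simp only [h.sf.sub_left, h.sf.sub_right, h.sf.zsmul_left, h.sf.zsmul_right, hr,
        h.sf.symm x α]
      linear_combination -(n x : F) * (hn x hx.1).1
    · rintro _ ⟨x, hx, rfl⟩
      simp only [h.sf.sub_right, h.sf.zsmul_right]
      rw [o _ h1 _ hx.1 (fun e => hx.2 e.symm), mul_zero, sub_zero, h.sf.symm]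
      exact hno _ (hYX h1)

theorem IsLFRSS.hasFrame (h : IsLFRSS form R) (hc : IsConnectedSet form (R \ formRadical form))
    (hinf : R.Infinite) : HasFrame form R := by
  have h20 : (2 : F) ≠ 0 := two_ne_zero
  obtain ⟨t, ht, hti⟩ := h.inf_deg hc hinf
  set X := {β ∈ R | form t β ≠ 0} with hXdef
  have hsplit : X = {x ∈ X | form x x ≠ 0} ∪ {x ∈ X | form x x = 0} := by
    ext x; by_cases hx : form x x = 0 <;> simp [hx]
  by_cases hr : form t t = 0
  · by_cases hfin : {x ∈ X | form x x ≠ 0}.Finite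
    · exfalso
      apply hti
      rw [hsplit]
      refine hfin.union (((hfin.image (fun x => x - t)).union (hfin.image (fun x => t - x))).subset ?_)
      rintro x ⟨⟨hxR, hx1⟩, hx2⟩
      rcases h.add_or_sub ht hxR hx1 with h1 | h1
      · left
        refine ⟨t + x, ⟨⟨h1, ?_⟩, ?_⟩, by simp⟩
        · rwa [h.sf.add_right, hr, zero_add]
        · simp only [h.sf.add_left, h.sf.add_right, hr, hx2, h.sf.symm x t]
          intro h0; apply hx1; apply mul_left_cancel₀ h20; linear_combination h0
      · right
        refine ⟨t - x, ⟨⟨h1, ?_⟩, ?_⟩, by simp⟩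
        · rw [h.sf.sub_right, hr, zero_sub]; simpa using hx1
        · simp only [h.sf.sub_left, h.sf.sub_right, hr, hx2, h.sf.symm x t]
          intro h0; apply hx1; apply mul_left_cancel₀ h20; linear_combination -h0
    · exact h.s2c ht hr hfin (fun x hx => hx.1.1) (fun x hx => hx.2) (fun x hx => hx.1.2)
  · rw [hsplit, Set.infinite_union] at hti
    rcases hti with h1 | h1
    · exact h.s2a ht hr h1 (fun x hx => hx.1.1) (fun x hx => hx.2) (fun x hx => hx.1.2)
    · exact h.s2b ht hr h1 (fun x hx => hx.1.1) (fun x hx => hx.2) (fun x hx => hx.1.2)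

end Frames2


set_option linter.unusedSimpArgs false
set_option linter.unusedVariables false

section Weights

variable {F : Type*} [Field F] [CharZero F] {A : Type*} [AddCommGroup A] {form : A → A → F}
  {R : Set A}

theorem inf_inj {ι α : Type*} {V : Set α} (hV : V.Infinite) (S : Finset ι) (T : Finset α) :
    ∃ f : ι → α, (∀ i ∈ S, f i ∈ V ∧ f i ∉ T) ∧ ∀ i ∈ S, ∀ j ∈ S, f i = f j → i = j := by
  classical
  induction S using Finset.induction_on with
  | empty =>
    obtain ⟨x, hx⟩ := hV.nonempty
    exact ⟨fun _ => x, by simp, by simp⟩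
  | insert i S hi ih =>
    obtain ⟨f, h1, h2⟩ := ih
    obtain ⟨z, hz, hz'⟩ := inf_avoid hV (T ∪ S.image f)
    simp only [Finset.mem_union, Finset.mem_image, not_or, not_exists, not_and] at hz'
    have hne : ∀ j ∈ S, j ≠ i := fun j hj e => hi (e ▸ hj)
    refine ⟨Function.update f i z, ?_, ?_⟩
    · intro j hj
      rcases Finset.mem_insert.1 hj with rfl | hj
      · simpa using ⟨hz, hz'.1⟩
      · rw [Function.update_of_ne (hne j hj)]; exact h1 j hj
    · intro j hj k hk e
      rcases Finset.mem_insert.1 hj with rfl | hj' <;> rcases Finset.mem_insert.1 hk with rfl | hk'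
      · rfl
      · rw [Function.update_self, Function.update_of_ne (hne k hk')] at e
        exact absurd e.symm (hz'.2 k hk')
      · rw [Function.update_self, Function.update_of_ne (hne j hj')] at e
        exact absurd e (hz'.2 j hj')
      · rw [Function.update_of_ne (hne k hk'), Function.update_of_ne (hne j hj')] at e
        exact h2 j hj' k hk' e

theorem IsLFRSS.maxFrame (h : IsLFRSS form R) (hf : HasFrame form R) :
    ∃ (c : F) (V : Set A), IsFrame form R c V ∧ V.Infinite ∧
      ∀ z, IsFrame form R c (insert z V) → z ∈ V := by
  obtain ⟨c, V0, h1, h2⟩ := hf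
  obtain ⟨V, hV0, hV⟩ := zorn_subset_nonempty {V : Set A | IsFrame form R c V} (by
    intro C hC hchain hne
    refine ⟨⋃₀ C, ⟨h1.1, ?_⟩, fun s hs => Set.subset_sUnion_of_mem hs⟩
    rintro x ⟨s, hs, hxs⟩ y ⟨t, ht, hyt⟩ hxy
    obtain ⟨u, hu, hsu, htu⟩ := hchain.directedOn s hs t ht
    exact (hC hu).2 x (hsu hxs) y (htu hyt) hxy) V0 h1
  refine ⟨c, V, hV.prop, h2.mono hV0, ?_⟩
  intro z hz
  exact hV.le_of_ge hz (Set.subset_insert _ _) (Set.mem_insert _ _)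

theorem IsFrame.inner (hV : IsFrame form R c V) (h : IsLFRSS form R) {x y z : A} (hx : x ∈ V)
    (hy : y ∈ V) (hz : z ∈ V) (hxy : x ≠ y) (hxz : x ≠ z) (hyz : y ≠ z) :
    form (x - y) (x - z) = c := by
  have h1 := (hV.2 x hx y hy hxy).2
  have h2 := (hV.2 x hx z hz hxz).2
  have h3 := (hV.2 y hy z hz hyz).2
  have e : y - z = (x - z) - (x - y) := by abel
  rw [e, h.sf.sub_left, h.sf.sub_right, h.sf.sub_right _ _ (x - y), h1, h2, h.sf.symm (x - z) (x - y)] at h3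
  have h20 : (2 : F) ≠ 0 := two_ne_zero
  apply mul_left_cancel₀ h20
  linear_combination -h3

open Classical in
theorem IsFrame.inner2 (hV : IsFrame form R c V) (h : IsLFRSS form R) {x y z w : A} (hx : x ∈ V)
    (hy : y ∈ V) (hz : z ∈ V) (hw : w ∈ V) (hxy : x ≠ y) :
    form (x - y) (z - w) = c * (((if x = z then 1 else 0) - (if y = z then 1 else 0) : ℤ)
      - ((if x = w then 1 else 0) - (if y = w then 1 else 0) : ℤ)) := by
  have key : ∀ z ∈ V, form (x - y) (z - y) = c * (((if x = z then 1 else 0) - (if y = z then 1 else 0) : ℤ) + 1) := by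
    intro z hz
    by_cases h1 : y = z
    · subst h1; simp [h.sf.zero_right, hxy]
    by_cases h2 : x = z
    · subst h2; simp [h1]; rw [(hV.2 x hx y hy hxy).2]; ring
    · have := hV.inner h hy hx hz (Ne.symm hxy) h1 h2
      rw [← neg_sub x y, ← neg_sub z y, h.sf.neg_left, h.sf.neg_right, neg_neg] at this
      simp [h1, h2, this]
  have e : z - w = (z - y) - (w - y) := by abel
  rw [e, h.sf.sub_right, key z hz, key w hw]
  push_cast; ring

theorem IsFrame.root_wt (hV : IsFrame form R c V) (h : IsLFRSS form R) (hinf : V.Infinite)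
    {β : A} (hβ : β ∈ R) : ∃ w : A →₀ ℤ, (∀ x, x ∉ V → w x = 0) ∧
      ∀ x ∈ V, ∀ y ∈ V, form β (x - y) = c * ((w x : F) - (w y : F)) := by
  classical
  have h20 : (2 : F) ≠ 0 := two_ne_zero
  have hc := hV.1
  have h2c : 2 * c ≠ 0 := mul_ne_zero h20 hc
  obtain ⟨x0, hx0⟩ := hinf.nonempty
  have hex : ∀ x : A, ∃ k : ℤ, x ∈ V → form β (x - x0) = c * k ∧ |k| ≤ 4 := by
    intro x
    by_cases hx : x ∈ V
    · by_cases hxx : x = x0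
      · exact ⟨0, fun _ => by simp [hxx, h.sf.zero_right]⟩
      · obtain ⟨h1, h2⟩ := hV.2 x hx x0 hx0 hxx
        obtain ⟨k, hk⟩ := h.car h1 (by rwa [h2]) hβ
        refine ⟨k, fun _ => ⟨?_, h.car_bound h1 (by rwa [h2]) hβ hk⟩⟩
        rw [h2] at hk
        apply mul_left_cancel₀ h20; linear_combination hk
    · exact ⟨0, fun h => absurd h hx⟩
  choose k hk using hex
  have hkxy : ∀ x ∈ V, ∀ y ∈ V, form β (x - y) = c * ((k x : F) - (k y : F)) := by
    intro x hx y hy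
    have e : x - y = (x - x0) - (y - x0) := by abel
    rw [e, h.sf.sub_right, (hk x hx).1, (hk y hy).1]; ring
  obtain ⟨k0, -, V0, hV0, hV0i, hV0k⟩ := pigeon hinf (T := Set.Icc (-4 : ℤ) 4) (Set.finite_Icc _ _)
    (fun x b => k x = b) (fun x hx => ⟨k x, by simpa [abs_le] using (hk x hx).2, rfl⟩)
  have hfin : {x ∈ V | k x ≠ k0}.Finite := by
    by_contra hinf'
    obtain ⟨k1, -, V1, hV1, hV1i, hV1k⟩ := pigeon hinf' (T := Set.Icc (-4 : ℤ) 4) (Set.finite_Icc _ _)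
      (fun x b => k x = b) (fun x hx => ⟨k x, by simpa [abs_le] using (hk x hx.1).2, rfl⟩)
    set d := k1 - k0 with hd
    have hd0 : d ≠ 0 := by
      obtain ⟨x, hx⟩ := hV1i.nonempty
      have := (hV1 hx).2
      rw [hV1k x hx] at this
      omega
    have hdF : (d : F) ≠ 0 := by exact_mod_cast hd0
    obtain ⟨f, hf1, hf2⟩ := inf_inj hV1i (Finset.range 7) ∅
    obtain ⟨g, hg1, hg2⟩ := inf_inj hV0i (Finset.range 8) ∅
    have hfV : ∀ i ∈ Finset.range 7, f i ∈ V := fun i hi => (hV1 (hf1 i hi).1).1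
    have hgV : ∀ i ∈ Finset.range 8, g i ∈ V := fun i hi => hV0 (hg1 i hi).1
    have hfg : ∀ i ∈ Finset.range 7, ∀ j ∈ Finset.range 8, f i ≠ g j := by
      intro i hi j hj e
      have h1 := (hV1 (hf1 i hi).1).2
      rw [e, hV0k _ (hg1 j hj).1] at h1
      exact h1 rfl
    have hsub : ∀ i ∈ Finset.range 7, i ∈ Finset.range 8 := by
      intro i; simp only [Finset.mem_range]; omega
    have hroot : ∀ i ∈ Finset.range 7, f i - g i ∈ R := fun i hi =>
      (hV.2 _ (hfV i hi) _ (hgV i (hsub i hi)) (hfg i hi i (hsub i hi))).1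
    have hnorm : ∀ i ∈ Finset.range 7, form (f i - g i) (f i - g i) = 2 * c := fun i hi =>
      (hV.2 _ (hfV i hi) _ (hgV i (hsub i hi)) (hfg i hi i (hsub i hi))).2
    have hval : ∀ i ∈ Finset.range 7, ∀ j ∈ Finset.range 8, form β (f i - g j) = c * d := by
      intro i hi j hj
      rw [hkxy _ (hfV i hi) _ (hgV j hj), hV1k _ (hf1 i hi).1, hV0k _ (hg1 j hj).1, hd]
      push_cast; ring
    have horth : ∀ i ∈ Finset.range 7, ∀ j ∈ Finset.range 7, i ≠ j →
        form (f i - g i) (f j - g j) = 0 := by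
      intro i hi j hj hij
      rw [hV.inner2 h (hfV i hi) (hgV i (hsub i hi)) (hfV j hj) (hgV j (hsub j hj))
        (hfg i hi i (hsub i hi))]
      have e1 : f i ≠ f j := fun e => hij (hf2 i hi j hj e)
      have e2 : g i ≠ g j := fun e => hij (hg2 i (hsub i hi) j (hsub j hj) e)
      simp [e1, e2, (hfg i hi j (hsub j hj)), (hfg j hj i (hsub i hi)).symm]
    by_cases hs : form β β = 0
    · have h0 : (0 : ℕ) ∈ Finset.range 7 := by simp
      have h1 : (1 : ℕ) ∈ Finset.range 7 := by simp
      have hs01 : ∀ i ∈ ({0, 1} : Finset ℕ), i ∈ Finset.range 7 := by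
        intro i hi; simp at hi ⊢; omega
      have hm := h.reflMany ({0, 1} : Finset ℕ) (fun i => f i - g i) (fun _ => d) hβ
        (fun i hi => hroot i (hs01 i hi)) (fun i hi => by rw [hnorm i (hs01 i hi)]; exact h2c)
        (fun i hi j hj hij => horth i (hs01 i hi) j (hs01 j hj) hij)
        (fun i hi => by rw [hval i (hs01 i hi) i (hsub i (hs01 i hi)), hnorm i (hs01 i hi)]; ring)
      rw [Finset.sum_pair (by norm_num)] at hm
      set β' := β - (d • (f 0 - g 0) + d • (f 1 - g 1)) with hβ'
      have v0 := hval 0 h0 0 (by simp)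
      have v1 := hval 1 h1 1 (by simp)
      have v7 := hval 0 h0 7 (by simp)
      have e01 := horth 0 h0 1 h1 (by norm_num)
      have e10 := horth 1 h1 0 h0 (by norm_num)
      have n0 := hnorm 0 h0
      have n1 := hnorm 1 h1
      have w0 : form (f 0 - g 0) (f 0 - g 7) = c := by
        refine hV.inner h (hfV 0 h0) (hgV 0 (by simp)) (hgV 7 (by simp)) (hfg 0 h0 0 (by simp))
          (hfg 0 h0 7 (by simp)) ?_
        intro e
        have := hg2 0 (by simp) 7 (by simp) e
        omega
      have w1 : form (f 1 - g 1) (f 0 - g 7) = 0 := by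
        rw [hV.inner2 h (hfV 1 h1) (hgV 1 (by simp)) (hfV 0 h0) (hgV 7 (by simp))
          (hfg 1 h1 1 (by simp))]
        have e1 : f 1 ≠ f 0 := fun e => by have := hf2 1 h1 0 h0 e; omega
        have e2 : g 1 ≠ g 7 := fun e => by have := hg2 1 (by simp) 7 (by simp) e; omega
        simp [e1, e2, hfg 1 h1 7 (by simp), (hfg 0 h0 1 (by simp)).symm]
      have v0' : form (f 0 - g 0) β = c * d := by rw [h.sf.symm, v0]
      have v1' : form (f 1 - g 1) β = c * d := by rw [h.sf.symm, v1]
      have p1 : form β β' = - 2 * c * d * d := by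
        simp only [hβ', h.sf.sub_right (β), h.sf.add_right, h.sf.zsmul_right, v0, v1, hs]
        ring
      have p2 : form β' β' = 0 := by
        rw [hβ', h.sf.sub_left β, ← hβ', p1]
        simp only [hβ', h.sf.sub_right (β), h.sf.add_right, h.sf.add_left, h.sf.zsmul_right,
          h.sf.zsmul_left, v0', v1', e01, e10, n0, n1]
        ring
      have p3 : form β' (f 0 - g 7) = 0 := by
        simp only [hβ', h.sf.sub_left β, h.sf.add_left, h.sf.zsmul_left, v7, w0, w1]
        ring
      have pr := (hV.2 _ (hfV 0 h0) _ (hgV 7 (by simp)) (hfg 0 h0 7 (by simp))).1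
      have hpne : form β β' ≠ 0 := by
        rw [p1]
        exact mul_ne_zero (mul_ne_zero (mul_ne_zero (by norm_num) hc) hdF) hdF
      have fin : ∀ (t : ℤ) (η : A), (t = 4 ∨ t = -4) → η ∈ R → form η η = (t : F) * (c * d * d) →
          form η (f 0 - g 7) = c * d → False := by
        intro t η ht hη hηn hηp
        have hr : form η η ≠ 0 := by
          rw [hηn]
          refine mul_ne_zero ?_ (mul_ne_zero (mul_ne_zero hc hdF) hdF)
          rcases ht with rfl | rfl <;> norm_num
        obtain ⟨l, hl⟩ := h.car hη hr pr
        rw [h.sf.symm, hηp, hηn] at hl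
        have e : ((2 : ℤ) : F) = ((l * t * d : ℤ) : F) := by
          apply mul_left_cancel₀ (mul_ne_zero hc hdF)
          push_cast
          linear_combination hl
        have e' : 2 = l * t * d := by exact_mod_cast e
        rcases ht with rfl | rfl
        · have : 2 = 4 * (l * d) := by linarith
          omega
        · have : 2 = 4 * (- (l * d)) := by linarith
          omega
      rcases h.add_or_sub hβ hm hpne with h5 | h5
      · refine fin (-4) _ (by simp) h5 ?_ ?_
        · rw [h.sf.add_left, h.sf.add_right, h.sf.add_right, hs, p2, h.sf.symm β' β, p1]
          push_cast; ring
        · rw [h.sf.add_left, v7, p3, add_zero]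
      · refine fin 4 _ (by simp) h5 ?_ ?_
        · rw [h.sf.sub_left β β', h.sf.sub_right β β' β, h.sf.sub_right β β' β', hs, p2, h.sf.symm β' β, p1]
          push_cast; ring
        · rw [h.sf.sub_left, v7, p3, sub_zero]
    · have hm := h.reflMany (Finset.range 7) (fun i => f i - g i) (fun _ => d) hβ
        (fun i hi => hroot i hi) (fun i hi => by rw [hnorm i hi]; exact h2c)
        (fun i hi j hj hij => horth i hi j hj hij)
        (fun i hi => by rw [hval i hi i (hsub i hi), hnorm i hi]; ring)
      have h0 : (0 : ℕ) ∈ Finset.range 7 := by simp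
      obtain ⟨e, he⟩ := h.car hβ hs (hroot 0 h0)
      rw [h.sf.symm] at he
      have hed := h.prod_ge (hroot 0 h0) (by rw [hnorm 0 h0]; exact h2c) hβ hs (m := d)
        (by rw [hval 0 h0 0 (by simp), hnorm 0 h0]; ring) he
        (by rw [hval 0 h0 0 (by simp)]; exact mul_ne_zero hc hdF)
      rw [hval 0 h0 0 (by simp)] at he
      have := h.car_bound hβ hs hm (m := 2 - 7 * (d * e)) (by
        rw [h.sf.sub_left, h.sf.sum_left, Finset.sum_congr rfl (g := fun _ => c * d * d)]
        · rw [Finset.sum_const, Finset.card_range]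
          push_cast
          rw [nsmul_eq_mul]
          push_cast
          linear_combination -7 * d * he
        · intro i hi
          rw [h.sf.zsmul_left, h.sf.symm, hval i hi i (hsub i hi)]; ring)
      rw [abs_le] at this
      omega
  refine ⟨Finsupp.onFinset hfin.toFinset (fun x => if x ∈ V then k x - k0 else 0) ?_, ?_, ?_⟩
  · intro x hx
    by_cases hxV : x ∈ V
    · simp only [hxV, if_true] at hx
      simp [hxV]; omega
    · simp [hxV] at hx
  · intro x hx; simp [hx]
  · intro x hx y hy
    simp only [Finsupp.onFinset_apply, hx, hy, if_true]
    rw [hkxy x hx y hy]; push_cast; ring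

theorem IsFrame.wt_unique (hV : IsFrame form R c V) (hinf : V.Infinite) {w w' : A →₀ ℤ}
    (h1 : ∀ x, x ∉ V → w x = 0) (h2 : ∀ x, x ∉ V → w' x = 0)
    (h3 : ∀ x ∈ V, ∀ y ∈ V, c * ((w x : F) - (w y : F)) = c * ((w' x : F) - (w' y : F))) : w = w' := by
  classical
  obtain ⟨y, hy, hy'⟩ := inf_avoid hinf (w.support ∪ w'.support)
  simp only [Finset.mem_union, Finsupp.mem_support_iff, not_or, not_not] at hy'
  ext x
  by_cases hx : x ∈ V
  · have := mul_left_cancel₀ hV.1 (h3 x hx y hy)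
    rw [hy'.1, hy'.2] at this
    push_cast at this
    rw [sub_zero, sub_zero] at this
    exact_mod_cast this
  · rw [h1 x hx, h2 x hx]

/-- a maximal frame together with the weight map -/
structure Fr (form : A → A → F) (R : Set A) (c : F) (V : Set A) (wt : A →+ (A →₀ ℤ)) : Prop where
  h : IsLFRSS form R
  fr : IsFrame form R c V
  inf : V.Infinite
  max : ∀ z, IsFrame form R c (insert z V) → z ∈ V
  off : ∀ a x, x ∉ V → wt a x = 0
  wf : ∀ a, ∀ x ∈ V, ∀ y ∈ V, form a (x - y) = c * ((wt a x : F) - (wt a y : F))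

theorem IsLFRSS.exists_fr (h : IsLFRSS form R) (hf : HasFrame form R) :
    ∃ c V wt, Fr form R c V wt := by
  obtain ⟨c, V, hV, hinf, hmax⟩ := h.maxFrame hf
  have hex : ∀ a : A, ∃ w : A →₀ ℤ, (∀ x, x ∉ V → w x = 0) ∧
      ∀ x ∈ V, ∀ y ∈ V, form a (x - y) = c * ((w x : F) - (w y : F)) := by
    intro a
    have ha : a ∈ AddSubgroup.closure R := by rw [h.1.closure_eq_top]; trivial
    induction ha using AddSubgroup.closure_induction with
    | mem x hx => exact hV.root_wt h hinf hx
    | zero => exact ⟨0, by simp, by simp [h.sf.zero_left]⟩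
    | add a b _ _ ha hb =>
      obtain ⟨w, h1, h2⟩ := ha
      obtain ⟨w', h1', h2'⟩ := hb
      refine ⟨w + w', fun x hx => by simp [h1 x hx, h1' x hx], fun x hx y hy => ?_⟩
      rw [h.sf.add_left, h2 x hx y hy, h2' x hx y hy]
      simp only [Finsupp.add_apply]; push_cast; ring
    | neg a _ ha =>
      obtain ⟨w, h1, h2⟩ := ha
      refine ⟨-w, fun x hx => by simp [h1 x hx], fun x hx y hy => ?_⟩
      rw [h.sf.neg_left, h2 x hx y hy]
      simp only [Finsupp.neg_apply]; push_cast; ring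
  choose w hw1 hw2 using hex
  refine ⟨c, V, AddMonoidHom.mk' w ?_, h, hV, hinf, hmax, hw1, hw2⟩
  intro a b
  apply hV.wt_unique hinf (hw1 _) (fun x hx => by simp [hw1 a x hx, hw1 b x hx])
  intro x hx y hy
  rw [← hw2 _ x hx y hy, h.sf.add_left, hw2 a x hx y hy, hw2 b x hx y hy]
  simp only [Finsupp.add_apply]; push_cast; ring

end Weights


set_option linter.unusedSimpArgs false
set_option linter.unusedVariables false

section Classify

variable {F : Type*} [Field F] [CharZero F] {A : Type*} [AddCommGroup A] {form : A → A → F}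
  {R : Set A} {c : F} {V : Set A} {wt : A →+ (A →₀ ℤ)}

theorem Fr.two_c (k : Fr form R c V wt) : 2 * c ≠ 0 := mul_ne_zero two_ne_zero k.fr.1

theorem Fr.dR (k : Fr form R c V wt) {x y : A} (hx : x ∈ V) (hy : y ∈ V) : x - y ∈ R := by
  by_cases h : x = y
  · rw [h, sub_self]; exact k.h.1.zero_mem
  · exact (k.fr.2 x hx y hy h).1

theorem Fr.dN (k : Fr form R c V wt) {x y : A} (hx : x ∈ V) (hy : y ∈ V) (hxy : x ≠ y) :
    form (x - y) (x - y) = 2 * c := (k.fr.2 x hx y hy hxy).2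

theorem Fr.wt_diff (k : Fr form R c V wt) {x y : A} (hx : x ∈ V) (hy : y ∈ V) :
    wt (x - y) = Finsupp.single x 1 - Finsupp.single y 1 := by
  classical
  by_cases hxy : x = y
  · simp [hxy]
  apply k.fr.wt_unique k.inf (k.off _)
  · intro z hz
    have h1 : x ≠ z := fun e => hz (e ▸ hx)
    have h2 : y ≠ z := fun e => hz (e ▸ hy)
    simp [Finsupp.single_apply, h1, h2]
  · intro z hz w hw
    rw [← k.wf _ z hz w hw, k.fr.inner2 k.h hx hy hz hw hxy]
    simp [Finsupp.single_apply]

theorem Fr.wt_mem (k : Fr form R c V wt) {a x : A} (h : wt a x ≠ 0) : x ∈ V := by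
  by_contra hx
  exact h (k.off a x hx)

theorem Fr.refl (k : Fr form R c V wt) {β x y : A} (hβ : β ∈ R) (hx : x ∈ V) (hy : y ∈ V) :
    β - (wt β x - wt β y) • (x - y) ∈ R := by
  by_cases hxy : x = y
  · simpa [hxy] using hβ
  · refine k.h.refl_mem (k.dR hx hy) (by rw [k.dN hx hy hxy]; exact k.two_c) hβ ?_
    rw [k.wf _ x hx y hy, k.dN hx hy hxy]; push_cast; ring

theorem Fr.move (k : Fr form R c V wt) {β : A} (hβ : β ∈ R) (T : Finset A) :
    ∃ β' ∈ R, form β' β = form β β - c * ∑ s ∈ (wt β).support, (wt β s : F) * (wt β s : F) ∧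
      form β' β' = form β β ∧ (∀ x ∈ (wt β).support, wt β' x = 0) ∧ (∀ x ∈ T, wt β' x = 0) ∧
      ((wt β).support.Nonempty → ∃ x, wt β' x ≠ 0) ∧
      ∀ γ, (∀ x ∈ (wt β).support, wt γ x = 0) → (∀ x, x ∉ T → wt γ x = 0) →
        form β' γ = form β γ := by
  classical
  set S := (wt β).support with hS
  have hSV : ∀ s ∈ S, s ∈ V := fun s hs => k.wt_mem (by simpa [hS] using hs)
  obtain ⟨y, hy1, hy2⟩ := inf_inj k.inf S (S ∪ T)
  have hyV : ∀ s ∈ S, y s ∈ V := fun s hs => (hy1 s hs).1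
  have hyS : ∀ s ∈ S, y s ∉ S := fun s hs h => (hy1 s hs).2 (Finset.mem_union_left _ h)
  have hyT : ∀ s ∈ S, y s ∉ T := fun s hs h => (hy1 s hs).2 (Finset.mem_union_right _ h)
  have hne : ∀ s ∈ S, ∀ t ∈ S, s ≠ y t := fun s hs t ht e => hyS t ht (e ▸ hs)
  have hb0 : ∀ s ∈ S, wt β (y s) = 0 := by
    intro s hs
    have := hyS s hs
    simpa [hS] using this
  have hval : ∀ s ∈ S, form β (s - y s) = c * wt β s := by
    intro s hs
    rw [k.wf _ s (hSV s hs) _ (hyV s hs), hb0 s hs]; simp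
  have hm := k.h.reflMany S (fun s => s - y s) (fun s => wt β s) hβ
    (fun s hs => k.dR (hSV s hs) (hyV s hs))
    (fun s hs => by rw [k.dN (hSV s hs) (hyV s hs) (hne s hs s hs)]; exact k.two_c)
    (fun s hs t ht hst => by
      have e2 : y s ≠ y t := fun e => hst (hy2 s hs t ht e)
      rw [k.wf _ t (hSV t ht) _ (hyV t ht), k.wt_diff (hSV s hs) (hyV s hs)]
      simp [Finsupp.single_apply, hst, e2, hne s hs t ht, (hne t ht s hs).symm])
    (fun s hs => by
      rw [hval s hs, k.dN (hSV s hs) (hyV s hs) (hne s hs s hs)]; ring)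
  set β' := β - ∑ s ∈ S, wt β s • (s - y s) with hβ'
  have hwt : ∀ x, wt β' x = wt β x - ∑ s ∈ S, wt β s *
      ((if s = x then 1 else 0) - (if y s = x then 1 else 0)) := by
    intro x
    rw [hβ', map_sub, map_sum, Finsupp.sub_apply, Finsupp.finset_sum_apply]
    congr 1
    apply Finset.sum_congr rfl
    intro s hs
    rw [map_zsmul, k.wt_diff (hSV s hs) (hyV s hs)]
    simp [Finsupp.single_apply]
  have hwS : ∀ x ∈ S, wt β' x = 0 := by
    intro x hx
    rw [hwt, Finset.sum_eq_single x]
    · simp [(hne x hx x hx).symm]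
    · intro s hs hsx
      simp [hsx, (hne x hx s hs).symm]
    · intro h; exact absurd hx h
  have hwy : ∀ s ∈ S, wt β' (y s) = wt β s := by
    intro s hs
    rw [hwt, hb0 s hs, Finset.sum_eq_single s]
    · simp [hne s hs s hs]
    · intro t ht hts
      have e2 : y t ≠ y s := fun e => hts (hy2 t ht s hs e)
      simp [hne t ht s hs, e2]
    · intro h; exact absurd hs h
  have hwo : ∀ x, (∀ s ∈ S, y s ≠ x) → wt β' x = 0 := by
    intro x hx
    by_cases hxS : x ∈ S
    · exact hwS x hxS
    · rw [hwt, Finset.sum_eq_zero]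
      · simpa [hS] using hxS
      · intro s hs
        have : s ≠ x := fun e => hxS (e ▸ hs)
        simp [this, hx s hs]
  have hpair : form β' β = form β β - c * ∑ s ∈ S, (wt β s : F) * (wt β s : F) := by
    rw [hβ', k.h.sf.sub_left, k.h.sf.sum_left, Finset.mul_sum]
    congr 1
    apply Finset.sum_congr rfl
    intro s hs
    rw [k.h.sf.zsmul_left, k.h.sf.symm, hval s hs]; ring
  refine ⟨β', hm, hpair, ?_, hwS, ?_, ?_, ?_⟩
  · have : form β' β' = form β' β - form β' (∑ s ∈ S, wt β s • (s - y s)) := by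
      conv_lhs => rw [hβ', k.h.sf.sub_right, ← hβ']
    rw [this, hpair, k.h.sf.sum_right, Finset.mul_sum]
    rw [Finset.sum_congr rfl (f := fun s => form β' (wt β s • (s - y s)))
      (g := fun s => - (c * ((wt β s : F) * (wt β s : F))))]
    · rw [Finset.sum_neg_distrib]; ring
    · intro s hs
      rw [k.h.sf.zsmul_right, k.wf _ s (hSV s hs) _ (hyV s hs), hwS s hs, hwy s hs]
      push_cast; ring
  · intro x hx
    apply hwo
    intro s hs e
    exact hyT s hs (e ▸ hx)
  · rintro ⟨s, hs⟩
    refine ⟨y s, ?_⟩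
    rw [hwy s hs]
    simpa [hS] using hs
  · intro γ h1 h2
    rw [hβ', k.h.sf.sub_left, k.h.sf.sum_left, Finset.sum_eq_zero, sub_zero]
    intro s hs
    rw [k.h.sf.zsmul_left, k.h.sf.symm, k.wf _ s (hSV s hs) _ (hyV s hs), h1 s hs, h2 _ (hyT s hs)]
    simp

theorem Fr.ns_class (k : Fr form R c V wt) {β : A} (hβ : β ∈ R) (hn : form β β = 0) :
    wt β = 0 ∨ ∃ i ∈ V, ∃ s : ℤ, (s = 1 ∨ s = -1) ∧ wt β = Finsupp.single i s := by
  classical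
  by_cases h0 : wt β = 0
  · exact Or.inl h0
  right
  obtain ⟨β', hR, p1, p2, p3, p4, p5, p6⟩ := k.move hβ ∅
  set S := (wt β).support with hS
  obtain ⟨s, hs⟩ : S.Nonempty := Finsupp.support_nonempty_iff.2 h0
  have hs0 : wt β s ≠ 0 := by simpa [hS] using hs
  have hsV := k.wt_mem hs0
  set D : ℤ := ∑ s ∈ S, wt β s * wt β s with hD
  have hDF : ∑ s ∈ S, (wt β s : F) * (wt β s : F) = (D : F) := by rw [hD]; push_cast; rfl
  rw [hDF, hn, zero_sub] at p1
  rw [hn] at p2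
  have hDge : wt β s * wt β s ≤ D :=
    Finset.single_le_sum (f := fun s => wt β s * wt β s) (fun i _ => mul_self_nonneg _) hs
  have hDpos : 0 < D := lt_of_lt_of_le (mul_self_pos.2 hs0) hDge
  have hDF0 : (D : F) ≠ 0 := by exact_mod_cast hDpos.ne'
  obtain ⟨z, hz, hz'⟩ := inf_avoid k.inf (S ∪ (wt β').support)
  simp only [Finset.mem_union, not_or, hS, Finsupp.mem_support_iff, not_not] at hz'
  have v1 : form β (s - z) = c * wt β s := by
    rw [k.wf _ s hsV z hz, hz'.1]; simp
  have v2 : form β' (s - z) = 0 := by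
    rw [k.wf _ s hsV z hz, hz'.2, p3 s hs]; simp
  have fin : ∀ (t : ℤ) (η : A), (t = 2 ∨ t = -2) → η ∈ R → form η η = (t : F) * (c * D) →
      form η (s - z) = c * wt β s → D ∣ wt β s := by
    intro t η ht hη hηn hηp
    obtain ⟨l, hl⟩ := k.h.car hη (by
      rw [hηn]
      refine mul_ne_zero ?_ (mul_ne_zero k.fr.1 hDF0)
      rcases ht with rfl | rfl <;> norm_num) (k.dR hsV hz)
    rw [k.h.sf.symm, hηp, hηn] at hl
    have e : ((2 * wt β s : ℤ) : F) = ((l * t * D : ℤ) : F) := by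
      apply mul_left_cancel₀ k.fr.1
      push_cast
      linear_combination hl
    have e' : 2 * wt β s = l * t * D := by exact_mod_cast e
    rcases ht with rfl | rfl
    · exact ⟨l, by linarith⟩
    · exact ⟨-l, by linarith⟩
  have hdvd : D ∣ wt β s := by
    rcases k.h.add_or_sub hβ hR (by
      rw [k.h.sf.symm, p1]; exact neg_ne_zero.2 (mul_ne_zero k.fr.1 hDF0)) with h5 | h5
    · refine fin (-2) _ (by simp) h5 ?_ ?_
      · rw [k.h.sf.add_left, k.h.sf.add_right, k.h.sf.add_right, hn, p2, k.h.sf.symm β β', p1]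
        push_cast; ring
      · rw [k.h.sf.add_left, v1, v2, add_zero]
    · refine fin 2 _ (by simp) h5 ?_ ?_
      · rw [k.h.sf.sub_left, k.h.sf.sub_right, k.h.sf.sub_right, hn, p2, k.h.sf.symm β β', p1]
        push_cast; ring
      · rw [k.h.sf.sub_left, v1, v2, sub_zero]
  have hle : D ≤ |wt β s| := Int.le_of_dvd (abs_pos.2 hs0) ((dvd_abs _ _).2 hdvd)
  have h1 : |wt β s| = 1 := by
    have h2 : |wt β s| * |wt β s| = wt β s * wt β s := abs_mul_abs_self _
    have h3 : 0 < |wt β s| := abs_pos.2 hs0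
    nlinarith
  have hD1 : D ≤ 1 := by omega
  refine ⟨s, hsV, wt β s, (abs_eq (by norm_num)).1 h1, ?_⟩
  have hSs : S = {s} := by
    apply Finset.eq_singleton_iff_unique_mem.2 ⟨hs, ?_⟩
    intro t ht
    by_contra hts
    have ht0 : wt β t ≠ 0 := by simpa [hS] using ht
    have : ∑ x ∈ ({s, t} : Finset A), wt β x * wt β x ≤ D := by
      apply Finset.sum_le_sum_of_subset_of_nonneg
      · intro x hx
        simp only [Finset.mem_insert, Finset.mem_singleton] at hx
        rcases hx with rfl | rfl <;> assumption
      · intro i _ _; exact mul_self_nonneg _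
    rw [Finset.sum_pair (Ne.symm hts)] at this
    have h3 := mul_self_pos.2 hs0
    have h4 := mul_self_pos.2 ht0
    omega
  exact (Finsupp.support_eq_singleton.1 hSs).2

theorem Fr.real_aux (k : Fr form R c V wt) {β : A} (hβ : β ∈ R) (hn : form β β ≠ 0) :
    ∃ e : A → ℤ, (∀ s ∈ (wt β).support, 2 * c * (wt β s : F) = (e s : F) * form β β ∧
      1 ≤ wt β s * e s) ∧ ∑ s ∈ (wt β).support, wt β s * e s ≤ 2 := by
  classical
  have hex : ∀ s : A, ∃ e : ℤ, s ∈ (wt β).support → 2 * c * (wt β s : F) = (e : F) * form β β ∧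
      1 ≤ wt β s * e := by
    intro s
    by_cases hs : s ∈ (wt β).support
    · have hs0 : wt β s ≠ 0 := by simpa using hs
      have hs0F : (wt β s : F) ≠ 0 := by exact_mod_cast hs0
      have hsV := k.wt_mem hs0
      obtain ⟨z, hz, hz'⟩ := inf_avoid k.inf (insert s (wt β).support)
      simp only [Finset.mem_insert, not_or, Finsupp.mem_support_iff, not_not] at hz'
      have hv : form β (s - z) = c * wt β s := by rw [k.wf _ s hsV z hz, hz'.2]; simp
      have hN := k.dN hsV hz (Ne.symm hz'.1)
      obtain ⟨e, he⟩ := k.h.car hβ hn (k.dR hsV hz)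
      rw [k.h.sf.symm] at he
      refine ⟨e, fun _ => ⟨by rw [← he, hv]; ring, ?_⟩⟩
      refine k.h.prod_ge (k.dR hsV hz) (by rw [hN]; exact k.two_c) hβ hn ?_ he ?_
      · rw [hv, hN]; ring
      · rw [hv]; exact mul_ne_zero k.fr.1 hs0F
    · exact ⟨0, fun h => absurd h hs⟩
  choose e he using hex
  refine ⟨e, he, ?_⟩
  by_cases hne : (wt β).support.Nonempty
  swap
  · rw [Finset.not_nonempty_iff_eq_empty] at hne
    rw [hne]; simp
  obtain ⟨b1, hR1, p1, n1, z1, t1, ne1, f1⟩ := k.move hβ ∅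
  obtain ⟨b2, hR2, p2, n2, z2, t2, ne2, f2⟩ := k.move hβ (wt b1).support
  obtain ⟨b3, hR3, p3, n3, z3, t3, ne3, f3⟩ := k.move hβ ((wt b1).support ∪ (wt b2).support)
  obtain ⟨s, hs⟩ := hne
  have hs0 : wt β s ≠ 0 := by simpa using hs
  set E := ∑ s ∈ (wt β).support, wt β s * e s with hE
  have hEN : 2 * (c * ∑ s ∈ (wt β).support, (wt β s : F) * (wt β s : F)) = (E : F) * form β β := by
    rw [hE]; push_cast
    rw [Finset.mul_sum, Finset.mul_sum, Finset.sum_mul]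
    apply Finset.sum_congr rfl
    intro t ht
    linear_combination (wt β t : F) * (he t ht).1
  have hm : ∀ b, form b β = form β β - c * ∑ s ∈ (wt β).support, (wt β s : F) * (wt β s : F) →
      2 * form b β = ((2 - E : ℤ) : F) * form β β := by
    intro b hb
    rw [hb]; push_cast; linear_combination -hEN
  rcases k.h.same_norm hβ hn hR1 n1 (hm b1 p1) with h1 | h1 | h1 | h1 | h1
  · exfalso
    have := z1 s hs
    rw [h1] at this
    exact hs0 this
  · exfalso
    have := z1 s hs
    rw [h1] at this
    simp at this
    exact hs0 this
  · exfalso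
    have hE3 : ((2 - E : ℤ) : F) = -1 := by rw [h1]; simp
    have q1 := hm b1 p1
    have q2 := hm b2 p2
    have q3 := hm b3 p3
    rw [hE3] at q1 q2 q3
    have g2 := f2 b1 z1 (fun x hx => by simpa using hx)
    have g3 := f3 b1 z1 (fun x hx => by
      simp only [Finset.mem_union, not_or, Finsupp.mem_support_iff, not_not] at hx; exact hx.1)
    rw [k.h.sf.symm β b1] at g2 g3
    have := k.h.tri hn hβ hR1 hR2 hR3 rfl n1 n2 n3 (by rw [k.h.sf.symm, q1]; ring)
      (by rw [q2]; ring) (by rw [g2, q1]; ring) (by rw [q3]; ring) (by rw [g3, q1]; ring)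
    obtain ⟨x, hx⟩ := ne2 ⟨s, hs⟩
    have h5 := t3 x (Finset.mem_union_right _ (by simpa using hx))
    rw [← this] at h5
    exact hx h5
  · omega
  · omega

theorem Fr.max_excl (k : Fr form R c V wt) {β i : A} (hβ : β ∈ R) (hi : i ∈ V)
    (hw : wt β = Finsupp.single i 1) (hn : form β β = 2 * c) : False := by
  classical
  have key : ∀ x ∈ V, (i - β) - x ∈ R ∧ form ((i - β) - x) ((i - β) - x) = 2 * c := by
    intro x hx
    by_cases hxi : x = i
    · subst hxi
      have e : x - β - x = -β := by abel
      rw [e]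
      exact ⟨k.h.neg hβ, by simp [k.h.sf.neg_left, k.h.sf.neg_right, hn]⟩
    · have e : i - β - x = (i - x) - β := by abel
      have hp : form β (i - x) = c := by
        rw [k.wf _ i hi x hx, hw]
        simp [Finsupp.single_apply, Ne.symm hxi]
      have hp' : form (i - x) β = c := by rw [k.h.sf.symm, hp]
      rw [e]
      constructor
      · exact k.h.str_sub hβ (by rw [hn]; exact k.two_c) (k.dR hi hx) (n := 1)
          (by rw [hp', hn]; push_cast; ring) le_rfl
      · rw [k.h.sf.sub_left (i - x) β, k.h.sf.sub_right (i - x) β, k.h.sf.sub_right (i - x) β, hn,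
          k.dN hi hx (Ne.symm hxi), hp, hp']; ring
  have hz : i - β ∈ V := by
    apply k.max
    refine ⟨k.fr.1, ?_⟩
    rintro x (rfl | hx) y (rfl | hy) hxy
    · exact absurd rfl hxy
    · exact key y hy
    · have := key x hx
      refine ⟨k.h.sub_comm this.1, ?_⟩
      rw [← neg_sub, k.h.sf.neg_left, k.h.sf.neg_right, neg_neg, this.2]
    · exact k.fr.2 x hx y hy hxy
  have h1 := k.wt_diff hi hz
  have e : i - (i - β) = β := by abel
  rw [e, hw] at h1
  have h2 := DFunLike.congr_fun h1 (i - β)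
  simp [Finsupp.single_apply] at h2
  split_ifs at h2 <;> omega

theorem Fr.cls (k : Fr form R c V wt) {β : A} (hβ : β ∈ R) :
    wt β = 0 ∨
    (∃ i ∈ V, ∃ s : ℤ, (s = 1 ∨ s = -1) ∧ wt β = Finsupp.single i s ∧
      (form β β = 0 ∨ form β β = c)) ∨
    (∃ i ∈ V, ∃ s : ℤ, (s = 1 ∨ s = -1) ∧ wt β = Finsupp.single i (2 * s) ∧ form β β = 4 * c) ∨
    (∃ i ∈ V, ∃ j ∈ V, i ≠ j ∧ ∃ s t : ℤ, (s = 1 ∨ s = -1) ∧ (t = 1 ∨ t = -1) ∧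
      wt β = Finsupp.single i s + Finsupp.single j t ∧ form β β = 2 * c) := by
  classical
  by_cases hn : form β β = 0
  · rcases k.ns_class hβ hn with h1 | ⟨i, hi, s, hs, hw⟩
    · exact Or.inl h1
    · exact Or.inr (Or.inl ⟨i, hi, s, hs, hw, Or.inl hn⟩)
  obtain ⟨e, he, hsum⟩ := k.real_aux hβ hn
  have hcard : (wt β).support.card ≤ 2 := by
    have : ∑ s ∈ (wt β).support, (1 : ℤ) ≤ ∑ s ∈ (wt β).support, wt β s * e s :=
      Finset.sum_le_sum fun i hi => (he i hi).2
    simp at this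
    omega
  have h3 : (wt β).support.card = 0 ∨ (wt β).support.card = 1 ∨ (wt β).support.card = 2 := by omega
  have h20 : (2 : F) ≠ 0 := two_ne_zero
  rcases h3 with h3 | h3 | h3
  · left; simpa using h3
  · obtain ⟨i, hi⟩ := Finset.card_eq_one.1 h3
    have hi0 := Finsupp.support_eq_singleton.1 hi
    rw [hi, Finset.sum_singleton] at hsum
    have h4 := he i (by rw [hi]; simp)
    have hiV := k.wt_mem hi0.1
    set d := wt β i with hd
    have hcase : (d = 1 ∧ e i = 1) ∨ (d = -1 ∧ e i = -1) ∨ (d = 1 ∧ e i = 2) ∨ (d = -1 ∧ e i = -2) ∨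
        (d = 2 ∧ e i = 1) ∨ (d = -2 ∧ e i = -1) := by
      have hb : d * e i = 1 ∨ d * e i = 2 := by omega
      rcases hb with hb | hb
      · rcases Int.eq_one_or_neg_one_of_mul_eq_one' hb with h | h <;> omega
      · have hdd : d ∣ 2 := ⟨e i, hb.symm⟩
        have h5 := Int.le_of_dvd (by norm_num) hdd
        have h6 := Int.le_of_dvd (by norm_num) ((neg_dvd).2 hdd)
        have : d = -2 ∨ d = -1 ∨ d = 0 ∨ d = 1 ∨ d = 2 := by omega
        rcases this with h | h | h | h | h <;> rw [h] at hb ⊢ <;> omega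
    rcases hcase with ⟨h5, h6⟩ | ⟨h5, h6⟩ | ⟨h5, h6⟩ | ⟨h5, h6⟩ | ⟨h5, h6⟩ | ⟨h5, h6⟩ <;>
      rw [h5, h6] at h4 <;> rw [h5] at hi0 <;> have h7 := h4.1 <;> push_cast at h7
    · exact (k.max_excl hβ hiV hi0.2 (by linear_combination -h7)).elim
    · exfalso
      refine k.max_excl (β := -β) (k.h.neg hβ) hiV ?_ ?_
      · rw [map_neg, hi0.2, ← Finsupp.single_neg]; simp
      · simp only [k.h.sf.neg_left, k.h.sf.neg_right, neg_neg]; linear_combination h7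
    · exact Or.inr (Or.inl ⟨i, hiV, 1, by simp, hi0.2, Or.inr (by
        apply mul_left_cancel₀ h20; linear_combination -h7)⟩)
    · exact Or.inr (Or.inl ⟨i, hiV, -1, by simp, hi0.2, Or.inr (by
        apply mul_left_cancel₀ h20; linear_combination h7)⟩)
    · exact Or.inr (Or.inr (Or.inl ⟨i, hiV, 1, by simp, by simpa using hi0.2, by
        linear_combination -h7⟩))
    · exact Or.inr (Or.inr (Or.inl ⟨i, hiV, -1, by simp, by simpa using hi0.2, by
        linear_combination h7⟩))
  · obtain ⟨i, j, hij, hi⟩ := Finset.card_eq_two.1 h3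
    have hiS : i ∈ (wt β).support := by rw [hi]; simp
    have hjS : j ∈ (wt β).support := by rw [hi]; simp
    rw [hi, Finset.sum_pair hij] at hsum
    have h4 := he i hiS
    have h5 := he j hjS
    have h6 : wt β i * e i = 1 := by omega
    have h7 : wt β j * e j = 1 := by omega
    refine Or.inr (Or.inr (Or.inr ⟨i, k.wt_mem (Finsupp.mem_support_iff.1 hiS), j,
      k.wt_mem (Finsupp.mem_support_iff.1 hjS), hij, wt β i, wt β j, ?_, ?_, ?_, ?_⟩))
    · rcases Int.eq_one_or_neg_one_of_mul_eq_one' h6 with h | h <;> omega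
    · rcases Int.eq_one_or_neg_one_of_mul_eq_one' h7 with h | h <;> omega
    · ext x
      rw [Finsupp.add_apply, Finsupp.single_apply, Finsupp.single_apply]
      by_cases h8 : i = x
      · subst h8; simp [hij, Ne.symm hij]
      by_cases h9 : j = x
      · subst h9; simp [hij]
      have : x ∉ (wt β).support := by rw [hi]; simp [Ne.symm h8, Ne.symm h9]
      simpa [h8, h9] using this
    · rcases Int.eq_one_or_neg_one_of_mul_eq_one' h6 with ⟨h8, h9⟩ | ⟨h8, h9⟩ <;>
        rw [h8, h9] at h4 <;> have h10 := h4.1 <;> push_cast at h10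
      · linear_combination -h10
      · linear_combination h10

end Classify


set_option linter.unusedSimpArgs false
set_option linter.unusedVariables false

section Finish

variable {F : Type*} [Field F] [CharZero F] {A : Type*} [AddCommGroup A] {form : A → A → F}
  {R : Set A}

/-- `Reach R J n α`: the element `α` is reached in `n` steps along nonzero elements of `R`. -/
inductive Reach (R J : Set A) : ℕ → A → Prop
  | zero : Reach R J 0 0
  | add (n : ℕ) (x p : A) : Reach R J n x → p ∈ J → x + p ∈ R → x + p ≠ 0 → Reach R J (n + 1) (x + p)
  | sub (n : ℕ) (x p : A) : Reach R J n x → p ∈ J → x - p ∈ R → x - p ≠ 0 → Reach R J (n + 1) (x - p)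

theorem Reach.mono {J J' : Set A} (hJ : J ⊆ J') {n : ℕ} {α : A} (hr : Reach R J n α) :
    Reach R J' n α := by
  induction hr with
  | zero => exact .zero
  | add n x p _ hp h1 h2 ih => exact .add n x p ih (hJ hp) h1 h2
  | sub n x p _ hp h1 h2 ih => exact .sub n x p ih (hJ hp) h1 h2

theorem Reach.finite {J : Set A} (hJ : J.Finite) (n : ℕ) : {α | Reach R J n α}.Finite := by
  induction n with
  | zero =>
    refine (Set.finite_singleton (0 : A)).subset ?_
    intro α hα
    cases hα
    rfl
  | succ n ih =>
    refine ((ih.image2 (fun x p => x + p) hJ).union (ih.image2 (fun x p => x - p) hJ)).subset ?_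
    intro α hα
    cases hα with
    | add n x p h1 h2 h3 h4 => exact Or.inl ⟨x, h1, p, h2, rfl⟩
    | sub n x p h1 h2 h3 h4 => exact Or.inr ⟨x, h1, p, h2, rfl⟩

theorem reach_snoc {J S : Set A} {n : ℕ} {x q : A} {e : ℤ} (he : e = 1 ∨ e = -1) (hq : q ∈ J)
    (hS : x + e • q ∈ S) (hx : ∃ (a : Fin n → A) (r : Fin n → ℤ), (∀ i, a i ∈ J) ∧
      (∀ i, r i = 1 ∨ r i = -1) ∧ x = ∑ i, r i • a i ∧
      ∀ t : Fin n, (∑ i ∈ Finset.Iic t, r i • a i) ∈ S) :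
    ∃ (a : Fin (n + 1) → A) (r : Fin (n + 1) → ℤ), (∀ i, a i ∈ J) ∧
      (∀ i, r i = 1 ∨ r i = -1) ∧ x + e • q = ∑ i, r i • a i ∧
      ∀ t : Fin (n + 1), (∑ i ∈ Finset.Iic t, r i • a i) ∈ S := by
  obtain ⟨a, r, h1, h2, h3, h4⟩ := hx
  have hsum : x + e • q = ∑ i, (Fin.snoc r e : Fin (n + 1) → ℤ) i •
      (Fin.snoc a q : Fin (n + 1) → A) i := by
    rw [Fin.sum_univ_castSucc]
    simp [h3]
  refine ⟨Fin.snoc a q, Fin.snoc r e, ?_, ?_, hsum, ?_⟩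
  · intro i
    refine Fin.lastCases ?_ ?_ i
    · simpa using hq
    · intro j; simpa using h1 j
  · intro i
    refine Fin.lastCases ?_ ?_ i
    · simpa using he
    · intro j; simpa using h2 j
  · intro t
    refine Fin.lastCases ?_ ?_ t
    · have : Finset.Iic (Fin.last n) = Finset.univ := by
        ext i; simp [Fin.le_last]
      rw [this, ← hsum]; exact hS
    · intro j
      rw [← Fin.map_castSuccEmb_Iic, Finset.sum_map]
      simpa using h4 j

theorem Reach.path {J S : Set A} {n : ℕ} {α : A} (hS : ∀ x, x ∈ R → x ≠ 0 → x ∈ Submodule.span ℤ J → x ∈ S)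
    (hr : Reach R J n α) : α ∈ Submodule.span ℤ J ∧
    ∃ (a : Fin n → A) (r : Fin n → ℤ), (∀ i, a i ∈ J) ∧
      (∀ i, r i = 1 ∨ r i = -1) ∧ α = ∑ i, r i • a i ∧
      ∀ t : Fin n, (∑ i ∈ Finset.Iic t, r i • a i) ∈ S := by
  induction hr with
  | zero => exact ⟨zero_mem _, Fin.elim0, Fin.elim0, fun i => i.elim0, fun i => i.elim0, by simp,
      fun i => i.elim0⟩
  | add n x p _ hp h1 h2 ih =>
    have hs : x + p ∈ Submodule.span ℤ J := add_mem ih.1 (Submodule.subset_span hp)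
    refine ⟨hs, ?_⟩
    have := reach_snoc (e := 1) (S := S) (Or.inl rfl) hp
      (by rw [one_smul]; exact hS _ h1 h2 hs) ih.2
    simpa only [one_smul] using this
  | sub n x p _ hp h1 h2 ih =>
    have hs : x - p ∈ Submodule.span ℤ J := sub_mem ih.1 (Submodule.subset_span hp)
    refine ⟨hs, ?_⟩
    have := reach_snoc (e := -1) (S := S) (Or.inr rfl) hp
      (by rw [neg_smul, one_smul, ← sub_eq_add_neg]; exact hS _ h1 h2 hs) ih.2
    simpa only [neg_smul, one_smul, ← sub_eq_add_neg] using this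

theorem li_support {P J : Set A} (hli : LinearIndependent ℤ (fun p : P => (p : A))) (hJ : J ⊆ P)
    {p y : A} {n : ℤ} (hp : p ∈ P) (hn : n ≠ 0) (hy : y ∈ Submodule.span ℤ (P \ {p}))
    (hs : n • p + y ∈ Submodule.span ℤ J) : p ∈ J := by
  by_contra hpJ
  have h1 : J ⊆ P \ {p} := fun x hx => ⟨hJ hx, fun e => hpJ (e ▸ hx)⟩
  have h2 : n • p ∈ Submodule.span ℤ (P \ {p}) := by
    have := sub_mem (Submodule.span_mono h1 hs) hy
    simpa using this
  have hli' : LinearIndepOn ℤ id P := hli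
  have := LinearIndepOn.eq_zero_of_smul_mem_span hli' hp n (by simpa using h2)
  exact hn this

theorem mem_span_finite {P : Set A} {X : Set A} (hX : X.Finite) (hs : ∀ α ∈ X, α ∈ Submodule.span ℤ P) :
    ∃ J ⊆ P, J.Finite ∧ ∀ α ∈ X, α ∈ Submodule.span ℤ J := by
  induction X, hX using Set.Finite.induction_on with
  | empty => exact ⟨∅, by simp, Set.finite_empty, by simp⟩
  | @insert a X _ _ ih =>
    obtain ⟨J, h1, h2, h3⟩ := ih (fun α hα => hs α (Or.inr hα))
    obtain ⟨T, hT, hT'⟩ := Submodule.mem_span_finite_of_mem_span (hs a (Or.inl rfl))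
    refine ⟨J ∪ T, Set.union_subset h1 hT, h2.union T.finite_toSet, ?_⟩
    rintro α (rfl | hα)
    · exact Submodule.span_mono Set.subset_union_right hT'
    · exact Submodule.span_mono Set.subset_union_left (h3 α hα)

theorem form_span_zero (hf : IsSymForm form) {J : Set A} {a : A} (h : ∀ b ∈ J, form a b = 0) :
    ∀ b ∈ Submodule.span ℤ J, form a b = 0 := by
  intro b hb
  induction hb using Submodule.span_induction with
  | mem x hx => exact h x hx
  | zero => exact hf.zero_right _
  | add x y _ _ h1 h2 => rw [hf.add_right, h1, h2, add_zero]
  | smul n x _ h1 => rw [hf.zsmul_right, h1, mul_zero]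

/-- A good finite set of base elements. -/
def Good (form : A → A → F) (R J : Set A) : Prop :=
  (∀ a ∈ Submodule.span ℤ J, (∀ b ∈ J, form a b = 0) → a = 0) ∧
  (∃ ρ ∈ R, ρ ∈ Submodule.span ℤ J ∧ form ρ ρ ≠ 0) ∧
  ∀ p ∈ J, ∀ q ∈ J, ∃ ρ ∈ R, ρ ∈ Submodule.span ℤ J ∧ form p ρ ≠ 0 ∧ form ρ q ≠ 0

theorem IsLFRSS.finish (h : IsLFRSS form R) (P P0 : Set A) (hPR : P ⊆ R)
    (hli : LinearIndependent ℤ (fun p : P => (p : A)))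
    (hspan : ∀ α ∈ R, α ∈ Submodule.span ℤ P) (hP0 : P0 ⊆ P) (hP0f : P0.Finite)
    (hreach : ∀ J ⊆ P, J.Finite → P0 ⊆ J → ∀ α ∈ R, α ∈ Submodule.span ℤ J → α ≠ 0 →
      ∃ n ≤ 4, Reach R J n α)
    (hnd : ∀ J ⊆ P, J.Finite → P0 ⊆ J → ∃ J', J ⊆ J' ∧ J' ⊆ P ∧ J'.Finite ∧ Good form R J') :
    (∃ P : Set A, IsBase form R P ∧
      ∃ 𝒞 : Set (Set A),
        (∀ S ∈ 𝒞, S.Finite ∧ IsSubSupersystem form R S ∧ IsIrreducibleRSS form S ∧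
          R ∩ (Submodule.span ℤ S : Set A) = S) ∧
        (∀ S ∈ 𝒞, ∀ T ∈ 𝒞, ∃ U ∈ 𝒞, S ⊆ U ∧ T ⊆ U) ∧
        R = (⋃ S ∈ 𝒞, S) ∧
        (∀ S ∈ 𝒞, IsBase form S (P ∩ S))) ∧
    ∀ X : Set A, X ⊆ R → X.Finite →
      ∃ S : Set A, S.Finite ∧ IsSubSupersystem form R S ∧
        R ∩ (Submodule.span ℤ S : Set A) = S ∧ X ⊆ S := by
  have hf := h.sf
  let Sp : Set A → Set A := fun J => R ∩ (Submodule.span ℤ J : Set A)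
  have hspSp : ∀ J ⊆ P, Submodule.span ℤ (Sp J) = Submodule.span ℤ J := by
    intro J hJ
    apply le_antisymm
    · exact Submodule.span_le.2 fun x hx => hx.2
    · exact Submodule.span_mono fun x hx => ⟨hPR (hJ hx), Submodule.subset_span hx⟩
  have hcl : ∀ S : Set A, ∀ a, a ∈ AddSubgroup.closure S ↔ a ∈ Submodule.span ℤ S := by
    intro S a
    rw [← Submodule.span_int_eq_addSubgroupClosure]
    rfl
  have hmono : ∀ J J', J ⊆ J' → Sp J ⊆ Sp J' := fun J J' hJ x hx =>
    ⟨hx.1, Submodule.span_mono hJ hx.2⟩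
  have key : ∀ J ⊆ P, J.Finite → P0 ⊆ J → Good form R J →
      (Sp J).Finite ∧ IsSubSupersystem form R (Sp J) ∧ IsIrreducibleRSS form (Sp J) ∧
          R ∩ (Submodule.span ℤ (Sp J) : Set A) = Sp J := by
    intro J hJ hJf hJ0 hg
    refine ⟨?_, ⟨Set.inter_subset_left, ?_, ⟨h.1.zero_mem, zero_mem _⟩, ?_, ?_⟩, ⟨?_, ?_⟩, ?_⟩
    · have hfin : ({0} ∪ ⋃ n ∈ Set.Iic 4, {α | Reach R J n α}).Finite :=
        (Set.finite_singleton 0).union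
          ((Set.finite_Iic 4).biUnion fun n _ => Reach.finite hJf n)
      refine hfin.subset ?_
      intro α hα
      by_cases h0 : α = 0
      · exact Or.inl h0
      · obtain ⟨n, hn, hr⟩ := hreach J hJ hJf hJ0 α hα.1 hα.2 h0
        exact Or.inr (Set.mem_biUnion (Set.mem_Iic.2 hn) hr)
    · intro a ha hb
      rw [hcl, hspSp J hJ] at ha
      refine hg.1 a ha fun b hbJ => hb b ?_
      exact AddSubgroup.subset_closure ⟨hPR (hJ hbJ), Submodule.subset_span hbJ⟩
    · intro α hα hr β hβ n hn
      exact ⟨h.refl_mem hα.1 hr hβ.1 hn, sub_mem hβ.2 (Submodule.smul_mem _ _ hα.2)⟩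
    · intro γ hγ hn β hβ hγβ
      rcases h.add_or_sub hγ.1 hβ.1 (by rwa [hf.symm]) with h1 | h1
      · exact Or.inr ⟨h1, add_mem hγ.2 hβ.2⟩
      · exact Or.inl ⟨h1, sub_mem hγ.2 hβ.2⟩
    · obtain ⟨ρ, h1, h2, h3⟩ := hg.2.1
      intro e
      have : ρ ∈ reRoots form (Sp J) := Or.inl ⟨⟨h1, h2⟩, h3⟩
      rw [e] at this
      rw [Set.mem_singleton_iff.1 this] at h3
      exact h3 (hf.zero_left _)
    · intro α hα β hβ
      have nbr : ∀ α ∈ Sp J \ formRadical form, ∃ p ∈ J, form α p ≠ 0 := by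
        intro α hα
        by_contra! hcon
        have := hg.1 α hα.1.2 hcon
        exact hα.2 (by rw [h.mem_rad]; exact this)
      obtain ⟨p, hp, hap⟩ := nbr α hα
      obtain ⟨q, hq, hbq⟩ := nbr β hβ
      obtain ⟨ρ, h1, h2, h3, h4⟩ := hg.2.2 p hp q hq
      have nz : ∀ x y, form x y ≠ 0 → x ∉ formRadical form := fun x y hxy hx => hxy (hx y)
      refine ⟨4, ![α, p, ρ, q, β], ?_, rfl, rfl, ?_⟩
      · intro i
        fin_cases i
        · exact hα
        · exact ⟨⟨hPR (hJ hp), Submodule.subset_span hp⟩, nz _ _ h3⟩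
        · exact ⟨⟨h1, h2⟩, nz _ _ h4⟩
        · exact ⟨⟨hPR (hJ hq), Submodule.subset_span hq⟩, nz _ β (by rwa [hf.symm])⟩
        · exact hβ
      · intro i
        fin_cases i
        · exact hap
        · exact h3
        · exact h4
        · show form q β ≠ 0
          rwa [hf.symm]
    · rw [hspSp J hJ]
  have exJ : ∀ X : Set A, X ⊆ R → X.Finite → ∃ J ⊆ P, J.Finite ∧ P0 ⊆ J ∧ Good form R J ∧ X ⊆ Sp J := by
    intro X hX hXf
    obtain ⟨J, h1, h2, h3⟩ := mem_span_finite hXf (fun α hα => hspan α (hX hα))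
    obtain ⟨J', h4, h5, h6, h7⟩ := hnd (J ∪ P0) (Set.union_subset h1 hP0) (h2.union hP0f)
      Set.subset_union_right
    refine ⟨J', h5, h6, Set.subset_union_right.trans h4, h7, fun x hx => ⟨hX hx, ?_⟩⟩
    exact Submodule.span_mono (Set.subset_union_left.trans h4) (h3 x hx)
  have base : ∀ J ⊆ P, (∀ α ∈ R, α ∈ Submodule.span ℤ J → α ≠ 0 → ∃ n, Reach R J n α) →
      IsBase form (Sp J) J := by
    intro J hJ hr
    refine ⟨⟨fun x hx => ⟨hPR (hJ hx), Submodule.subset_span hx⟩, ?_, (hspSp J hJ).symm⟩, ?_⟩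
    · have hli' : LinearIndepOn ℤ id P := hli
      exact hli'.mono hJ
    · intro α hα
      have h0 : α ≠ 0 := fun e => hα.2 (by rw [h.mem_rad]; exact e)
      obtain ⟨n, hn⟩ := hr α hα.1.1 hα.1.2 h0
      obtain ⟨_, a, r, h1⟩ := hn.path (S := Sp J \ formRadical form)
        (fun x hx hx0 hxs => ⟨⟨hx, hxs⟩, fun e => hx0 (by rwa [h.mem_rad] at e)⟩)
      exact ⟨n, a, r, h1⟩
  refine ⟨⟨P, ?_, {S | ∃ J ⊆ P, J.Finite ∧ P0 ⊆ J ∧ Good form R J ∧ S = Sp J}, ?_, ?_, ?_, ?_⟩, ?_⟩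
  · have hRP : Sp P = R := by
      ext x; exact ⟨fun hx => hx.1, fun hx => ⟨hx, hspan x hx⟩⟩
    have := base P subset_rfl ?_
    · rwa [hRP] at this
    · intro α hα hαs h0
      obtain ⟨J, h1, h2, h3, h4, h5⟩ := exJ {α} (by simpa using hα) (Set.finite_singleton α)
      obtain ⟨n, _, hn⟩ := hreach J h1 h2 h3 α hα (h5 rfl).2 h0
      exact ⟨n, hn.mono h1⟩
  · rintro S ⟨J, h1, h2, h3, h4, rfl⟩
    exact key J h1 h2 h3 h4
  · rintro S ⟨J, h1, h2, h3, h4, rfl⟩ T ⟨K, g1, g2, g3, g4, rfl⟩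
    obtain ⟨J', k1, k2, k3, k4⟩ := hnd (J ∪ K) (Set.union_subset h1 g1) (h2.union g2)
      (h3.trans Set.subset_union_left)
    exact ⟨Sp J', ⟨J', k2, k3, h3.trans (Set.subset_union_left.trans k1), k4, rfl⟩,
      hmono _ _ (Set.subset_union_left.trans k1), hmono _ _ (Set.subset_union_right.trans k1)⟩
  · ext x
    simp only [Set.mem_iUnion, Set.mem_setOf_eq, exists_prop]
    constructor
    · intro hx
      obtain ⟨J, h1, h2, h3, h4, h5⟩ := exJ {x} (by simpa using hx) (Set.finite_singleton x)
      exact ⟨Sp J, ⟨J, h1, h2, h3, h4, rfl⟩, h5 rfl⟩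
    · rintro ⟨S, ⟨J, h1, h2, h3, h4, rfl⟩, hx⟩
      exact hx.1
  · rintro S ⟨J, h1, h2, h3, h4, rfl⟩
    have : P ∩ Sp J = J := by
      ext p
      constructor
      · rintro ⟨hp, hpR, hps⟩
        refine li_support hli h1 hp (n := 1) one_ne_zero (zero_mem _) ?_
        simpa using hps
      · intro hp
        exact ⟨h1 hp, hPR (h1 hp), Submodule.subset_span hp⟩
    rw [this]
    refine base J h1 fun α hα hαs h0 => ?_
    obtain ⟨n, _, hn⟩ := hreach J h1 h2 h3 α hα hαs h0
    exact ⟨n, hn⟩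
  · intro X hX hXf
    obtain ⟨J, h1, h2, h3, h4, h5⟩ := exJ X hX hXf
    have := key J h1 h2 h3 h4
    exact ⟨Sp J, this.1, this.2.1, this.2.2.2, h5⟩

end Finish


set_option linter.unusedSimpArgs false
set_option linter.unusedVariables false

section Finish2

variable {F : Type*} [Field F] [CharZero F] {A : Type*} [AddCommGroup A] {form : A → A → F}
  {R : Set A}

/-- The conclusion of the main theorem. -/
def Concl (form : A → A → F) (R : Set A) : Prop :=
    (∃ P : Set A, IsBase form R P ∧
      ∃ 𝒞 : Set (Set A),
        (∀ S ∈ 𝒞, S.Finite ∧ IsSubSupersystem form R S ∧ IsIrreducibleRSS form S ∧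
          R ∩ (Submodule.span ℤ S : Set A) = S) ∧
        (∀ S ∈ 𝒞, ∀ T ∈ 𝒞, ∃ U ∈ 𝒞, S ⊆ U ∧ T ⊆ U) ∧
        R = (⋃ S ∈ 𝒞, S) ∧
        (∀ S ∈ 𝒞, IsBase form S (P ∩ S))) ∧
    ∀ X : Set A, X ⊆ R → X.Finite →
      ∃ S : Set A, S.Finite ∧ IsSubSupersystem form R S ∧
        R ∩ (Submodule.span ℤ S : Set A) = S ∧ X ⊆ S

/-- Nondegeneracy of the Gram matrix of a finite set, on integer vectors. -/
def CoefND (form : A → A → F) (J : Finset A) : Prop :=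
  ∀ n : A → ℤ, (∀ q ∈ J, ∑ p ∈ J, (n p : F) * form p q = 0) → ∀ p ∈ J, n p = 0

/-- Membership of a base element in the support. -/
def Supp (P : Set A) (J : Finset A) : Prop :=
  ∀ (p y : A) (n : ℤ), p ∈ P → n ≠ 0 → y ∈ Submodule.span ℤ (P \ {p}) →
    n • p + y ∈ Submodule.span ℤ (J : Set A) → p ∈ J

theorem IsLFRSS.finish2 (h : IsLFRSS form R) (P : Set A) (P0 : Finset A) (hPR : P ⊆ R)
    (hspan : ∀ α ∈ R, α ∈ Submodule.span ℤ P) (hP0 : (P0 : Set A) ⊆ P)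
    (hreach : ∀ J : Finset A, (J : Set A) ⊆ P → P0 ⊆ J → Supp P J → ∀ α ∈ R,
      α ∈ Submodule.span ℤ (J : Set A) → α ≠ 0 → ∃ n ≤ 4, Reach R J n α)
    (hnd : ∀ J : Finset A, (J : Set A) ⊆ P → P0 ⊆ J → ∃ J' : Finset A, J ⊆ J' ∧ (J' : Set A) ⊆ P ∧
      CoefND form J' ∧
      (∃ ρ ∈ R, ρ ∈ Submodule.span ℤ (J' : Set A) ∧ form ρ ρ ≠ 0) ∧
      ∀ p ∈ J', ∀ q ∈ J', ∃ ρ ∈ R, ρ ∈ Submodule.span ℤ (J' : Set A) ∧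
        form p ρ ≠ 0 ∧ form ρ q ≠ 0) : Concl form R := by
  classical
  have hf := h.sf
  have hli : LinearIndependent ℤ (fun p : P => (p : A)) := by
    have : LinearIndepOn ℤ id P := by
      rw [linearIndepOn_iff']
      intro t g ht hsum i hi
      obtain ⟨J', h1, h2, h3, _⟩ := hnd (t ∪ P0) (by
        rw [Finset.coe_union]; exact Set.union_subset ht hP0) Finset.subset_union_right
      have ht' : t ⊆ J' := Finset.subset_union_left.trans h1
      have := h3 (fun p => if p ∈ t then g p else 0) (by
        intro q hq
        have e : ∑ p ∈ J', (((if p ∈ t then g p else 0 : ℤ)) : F) * form p q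
            = form (∑ p ∈ t, g p • p) q := by
          rw [hf.sum_left, ← Finset.sum_subset ht']
          · refine Finset.sum_congr rfl fun p hp => ?_
            rw [if_pos hp, hf.zsmul_left]
          · intro p _ hp
            rw [if_neg hp]; simp
        rw [e]
        have : ∑ p ∈ t, g p • p = 0 := by simpa using hsum
        rw [this, hf.zero_left]) i (ht' hi)
      simpa [hi] using this
    exact this
  refine h.finish P P0 hPR hli hspan hP0 P0.finite_toSet ?_ ?_
  · intro J hJ hJf hJ0
    lift J to Finset A using hJf
    refine hreach J hJ (by simpa using hJ0) ?_
    intro p y n hp hn hy hs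
    exact li_support hli hJ hp hn hy hs
  · intro J hJ hJf hJ0
    lift J to Finset A using hJf
    obtain ⟨J', h1, h2, h3, h4, h5⟩ := hnd J hJ (by simpa using hJ0)
    refine ⟨J', by simpa using h1, h2, J'.finite_toSet, ?_, h4, h5⟩
    intro a ha hb
    obtain ⟨g, _, rfl⟩ := Submodule.mem_span_finset.1 ha
    have := h3 g (by
      intro q hq
      have := hb q hq
      rw [hf.sum_left] at this
      rw [← this]
      exact Finset.sum_congr rfl fun p _ => (hf.zsmul_left _ _ _).symm)
    exact Finset.sum_eq_zero fun p hp => by rw [this p hp, zero_smul]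

theorem Reach.step_add {J : Set A} {n : ℕ} {x p z : A} (hr : Reach R J n x) (hp : p ∈ J)
    (hz : x + p = z) (hR : z ∈ R) (h0 : z ≠ 0) : Reach R J (n + 1) z := by
  subst hz; exact .add n x p hr hp hR h0

theorem Reach.step_sub {J : Set A} {n : ℕ} {x p z : A} (hr : Reach R J n x) (hp : p ∈ J)
    (hz : x - p = z) (hR : z ∈ R) (h0 : z ≠ 0) : Reach R J (n + 1) z := by
  subst hz; exact .sub n x p hr hp hR h0

theorem Reach.one {J : Set A} {p : A} (hp : p ∈ J) (hR : p ∈ R) (h0 : p ≠ 0) : Reach R J 1 p :=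
  Reach.zero.step_add hp (zero_add p) hR h0

theorem Reach.neg (h : IsLFRSS form R) {J : Set A} {n : ℕ} {x : A} (hr : Reach R J n x) :
    Reach R J n (-x) := by
  induction hr with
  | zero => rw [neg_zero]; exact .zero
  | add n x p _ hp h1 h2 ih =>
    exact ih.step_sub hp (by abel) (h.neg h1) (neg_ne_zero.2 h2)
  | sub n x p _ hp h1 h2 ih =>
    exact ih.step_add hp (by abel) (h.neg h1) (neg_ne_zero.2 h2)

theorem sp_of_ne {P : Set A} {p q : A} (hq : q ∈ P) (hpq : q ≠ p) :
    q ∈ Submodule.span ℤ (P \ {p}) := Submodule.subset_span ⟨hq, hpq⟩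

theorem IsLFRSS.finishA (h : IsLFRSS form R) {c : F} (hc : c ≠ 0) (P : Set A) (hPR : P ⊆ R)
    (h0 : ∀ p ∈ P, p ≠ 0) (hg : ∀ p ∈ P, ∀ q ∈ P, p ≠ q → form p q = c ∧ p - q ∈ R)
    (hN : ∀ p ∈ P, form p p = 2 * c ∨ form p p = 0)
    (hinf : {p ∈ P | form p p = 2 * c}.Infinite)
    (hroots : ∀ α ∈ R, α ≠ 0 → ∃ p ∈ P, α = p ∨ α = -p ∨ ∃ q ∈ P, p ≠ q ∧ α = p - q) :
    Concl form R := by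
  classical
  have hf := h.sf
  obtain ⟨e, he⟩ := hinf.nonempty
  refine h.finish2 P {e} hPR ?_ (by simpa using he.1) ?_ ?_
  · intro α hα
    by_cases hα0 : α = 0
    · rw [hα0]; exact zero_mem _
    obtain ⟨p, hp, rfl | rfl | ⟨q, hq, hpq, rfl⟩⟩ := hroots α hα hα0
    · exact Submodule.subset_span hp
    · exact neg_mem (Submodule.subset_span hp)
    · exact sub_mem (Submodule.subset_span hp) (Submodule.subset_span hq)
  · intro J hJ _ hs α hα hαs hα0
    obtain ⟨p, hp, rfl | rfl | ⟨q, hq, hpq, rfl⟩⟩ := hroots α hα hα0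
    · have := hs α 0 1 hp one_ne_zero (zero_mem _) (by simpa using hαs)
      exact ⟨1, by norm_num, .one this hα hα0⟩
    · have := hs p 0 (-1) hp (by norm_num) (zero_mem _) (by simpa using hαs)
      exact ⟨1, by norm_num, (Reach.one this (hPR hp) (h0 p hp)).neg h⟩
    · have h1 := hs p (-q) 1 hp (by norm_num) (neg_mem (sp_of_ne hq (Ne.symm hpq)))
        (by simpa [sub_eq_add_neg] using hαs)
      have h2 := hs q p (-1) hq (by norm_num) (sp_of_ne hp hpq)
        (by simpa [sub_eq_add_neg, add_comm] using hαs)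
      exact ⟨2, by norm_num, (Reach.one h1 (hPR hp) (h0 p hp)).step_sub h2 rfl hα hα0⟩
  · intro J hJ hJe
    let s : A → ℤ := fun p => if form p p = 2 * c then 1 else -1
    have hsN : ∀ p ∈ P, form p p = c + c * (s p : F) := by
      intro p hp
      by_cases h1 : form p p = 2 * c
      · simp only [s, if_pos h1]; rw [h1]; push_cast; ring
      · have := (hN p hp).resolve_left h1
        simp only [s, if_neg h1]; rw [this]; push_cast; ring
    have hs1 : ∀ p, s p * s p = 1 := by
      intro p; by_cases h1 : form p p = 2 * c <;> simp [s, h1]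
    have exJ' : ∃ J' : Finset A, J ⊆ J' ∧ (J' : Set A) ⊆ P ∧ 1 + ∑ p ∈ J', s p ≠ 0 := by
      by_cases h1 : 1 + ∑ p ∈ J, s p = 0
      · obtain ⟨x, hx, hxJ⟩ := inf_avoid hinf J
        refine ⟨insert x J, Finset.subset_insert _ _, ?_, ?_⟩
        · rw [Finset.coe_insert]; exact Set.insert_subset hx.1 hJ
        · rw [Finset.sum_insert hxJ]
          have : s x = 1 := by simp [s, hx.2]
          rw [this]; omega
      · exact ⟨J, subset_rfl, hJ, h1⟩
    obtain ⟨J', hJJ, hJP, hsum⟩ := exJ'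
    have heJ : e ∈ J' := hJJ (hJe (Finset.mem_singleton_self e))
    have h2c : form e e ≠ 0 := by rw [he.2]; exact mul_ne_zero two_ne_zero hc
    refine ⟨J', hJJ, hJP, ?_, ⟨e, hPR he.1, Submodule.subset_span heJ, h2c⟩, ?_⟩
    · intro n hn
      have e1 : ∀ q ∈ J', n q * s q = - ∑ p ∈ J', n p := by
        intro q hq
        have h1 := hn q hq
        have h2 : ∑ p ∈ J', (n p : F) * form p q
            = ∑ p ∈ J', ((n p : F) * c + if p = q then (n q : F) * c * s q else 0) := by
          refine Finset.sum_congr rfl fun p hp => ?_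
          by_cases hpq : p = q
          · subst hpq; rw [if_pos rfl, hsN p (hJP hp)]; ring
          · rw [if_neg hpq, (hg p (hJP hp) q (hJP hq) hpq).1, add_zero]
        rw [h2, Finset.sum_add_distrib, Finset.sum_ite_eq', if_pos hq, ← Finset.sum_mul] at h1
        have h3 : (((∑ p ∈ J', n p) + n q * s q : ℤ) : F) = 0 := by
          push_cast
          apply mul_left_cancel₀ hc
          linear_combination h1
        have h4 : (∑ p ∈ J', n p) + n q * s q = 0 := by exact_mod_cast h3
        omega
      have e2 : ∀ q ∈ J', n q = - (∑ p ∈ J', n p) * s q := by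
        intro q hq
        have := e1 q hq
        calc n q = n q * s q * s q := by rw [mul_assoc, hs1, mul_one]
          _ = _ := by rw [this]
      have e3 : (∑ p ∈ J', n p) * (1 + ∑ p ∈ J', s p) = 0 := by
        have := Finset.sum_congr rfl e2
        rw [← Finset.mul_sum] at this
        linear_combination this
      have e4 := (mul_eq_zero.1 e3).resolve_right hsum
      intro p hp
      rw [e2 p hp, e4]; simp
    · intro p hp q hq
      refine ⟨e, hPR he.1, Submodule.subset_span heJ, ?_, ?_⟩
      · by_cases hpe : p = e
        · rw [hpe]; exact h2c
        · rw [(hg p (hJP hp) e he.1 hpe).1]; exact hc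
      · by_cases hpe : e = q
        · rw [← hpe]; exact h2c
        · rw [(hg e he.1 q (hJP hq) hpe).1]; exact hc

theorem IsLFRSS.finishB (h : IsLFRSS form R) (P : Set A) (hPR : P ⊆ R)
    (hg : ∀ p ∈ P, ∀ q ∈ P, p ≠ q → form p q = 0 ∧ p + q ∈ R ∧ p - q ∈ R)
    (hN : ∀ p ∈ P, form p p ≠ 0) (hne : P.Nonempty)
    (hroots : ∀ α ∈ R, α ≠ 0 → ∃ β, (α = β ∨ α = -β) ∧ ∃ p ∈ P, β = p ∨ β = p + p ∨
      ∃ q ∈ P, p ≠ q ∧ (β = p + q ∨ β = p - q)) :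
    Concl form R := by
  classical
  have hf := h.sf
  obtain ⟨e, he⟩ := hne
  have h0 : ∀ p ∈ P, p ≠ 0 := fun p hp e => hN p hp (by rw [e, hf.zero_left])
  refine h.finish2 P {e} hPR ?_ (by simpa using he) ?_ ?_
  · intro α hα
    by_cases hα0 : α = 0
    · rw [hα0]; exact zero_mem _
    obtain ⟨β, hαβ, hβ⟩ := hroots α hα hα0
    have : β ∈ Submodule.span ℤ P := by
      obtain ⟨p, hp, rfl | rfl | ⟨q, hq, hpq, rfl | rfl⟩⟩ := hβ
      · exact Submodule.subset_span hp
      · exact add_mem (Submodule.subset_span hp) (Submodule.subset_span hp)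
      · exact add_mem (Submodule.subset_span hp) (Submodule.subset_span hq)
      · exact sub_mem (Submodule.subset_span hp) (Submodule.subset_span hq)
    rcases hαβ with rfl | rfl
    · exact this
    · exact neg_mem this
  · intro J hJ _ hs α hα hαs hα0
    obtain ⟨β, hαβ, hβ⟩ := hroots α hα hα0
    have : ∃ n ≤ 4, Reach R J n β := by
      have hβR : β ∈ R := by
        rcases hαβ with rfl | rfl
        · exact hα
        · simpa using h.neg hα
      have hβs : β ∈ Submodule.span ℤ (J : Set A) := by
        rcases hαβ with rfl | rfl
        · exact hαs
        · simpa using neg_mem hαs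
      have hβ0 : β ≠ 0 := by
        rcases hαβ with rfl | rfl
        · exact hα0
        · simpa using hα0
      obtain ⟨p, hp, rfl | rfl | ⟨q, hq, hpq, rfl | rfl⟩⟩ := hβ
      · have := hs β 0 1 hp one_ne_zero (zero_mem _) (by simpa using hβs)
        exact ⟨1, by norm_num, .one this hβR hβ0⟩
      · have := hs p 0 2 hp two_ne_zero (zero_mem _) (by simpa [two_smul] using hβs)
        exact ⟨2, by norm_num, (Reach.one this (hPR hp) (h0 p hp)).step_add this rfl hβR hβ0⟩
      · have h1 := hs p q 1 hp (by norm_num) (sp_of_ne hq (Ne.symm hpq)) (by simpa using hβs)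
        have h2 := hs q p 1 hq (by norm_num) (sp_of_ne hp hpq) (by simpa [add_comm] using hβs)
        exact ⟨2, by norm_num, (Reach.one h1 (hPR hp) (h0 p hp)).step_add h2 rfl hβR hβ0⟩
      · have h1 := hs p (-q) 1 hp (by norm_num) (neg_mem (sp_of_ne hq (Ne.symm hpq)))
          (by simpa [sub_eq_add_neg] using hβs)
        have h2 := hs q p (-1) hq (by norm_num) (sp_of_ne hp hpq)
          (by simpa [sub_eq_add_neg, add_comm] using hβs)
        exact ⟨2, by norm_num, (Reach.one h1 (hPR hp) (h0 p hp)).step_sub h2 rfl hβR hβ0⟩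
    obtain ⟨n, hn, hr⟩ := this
    rcases hαβ with rfl | rfl
    · exact ⟨n, hn, hr⟩
    · exact ⟨n, hn, hr.neg h⟩
  · intro J hJ hJe
    have heJ : e ∈ J := hJe (Finset.mem_singleton_self e)
    refine ⟨J, subset_rfl, hJ, ?_, ⟨e, hPR he, Submodule.subset_span heJ, hN e he⟩, ?_⟩
    · intro n hn q hq
      have h1 := hn q hq
      rw [Finset.sum_eq_single q] at h1
      · have := (mul_eq_zero.1 h1).resolve_right (hN q (hJ hq))
        exact_mod_cast this
      · intro p hp hpq
        rw [(hg p (hJ hp) q (hJ hq) hpq).1, mul_zero]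
      · intro hq'; exact absurd hq hq'
    · intro p hp q hq
      by_cases hpq : p = q
      · subst hpq
        exact ⟨p, hPR (hJ hp), Submodule.subset_span hp, hN p (hJ hp), hN p (hJ hp)⟩
      · have := hg p (hJ hp) q (hJ hq) hpq
        refine ⟨p + q, this.2.1, add_mem (Submodule.subset_span hp) (Submodule.subset_span hq), ?_, ?_⟩
        · rw [hf.add_right, this.1, add_zero]; exact hN p (hJ hp)
        · rw [hf.add_left, this.1, zero_add]; exact hN q (hJ hq)

end Finish2


set_option linter.unusedSimpArgs false
set_option linter.unusedVariables false

section Finish3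

variable {F : Type*} [Field F] [CharZero F] {A : Type*} [AddCommGroup A] {form : A → A → F}
  {R : Set A}

/-- reduction of the span and reachability conditions to roots up to sign -/
theorem IsLFRSS.finish3 (h : IsLFRSS form R) (Q : A → Prop) (P : Set A) (P0 : Finset A) (hPR : P ⊆ R)
    (hroots : ∀ α ∈ R, α ≠ 0 → ∃ β, (α = β ∨ α = -β) ∧ Q β)
    (hspan : ∀ β, Q β → β ∈ Submodule.span ℤ P) (hP0 : (P0 : Set A) ⊆ P)
    (hreach : ∀ J : Finset A, (J : Set A) ⊆ P → P0 ⊆ J → Supp P J → ∀ β ∈ R,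
      β ∈ Submodule.span ℤ (J : Set A) → β ≠ 0 → Q β → ∃ n ≤ 4, Reach R J n β)
    (hnd : ∀ J : Finset A, (J : Set A) ⊆ P → P0 ⊆ J → 
      CoefND form J ∧
      (∃ ρ ∈ R, ρ ∈ Submodule.span ℤ (J : Set A) ∧ form ρ ρ ≠ 0) ∧
      ∀ p ∈ J, ∀ q ∈ J, ∃ ρ ∈ R, ρ ∈ Submodule.span ℤ (J : Set A) ∧
        form p ρ ≠ 0 ∧ form ρ q ≠ 0) : Concl form R := by
  refine h.finish2 P P0 hPR ?_ hP0 ?_ (fun J h1 h2 => ⟨J, subset_rfl, h1, hnd J h1 h2⟩)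
  · intro α hα
    by_cases hα0 : α = 0
    · rw [hα0]; exact zero_mem _
    obtain ⟨β, hαβ, hβ⟩ := hroots α hα hα0
    have := hspan β hβ
    rcases hαβ with rfl | rfl
    · exact this
    · exact neg_mem this
  · intro J hJ hJ0 hs α hα hαs hα0
    obtain ⟨β, hαβ, hβ⟩ := hroots α hα hα0
    have hβR : β ∈ R := by
      rcases hαβ with rfl | rfl
      · exact hα
      · simpa using h.neg hα
    have hβs : β ∈ Submodule.span ℤ (J : Set A) := by
      rcases hαβ with rfl | rfl
      · exact hαs
      · simpa using neg_mem hαs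
    have hβ0 : β ≠ 0 := by
      rcases hαβ with rfl | rfl
      · exact hα0
      · simpa using hα0
    obtain ⟨n, hn, hr⟩ := hreach J hJ hJ0 hs β hβR hβs hβ0 hβ
    rcases hαβ with rfl | rfl
    · exact ⟨n, hn, hr⟩
    · exact ⟨n, hn, hr.neg h⟩

theorem IsLFRSS.finishC (h : IsLFRSS form R) {d : F} (hd : d ≠ 0) (E : A) (P : Set A)
    (hE : E ∈ R) (hPR : P ⊆ R) (hEE : form E E = 4 * d)
    (hEp : ∀ p ∈ P, form E p = 2 * d ∧ form p p ≠ d ∧ E - p ∈ R)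
    (hg : ∀ p ∈ P, ∀ q ∈ P, p ≠ q → form p q = d)
    (hroots : ∀ α ∈ R, α ≠ 0 → ∃ β, (α = β ∨ α = -β) ∧ (β = E ∨ ∃ p ∈ P, β = p ∨ β = E - p ∨
      β = E - p - p ∨ ∃ q ∈ P, p ≠ q ∧ (β = p - q ∨ β = E - p - q))) :
    Concl form R := by
  classical
  have hf := h.sf
  have h2d : (2 : F) * d ≠ 0 := mul_ne_zero two_ne_zero hd
  have h4d : (4 : F) * d ≠ 0 := mul_ne_zero (by norm_num) hd
  have hE0 : E ≠ 0 := fun e => h4d (by rw [← hEE, e, hf.zero_left])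
  have hp0 : ∀ p ∈ P, p ≠ 0 := fun p hp e => h2d (by rw [← (hEp p hp).1, e, hf.zero_right])
  have hEp0 : ∀ p ∈ P, E - p ≠ 0 := fun p hp e => h2d (by
    have h1 : form E (E - p) = 2 * d := by
      rw [hf.sub_right, hEE, (hEp p hp).1]; ring
    rw [← h1, e, hf.zero_right])
  have hEP : E ∉ P := fun hEP => h2d (by
    have := (hEp E hEP).1
    rw [hEE] at this
    linear_combination this)
  have hne : ∀ p ∈ P, p ≠ E := fun p hp e => hEP (e ▸ hp)
  have sE : E ∈ Submodule.span ℤ (insert E P) := Submodule.subset_span (Set.mem_insert _ _)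
  have sP : ∀ p ∈ P, p ∈ Submodule.span ℤ (insert E P) := fun p hp =>
    Submodule.subset_span (Set.mem_insert_of_mem _ hp)
  have iE : E ∈ insert E P := Set.mem_insert _ _
  have iP : ∀ p ∈ P, p ∈ insert E P := fun p hp => Set.mem_insert_of_mem _ hp
  refine h.finish3 _ (insert E P) {E} (Set.insert_subset hE hPR) hroots ?_ (by simp) ?_ ?_
  · rintro β (rfl | ⟨p, hp, rfl | rfl | rfl | ⟨q, hq, hpq, rfl | rfl⟩⟩)
    · exact sE
    · exact sP _ hp
    · exact sub_mem sE (sP _ hp)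
    · exact sub_mem (sub_mem sE (sP _ hp)) (sP _ hp)
    · exact sub_mem (sP _ hp) (sP _ hq)
    · exact sub_mem (sub_mem sE (sP _ hp)) (sP _ hq)
  · intro J hJ hJ0 hs β hβR hβs hβ0 hβ
    have hEJ : E ∈ J := by simpa using hJ0
    rcases hβ with rfl | ⟨p, hp, rfl | rfl | rfl | ⟨q, hq, hpq, rfl | rfl⟩⟩
    · exact ⟨1, by norm_num, .one hEJ hβR hβ0⟩
    · have := hs β 0 1 (iP _ hp) one_ne_zero (zero_mem _) (by simpa using hβs)
      exact ⟨1, by norm_num, .one this hβR hβ0⟩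
    · have := hs p E (-1) (iP _ hp) (by norm_num) (sp_of_ne iE (hne p hp).symm)
        (by simpa [sub_eq_add_neg, add_comm] using hβs)
      exact ⟨2, by norm_num, (Reach.one hEJ hE hE0).step_sub this rfl hβR hβ0⟩
    · have := hs p E (-2) (iP _ hp) (by norm_num) (sp_of_ne iE (hne p hp).symm) (by
        convert hβs using 1; module)
      exact ⟨3, by norm_num, ((Reach.one hEJ hE hE0).step_sub this rfl (hEp p hp).2.2
        (hEp0 p hp)).step_sub this rfl hβR hβ0⟩
    · have h1 := hs p (-q) 1 (iP _ hp) (by norm_num) (neg_mem (sp_of_ne (iP _ hq) (Ne.symm hpq)))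
        (by simpa [sub_eq_add_neg] using hβs)
      have h2 := hs q p (-1) (iP _ hq) (by norm_num) (sp_of_ne (iP _ hp) hpq)
        (by simpa [sub_eq_add_neg, add_comm] using hβs)
      exact ⟨2, by norm_num, (Reach.one h1 (hPR hp) (hp0 p hp)).step_sub h2 rfl hβR hβ0⟩
    · have h1 := hs p (E - q) (-1) (iP _ hp) (by norm_num)
        (sub_mem (sp_of_ne iE (hne p hp).symm) (sp_of_ne (iP _ hq) (Ne.symm hpq)))
        (by convert hβs using 1; module)
      have h2 := hs q (E - p) (-1) (iP _ hq) (by norm_num)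
        (sub_mem (sp_of_ne iE (hne q hq).symm) (sp_of_ne (iP _ hp) hpq))
        (by convert hβs using 1; module)
      exact ⟨3, by norm_num, ((Reach.one hEJ hE hE0).step_sub h1 rfl (hEp p hp).2.2
        (hEp0 p hp)).step_sub h2 rfl hβR hβ0⟩
  · intro J hJ hJ0
    have hEJ : E ∈ J := by simpa using hJ0
    have hEE0 : form E E ≠ 0 := by rw [hEE]; exact h4d
    have hEx : ∀ p ∈ J, form E p ≠ 0 := by
      intro p hp
      rcases hJ hp with rfl | hp
      · exact hEE0
      · rw [(hEp p hp).1]; exact h2d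
    refine ⟨?_, ⟨E, hE, Submodule.subset_span hEJ, hEE0⟩, ?_⟩
    · intro n hn
      have hJ1 : ∀ p ∈ J.erase E, p ∈ P := fun p hp =>
        (hJ (Finset.mem_of_mem_erase hp)).resolve_left (Finset.ne_of_mem_erase hp)
      have hsum : ∀ q ∈ J, (n E : F) * form E q + ∑ p ∈ J.erase E, (n p : F) * form p q = 0 := by
        intro q hq
        rw [← hn q hq, Finset.add_sum_erase J (fun p => (n p : F) * form p q) hEJ]
      have e1 : 2 * (n E : F) + ∑ p ∈ J.erase E, (n p : F) = 0 := by
        have := hsum E hEJ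
        have h2 : ∑ p ∈ J.erase E, (n p : F) * form p E = (∑ p ∈ J.erase E, (n p : F)) * (2 * d) := by
          rw [Finset.sum_mul]
          refine Finset.sum_congr rfl fun p hp => ?_
          rw [hf.symm, (hEp p (hJ1 p hp)).1]
        rw [h2, hEE] at this
        apply mul_left_cancel₀ h2d
        linear_combination this
      have e2 : ∀ q ∈ J.erase E, n q = 0 := by
        intro q hq
        have hqP := hJ1 q hq
        have h1 := hsum q (Finset.mem_of_mem_erase hq)
        have h2 : ∑ p ∈ J.erase E, (n p : F) * form p q
            = ∑ p ∈ J.erase E, ((n p : F) * d + if p = q then (n q : F) * (form q q - d) else 0) := by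
          refine Finset.sum_congr rfl fun p hp => ?_
          by_cases hpq : p = q
          · subst hpq; rw [if_pos rfl]; ring
          · rw [if_neg hpq, hg p (hJ1 p hp) q hqP hpq, add_zero]
        rw [h2, Finset.sum_add_distrib, Finset.sum_ite_eq', if_pos hq, ← Finset.sum_mul,
          (hEp q hqP).1] at h1
        have h3 : (n q : F) * (form q q - d) = 0 := by linear_combination h1 - d * e1
        have := (mul_eq_zero.1 h3).resolve_right (sub_ne_zero.2 (hEp q hqP).2.1)
        exact_mod_cast this
      have e3 : n E = 0 := by
        rw [Finset.sum_eq_zero (fun p hp => by rw [e2 p hp]; simp), add_zero] at e1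
        have := (mul_eq_zero.1 e1).resolve_left two_ne_zero
        exact_mod_cast this
      intro p hp
      by_cases hpE : p = E
      · rw [hpE, e3]
      · exact e2 p (Finset.mem_erase.2 ⟨hpE, hp⟩)
    · intro p hp q hq
      exact ⟨E, hE, Submodule.subset_span hEJ, by rw [hf.symm]; exact hEx p hp, hEx q hq⟩

theorem IsLFRSS.finishD (h : IsLFRSS form R) {d : F} (hd : d ≠ 0) (E : A) (P : Set A)
    (hPR : P ⊆ R) (hEE : form E E = 4 * d)
    (hEp : ∀ p ∈ P, form E p = 2 * d ∧ form p p = 2 * d ∧ E - p ∈ R)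
    (hg : ∀ p ∈ P, ∀ q ∈ P, p ≠ q → form p q = d ∧ E - p - q ∈ R)
    {p1 p2 : A} (hp1 : p1 ∈ P) (hp2 : p2 ∈ P) (h12 : p1 ≠ p2)
    (hroots : ∀ α ∈ R, α ≠ 0 → ∃ β, (α = β ∨ α = -β) ∧ (∃ p ∈ P, β = p ∨ β = E - p ∨
      ∃ q ∈ P, p ≠ q ∧ (β = p - q ∨ β = E - p - q))) :
    Concl form R := by
  classical
  have hf := h.sf
  have h2d : (2 : F) * d ≠ 0 := mul_ne_zero two_ne_zero hd
  obtain ⟨b, hb⟩ : ∃ b, b = E - p1 := ⟨_, rfl⟩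
  have hbp : ∀ q, form b q = form E q - form p1 q := fun q => by rw [hb, hf.sub_left]
  have hbR : b ∈ R := by rw [hb]; exact (hEp p1 hp1).2.2
  have hb1 : form b p1 = 0 := by rw [hbp, (hEp p1 hp1).1, (hEp p1 hp1).2.1, sub_self]
  have hbq : ∀ q ∈ P, q ≠ p1 → form b q = d := by
    intro q hq hq1
    rw [hbp, (hEp q hq).1, (hg p1 hp1 q hq hq1.symm).1]; ring
  have hbb : form b b = 2 * d := by
    rw [hbp, hf.symm p1, hb1, hf.symm E, hbp, hEE, hf.symm p1, (hEp p1 hp1).1]; ring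
  have hb0 : b ≠ 0 := fun e => h2d (by rw [← hbb, e, hf.zero_left])
  have hp0 : ∀ p ∈ P, p ≠ 0 := fun p hp e => h2d (by rw [← (hEp p hp).1, e, hf.zero_right])
  have hEp0 : ∀ p ∈ P, E - p ≠ 0 := fun p hp e => h2d (by
    have h1 : form E (E - p) = 2 * d := by
      rw [hf.sub_right, hEE, (hEp p hp).1]; ring
    rw [← h1, e, hf.zero_right])
  have hEpq0 : ∀ p ∈ P, ∀ q ∈ P, p ≠ q → E - p - q ≠ 0 := fun p hp q hq hpq e => hd (by
    have h1 : form (E - p - q) p = -d := by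
      rw [hf.sub_left, hf.sub_left, (hEp p hp).1, (hEp p hp).2.1, hf.symm q, (hg p hp q hq hpq).1]; ring
    rw [e, hf.zero_left] at h1
    linear_combination h1)
  have hbP : b ∉ P := fun hbP => by
    by_cases e : b = p1
    · rw [e] at hb1
      exact h2d (by rw [← hb1, (hEp p1 hp1).2.1])
    · have := (hg b hbP p1 hp1 e).1
      rw [hb1] at this
      exact hd this.symm
  have hne : ∀ p ∈ P, p ≠ b := fun p hp e => hbP (e ▸ hp)
  have sE : b ∈ Submodule.span ℤ (insert b P) := Submodule.subset_span (Set.mem_insert _ _)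
  have sP : ∀ p ∈ P, p ∈ Submodule.span ℤ (insert b P) := fun p hp =>
    Submodule.subset_span (Set.mem_insert_of_mem _ hp)
  have iE : b ∈ insert b P := Set.mem_insert _ _
  have iP : ∀ p ∈ P, p ∈ insert b P := fun p hp => Set.mem_insert_of_mem _ hp
  have hEb : E = b + p1 := by rw [hb]; abel
  refine h.finish3 _ (insert b P) {b, p1, p2} (Set.insert_subset hbR hPR) hroots ?_ ?_ ?_ ?_
  · have sE' : E ∈ Submodule.span ℤ (insert b P) := by rw [hEb]; exact add_mem sE (sP _ hp1)
    rintro β (⟨p, hp, rfl | rfl | ⟨q, hq, hpq, rfl | rfl⟩⟩)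
    · exact sP _ hp
    · exact sub_mem sE' (sP _ hp)
    · exact sub_mem (sP _ hp) (sP _ hq)
    · exact sub_mem (sub_mem sE' (sP _ hp)) (sP _ hq)
  · intro x hx
    simp only [Finset.coe_insert, Finset.coe_singleton, Set.mem_insert_iff,
      Set.mem_singleton_iff] at hx
    rcases hx with rfl | rfl | rfl
    · exact iE
    · exact iP _ hp1
    · exact iP _ hp2
  · intro J hJ hJ0 hs β hβR hβs hβ0 hβ
    have hbJ : b ∈ J := hJ0 (by simp)
    have h1J : p1 ∈ J := hJ0 (by simp)
    have rb : Reach R (J : Set A) 1 b := .one hbJ hbR hb0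
    have rE : ∀ p ∈ P, p ∈ J → p ≠ p1 → Reach R (J : Set A) 3 (E - p) := by
      intro p hp hpJ hp1'
      exact (rb.step_sub hpJ (z := E - p1 - p) (by rw [hb]) (hg p1 hp1 p hp hp1'.symm).2
        (hEpq0 p1 hp1 p hp hp1'.symm)).step_add h1J (by abel) (hEp p hp).2.2 (hEp0 p hp)
    have mE : ∀ p ∈ P, p ≠ p1 → E ∈ Submodule.span ℤ (insert b P \ {p}) := by
      intro p hp hp1'
      rw [hEb]
      exact add_mem (sp_of_ne iE (hne p hp).symm) (sp_of_ne (iP _ hp1) hp1'.symm)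
    rcases hβ with ⟨p, hp, rfl | rfl | ⟨q, hq, hpq, rfl | rfl⟩⟩
    · have := hs β 0 1 (iP _ hp) one_ne_zero (zero_mem _) (by simpa using hβs)
      exact ⟨1, by norm_num, .one this hβR hβ0⟩
    · by_cases e : p = p1
      · rw [e, ← hb]; exact ⟨1, by norm_num, rb⟩
      · have := hs p E (-1) (iP _ hp) (by norm_num) (mE p hp e)
          (by convert hβs using 1; module)
        exact ⟨3, by norm_num, rE p hp this e⟩
    · have h1 := hs p (-q) 1 (iP _ hp) (by norm_num) (neg_mem (sp_of_ne (iP _ hq) (Ne.symm hpq)))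
        (by simpa [sub_eq_add_neg] using hβs)
      have h2 := hs q p (-1) (iP _ hq) (by norm_num) (sp_of_ne (iP _ hp) hpq)
        (by simpa [sub_eq_add_neg, add_comm] using hβs)
      exact ⟨2, by norm_num, (Reach.one h1 (hPR hp) (hp0 p hp)).step_sub h2 rfl hβR hβ0⟩
    · have hqJ : q ≠ p1 → q ∈ J := fun e => hs q (E - p) (-1) (iP _ hq) (by norm_num)
          (sub_mem (mE q hq e) (sp_of_ne (iP _ hp) hpq)) (by convert hβs using 1; module)
      have hpJ : p ≠ p1 → p ∈ J := fun e => hs p (E - q) (-1) (iP _ hp) (by norm_num)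
          (sub_mem (mE p hp e) (sp_of_ne (iP _ hq) hpq.symm)) (by convert hβs using 1; module)
      by_cases e : p = p1
      · have hq1 : q ≠ p1 := fun e' => hpq (e.trans e'.symm)
        exact ⟨2, by norm_num, rb.step_sub (hqJ hq1) (by rw [hb, e]) hβR hβ0⟩
      · by_cases e' : q = p1
        · exact ⟨2, by norm_num, rb.step_sub (hpJ e) (by rw [hb, e']; abel) hβR hβ0⟩
        · exact ⟨4, le_rfl, (rE p hp (hpJ e) e).step_sub (hqJ e') rfl hβR hβ0⟩
  · intro J hJ hJ0
    have hbJ : b ∈ J := hJ0 (by simp)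
    have h1J : p1 ∈ J := hJ0 (by simp)
    have h2J : p2 ∈ J := hJ0 (by simp)
    have h22 : form p2 p2 ≠ 0 := by rw [(hEp p2 hp2).2.1]; exact h2d
    have hEx : ∀ p ∈ J, form p p2 ≠ 0 := by
      intro p hp
      rcases hJ hp with rfl | hp
      · rw [hbq p2 hp2 h12.symm]; exact hd
      · by_cases e : p = p2
        · rw [e]; exact h22
        · rw [(hg p hp p2 hp2 e).1]; exact hd
    refine ⟨?_, ⟨p2, hPR hp2, Submodule.subset_span h2J, h22⟩, ?_⟩
    · intro n hn
      set J1 := (J.erase b).erase p1 with hJ1def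
      have h1b : p1 ∈ J.erase b := Finset.mem_erase.2 ⟨hne p1 hp1, h1J⟩
      have hJ1 : ∀ p ∈ J1, p ∈ P ∧ p ≠ p1 ∧ p ∈ J := fun p hp => by
        rw [hJ1def, Finset.mem_erase, Finset.mem_erase] at hp
        exact ⟨(hJ hp.2.2).resolve_left hp.2.1, hp.1, hp.2.2⟩
      have hsum : ∀ q ∈ J, (n b : F) * form b q + ((n p1 : F) * form p1 q +
          ∑ p ∈ J1, (n p : F) * form p q) = 0 := by
        intro q hq
        rw [← hn q hq, Finset.add_sum_erase (J.erase b) (fun p => (n p : F) * form p q) h1b,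
          Finset.add_sum_erase J (fun p => (n p : F) * form p q) hbJ]
      have hss : ∀ q, (∀ p ∈ J1, form p q = d) →
          ∑ p ∈ J1, (n p : F) * form p q = (∑ p ∈ J1, (n p : F)) * d := by
        intro q hq
        rw [Finset.sum_mul]
        exact Finset.sum_congr rfl fun p hp => by rw [hq p hp]
      have e1 : 2 * (n b : F) + ∑ p ∈ J1, (n p : F) = 0 := by
        have := hsum b hbJ
        rw [hss b (fun p hp => by rw [hf.symm]; exact hbq p (hJ1 p hp).1 (hJ1 p hp).2.1), hbb,
          hf.symm p1, hb1] at this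
        apply mul_left_cancel₀ hd
        linear_combination this
      have e2 : 2 * (n p1 : F) + ∑ p ∈ J1, (n p : F) = 0 := by
        have := hsum p1 h1J
        rw [hss p1 (fun p hp => (hg p (hJ1 p hp).1 p1 hp1 (hJ1 p hp).2.1).1), hb1,
          (hEp p1 hp1).2.1] at this
        apply mul_left_cancel₀ hd
        linear_combination this
      have e3 : ∀ q ∈ J1, n q = 0 := by
        intro q hq
        obtain ⟨hqP, hq1, hqJ⟩ := hJ1 q hq
        have h1 := hsum q hqJ
        have h2 : ∑ p ∈ J1, (n p : F) * form p q
            = ∑ p ∈ J1, ((n p : F) * d + if p = q then (n q : F) * d else 0) := by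
          refine Finset.sum_congr rfl fun p hp => ?_
          by_cases hpq : p = q
          · subst hpq; rw [if_pos rfl, (hEp p hqP).2.1]; ring
          · rw [if_neg hpq, (hg p (hJ1 p hp).1 q hqP hpq).1, add_zero]
        rw [h2, Finset.sum_add_distrib, Finset.sum_ite_eq', if_pos hq, ← Finset.sum_mul,
          hbq q hqP hq1, (hg p1 hp1 q hqP hq1.symm).1] at h1
        have h3 : (n q : F) * (2 * d) = 0 := by linear_combination 2 * h1 - d * e1 - d * e2
        have := (mul_eq_zero.1 h3).resolve_right h2d
        exact_mod_cast this
      have e0 : ∑ p ∈ J1, (n p : F) = 0 :=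
        Finset.sum_eq_zero (fun p hp => by rw [e3 p hp]; simp)
      rw [e0, add_zero] at e1 e2
      have e4 : n b = 0 := by
        have := (mul_eq_zero.1 e1).resolve_left two_ne_zero
        exact_mod_cast this
      have e5 : n p1 = 0 := by
        have := (mul_eq_zero.1 e2).resolve_left two_ne_zero
        exact_mod_cast this
      intro p hp
      by_cases hpb : p = b
      · rw [hpb, e4]
      · by_cases hpp : p = p1
        · rw [hpp, e5]
        · exact e3 p (Finset.mem_erase.2 ⟨hpp, Finset.mem_erase.2 ⟨hpb, hp⟩⟩)
    · intro p hp q hq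
      exact ⟨p2, hPR hp2, Submodule.subset_span h2J, hEx p hp, by rw [hf.symm]; exact hEx q hq⟩

end Finish3


set_option linter.unusedSimpArgs false
set_option linter.unusedVariables false

section Types

variable {F : Type*} [Field F] [CharZero F] {A : Type*} [AddCommGroup A] {form : A → A → F}
  {R : Set A} {c : F} {V : Set A} {wt : A →+ (A →₀ ℤ)}

theorem Fr.pairv (k : Fr form R c V wt) {β i j : A} (hβ : β ∈ R) (hij : i ≠ j) (hi : wt β i ≠ 0)
    (hj : wt β j ≠ 0) : form β β = 2 * c ∧ (wt β i = 1 ∨ wt β i = -1) ∧ (wt β j = 1 ∨ wt β j = -1) ∧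
      ∀ l, l ≠ i → l ≠ j → wt β l = 0 := by
  classical
  rcases k.cls hβ with h0 | ⟨a, ha, s, hs, hw, hn⟩ | ⟨a, ha, s, hs, hw, hn⟩ |
    ⟨a, ha, b, hb, hab, s, t, hs, ht, hw, hn⟩
  · rw [h0] at hi; simp at hi
  · rw [hw, Finsupp.single_apply] at hi hj
    exfalso; apply hij
    have h1 : a = i := by by_contra e; simp [e] at hi
    have h2 : a = j := by by_contra e; simp [e] at hj
    rw [← h1, h2]
  · rw [hw, Finsupp.single_apply] at hi hj
    exfalso; apply hij
    have h1 : a = i := by by_contra e; simp [e] at hi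
    have h2 : a = j := by by_contra e; simp [e] at hj
    rw [← h1, h2]
  · refine ⟨hn, ?_⟩
    rw [hw] at hi hj ⊢
    simp only [Finsupp.add_apply, Finsupp.single_apply] at hi hj ⊢
    have h1 : a = i ∨ b = i := by by_contra! e; simp [e.1, e.2] at hi
    have h2 : a = j ∨ b = j := by by_contra! e; simp [e.1, e.2] at hj
    rcases h1 with rfl | rfl <;> rcases h2 with rfl | rfl
    · exact absurd rfl hij
    · simp only [if_true, if_neg hij, if_neg hij.symm, add_zero, zero_add]
      refine ⟨hs, ht, fun l h1 h2 => ?_⟩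
      simp [h1.symm, h2.symm]
    · simp only [if_true, if_neg hij, if_neg hij.symm, add_zero, zero_add]
      refine ⟨ht, hs, fun l h1 h2 => ?_⟩
      simp [h1.symm, h2.symm]
    · exact absurd rfl hij

theorem Fr.eq_diff (k : Fr form R c V wt) {β i j : A} (hβ : β ∈ R) (hi : i ∈ V) (hj : j ∈ V)
    (hij : i ≠ j) (hw : wt β = Finsupp.single i 1 - Finsupp.single j 1) : β = i - j := by
  classical
  have h1 : wt β i = 1 := by simp [hw, hij.symm, hij]
  have h2 : wt β j = -1 := by simp [hw, hij.symm, hij]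
  refine k.h.eq_of_two (k.dR hi hj) ?_ hβ ?_ ?_
  · rw [k.dN hi hj hij]; exact k.two_c
  · rw [k.dN hi hj hij, (k.pairv hβ hij (by rw [h1]; norm_num) (by rw [h2]; norm_num)).1]
  · rw [k.dN hi hj hij, k.wf _ i hi j hj, h1, h2]; push_cast; ring

theorem Fr.mv (k : Fr form R c V wt) {φ i j : A} (hφ : φ ∈ R) (hi : i ∈ V) (hj : j ∈ V)
    (hw : wt φ = Finsupp.single i 1) : φ - (i - j) ∈ R ∧ wt (φ - (i - j)) = Finsupp.single j 1 ∧
      form (φ - (i - j)) (φ - (i - j)) = form φ φ := by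
  classical
  by_cases hij : i = j
  · subst hij; simp [hφ, hw]
  refine ⟨?_, ?_, ?_⟩
  · have := k.refl hφ hi hj
    rw [hw] at this
    simpa [hij, Ne.symm hij] using this
  · rw [map_sub, k.wt_diff hi hj, hw]; abel
  · have hf := k.h.sf
    rw [hf.sub_left, hf.sub_right φ (i - j) φ, hf.sub_right φ (i - j) (i - j), hf.symm (i - j) φ, k.dN hi hj hij,
      k.wf _ i hi j hj, hw]
    simp [hij, Ne.symm hij]; try ring

/-- `T` parametrizes the roots of weight `i + j`. -/
def Pr (R V : Set A) (wt : A →+ (A →₀ ℤ)) (T : A) : Prop :=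
  ∀ i ∈ V, ∀ j ∈ V, i ≠ j → T + i + j ∈ R ∧ wt (T + i + j) = Finsupp.single i 1 + Finsupp.single j 1

theorem Fr.exists_pr (k : Fr form R c V wt) {β a b : A} (hβ : β ∈ R) (ha : a ∈ V) (hb : b ∈ V)
    (hab : a ≠ b) (hw : wt β = Finsupp.single a 1 + Finsupp.single b 1) :
    ∃ T, Pr R V wt T ∧ β = T + a + b := by
  classical
  refine ⟨β - a - b, ?_, by abel⟩
  set T := β - a - b with hT
  have hwt : ∀ i ∈ V, ∀ j ∈ V, wt (T + i + j) = Finsupp.single i 1 + Finsupp.single j 1 := by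
    intro i hi j hj
    have e : T + i + j = β + (i - a) + (j - b) := by rw [hT]; abel
    rw [e, map_add, map_add, k.wt_diff hi ha, k.wt_diff hj hb, hw]; abel
  have step : ∀ i ∈ V, ∀ j ∈ V, ∀ l ∈ V, i ≠ j → l ≠ i → l ≠ j → T + i + j ∈ R → T + l + j ∈ R := by
    intro i hi j hj l hl hij hli hlj hR
    have := k.refl hR hi hl
    rw [hwt i hi j hj] at this
    simp [hli, hli.symm, hij, hij.symm, hlj, hlj.symm] at this
    convert this using 1
    abel
  have sym : ∀ i j, T + i + j ∈ R → T + j + i ∈ R := by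
    intro i j hR; rwa [add_right_comm]
  have h0 : T + a + b ∈ R := by convert hβ using 1; rw [hT]; abel
  intro i hi j hj hij
  refine ⟨?_, hwt i hi j hj⟩
  obtain ⟨l, hl, hl'⟩ := inf_avoid k.inf {a, b, i, j}
  obtain ⟨m, hm, hm'⟩ := inf_avoid k.inf {a, b, i, j, l}
  simp only [Finset.mem_insert, Finset.mem_singleton, not_or] at hl' hm'
  have h1 := step a ha b hb l hl hab hl'.1 hl'.2.1 h0
  have h2 := step b hb l hl m hm (Ne.symm hl'.2.1) hm'.2.1 hm'.2.2.2.2 (sym _ _ h1)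
  have h3 := step m hm l hl i hi hm'.2.2.2.2 (Ne.symm hm'.2.2.1) (Ne.symm hl'.2.2.1) h2
  have h4 := step l hl i hi j hj hl'.2.2.1 (Ne.symm hl'.2.2.2) (Ne.symm hij) (sym _ _ h3)
  exact sym _ _ h4

theorem Fr.pr_uniq (k : Fr form R c V wt) {T γ i j : A} (hT : Pr R V wt T) (hγ : γ ∈ R) (hi : i ∈ V)
    (hj : j ∈ V) (hij : i ≠ j) (hw : wt γ = Finsupp.single i 1 + Finsupp.single j 1) :
    γ = T + i + j := by
  classical
  have hf := k.h.sf
  obtain ⟨l, hl, hl'⟩ := inf_avoid k.inf {i, j}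
  obtain ⟨m, hm, hm'⟩ := inf_avoid k.inf {i, j, l}
  simp only [Finset.mem_insert, Finset.mem_singleton, not_or] at hl' hm'
  have hlm : l ≠ m := Ne.symm hm'.2.2
  obtain ⟨h1, h1w⟩ := hT l hl m hm hlm
  obtain ⟨h2, h2w⟩ := hT i hi j hj hij
  have hji := hij.symm
  have a1 := hl'.1
  have a2 := hl'.2
  have a3 := hm'.1
  have a4 := hm'.2.1
  have a1' := Ne.symm a1
  have a2' := Ne.symm a2
  have a3' := Ne.symm a3
  have a4' := Ne.symm a4
  have hml := hlm.symm
  have N : ∀ β ∈ R, wt β = Finsupp.single i 1 + Finsupp.single j 1 → form β β = 2 * c := by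
    intro β hβ hwβ
    refine (k.pairv hβ hij ?_ ?_).1 <;> rw [hwβ] <;> simp [hij, hji]
  have z : form γ (T + l + m) = 0 := by
    by_contra hne
    rcases k.h.add_or_sub hγ h1 hne with h3 | h3
    · have := (k.pairv h3 hij (by rw [map_add, hw, h1w]; simp [*]) (by rw [map_add, hw, h1w]; simp [*])).2.2.2
        l hl'.1 hl'.2
      rw [map_add, hw, h1w] at this
      simp [*] at this
    · have := (k.pairv h3 hij (by rw [map_sub, hw, h1w]; simp [*]) (by rw [map_sub, hw, h1w]; simp [*])).2.2.2
        l hl'.1 hl'.2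
      rw [map_sub, hw, h1w] at this
      simp [*] at this
  have e : T + i + j = (T + l + m) + ((i - l) + (j - m)) := by abel
  refine k.h.eq_of_two h2 ?_ hγ ?_ ?_
  · rw [N _ h2 h2w]; exact k.two_c
  · rw [N _ h2 h2w, N _ hγ hw]
  · rw [N _ h2 h2w, e, hf.add_right _ (T + l + m), z, hf.add_right, k.wf _ i hi l hl, k.wf _ j hj m hm, hw]
    simp [*]; ring

theorem Fr.pr_form (k : Fr form R c V wt) {T i j : A} (hT : Pr R V wt T) (hi : i ∈ V)
    (hj : j ∈ V) (hij : i ≠ j) (ρ : A) : form ρ (T + i + j) = c * ((wt ρ i : F) + (wt ρ j : F)) := by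
  classical
  have hf := k.h.sf
  have ha : ρ ∈ AddSubgroup.closure R := by rw [k.h.1.closure_eq_top]; trivial
  induction ha using AddSubgroup.closure_induction with
  | zero => simp [hf.zero_left]
  | add a b _ _ ha hb => rw [hf.add_left, ha, hb, map_add]; simp; ring
  | neg a _ ha => rw [hf.neg_left, ha, map_neg]; simp; ring
  | mem ρ hρ =>
    obtain ⟨l, hl, hl'⟩ := inf_avoid k.inf (wt ρ).support
    obtain ⟨m, hm, hm'⟩ := inf_avoid k.inf (insert l (wt ρ).support)
    simp only [Finset.mem_insert, Finsupp.mem_support_iff, not_or, not_not] at hl' hm'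
    have hlm : l ≠ m := Ne.symm hm'.1
    obtain ⟨h1, h1w⟩ := hT l hl m hm hlm
    have z : form ρ (T + l + m) = 0 := by
      by_contra hne
      by_cases h0 : wt ρ = 0
      · rcases k.h.add_or_sub h1 hρ (by rwa [hf.symm]) with h3 | h3
        · have := k.pr_uniq hT h3 hl hm hlm (by rw [map_add, h0, h1w, add_zero])
          rw [add_eq_left] at this
          exact hne (by rw [this, hf.zero_left])
        · have := k.pr_uniq hT h3 hl hm hlm (by rw [map_sub, h0, h1w, sub_zero])
          rw [sub_eq_self] at this
          exact hne (by rw [this, hf.zero_left])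
      · obtain ⟨x, hx⟩ : ∃ x, wt ρ x ≠ 0 := by
          by_contra! hcon
          exact h0 (Finsupp.ext hcon)
        have hxl : x ≠ l := fun e => hx (e ▸ hl')
        have hxm : x ≠ m := fun e => hx (e ▸ hm'.2)
        have w1 : wt (T + l + m) l = 1 := by rw [h1w]; simp [hlm, hlm.symm]
        have w2 : wt (T + l + m) m = 1 := by rw [h1w]; simp [hlm, hlm.symm]
        have w3 : wt (T + l + m) x = 0 := by rw [h1w]; simp [hxl, hxm, hxl.symm, hxm.symm]
        rcases k.h.add_or_sub h1 hρ (by rwa [hf.symm]) with h3 | h3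
        · have := (k.pairv h3 hlm (by simp only [map_add (f := wt) (T + l + m), Finsupp.add_apply, w1, hl']; norm_num)
            (by simp only [map_add (f := wt) (T + l + m), Finsupp.add_apply, w2, hm'.2]; norm_num)).2.2.2 x hxl hxm
          simp only [map_add (f := wt) (T + l + m), Finsupp.add_apply, w3] at this
          exact hx (by simpa using this)
        · have := (k.pairv h3 hlm (by simp only [map_sub, Finsupp.sub_apply, w1, hl']; norm_num)
            (by simp only [map_sub, Finsupp.sub_apply, w2, hm'.2]; norm_num)).2.2.2 x hxl hxm
          simp only [map_sub, Finsupp.sub_apply, w3] at this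
          exact hx (by simpa using this)
    have e : T + i + j = (T + l + m) + ((i - l) + (j - m)) := by abel
    rw [e, hf.add_right _ (T + l + m), z, hf.add_right, k.wf _ i hi l hl, k.wf _ j hj m hm, hl', hm'.2]
    push_cast; ring

theorem Fr.pr_form2 (k : Fr form R c V wt) {T i : A} (hT : Pr R V wt T) (hi : i ∈ V) (ρ : A) :
    form ρ (T + i + i) = 2 * c * (wt ρ i : F) := by
  obtain ⟨j, hj, hj'⟩ := inf_avoid k.inf {i}
  simp only [Finset.mem_singleton] at hj'
  have e : T + i + i = (T + i + j) + (i - j) := by abel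
  rw [e, k.h.sf.add_right _ (T + i + j), k.pr_form hT hi hj (Ne.symm hj'), k.wf _ i hi j hj]; ring

theorem Fr.pr_wt2 (k : Fr form R c V wt) {T i : A} (hT : Pr R V wt T) (hi : i ∈ V) :
    wt (T + i + i) = Finsupp.single i 2 := by
  obtain ⟨j, hj, hj'⟩ := inf_avoid k.inf {i}
  simp only [Finset.mem_singleton] at hj'
  have e : T + i + i = (T + i + j) + (i - j) := by abel
  rw [e, map_add, (hT i hi j hj (Ne.symm hj')).2, k.wt_diff hi hj]
  have : (Finsupp.single i 2 : A →₀ ℤ) = Finsupp.single i 1 + Finsupp.single i 1 := by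
    rw [← Finsupp.single_add]; norm_num
  rw [this]; abel

theorem Fr.dbl (k : Fr form R c V wt) {γ i j : A} (hγ : γ ∈ R) (hi : i ∈ V) (hj : j ∈ V)
    (hij : i ≠ j) (hw : wt γ = Finsupp.single i 2) :
    γ - (i - j) ∈ R ∧ wt (γ - (i - j)) = Finsupp.single i 1 + Finsupp.single j 1 := by
  constructor
  · refine k.h.str_sub (k.dR hi hj) (by rw [k.dN hi hj hij]; exact k.two_c) hγ (n := 2) ?_ (by norm_num)
    rw [k.wf _ i hi j hj, k.dN hi hj hij, hw]
    simp [hij, hij.symm]; ring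
  · rw [map_sub, hw, k.wt_diff hi hj]
    have : (Finsupp.single i 2 : A →₀ ℤ) = Finsupp.single i 1 + Finsupp.single i 1 := by
      rw [← Finsupp.single_add]; norm_num
    rw [this]; abel

theorem Fr.dbl_eq (k : Fr form R c V wt) {T γ i : A} (hT : Pr R V wt T) (hγ : γ ∈ R) (hi : i ∈ V)
    (hw : wt γ = Finsupp.single i 2) : γ = T + i + i := by
  obtain ⟨j, hj, hj'⟩ := inf_avoid k.inf {i}
  simp only [Finset.mem_singleton] at hj'
  obtain ⟨h1, h2⟩ := k.dbl hγ hi hj (Ne.symm hj') hw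
  have := k.pr_uniq hT h1 hi hj (Ne.symm hj') h2
  have e : γ = (γ - (i - j)) + (i - j) := by abel
  rw [e, this]; abel

theorem Fr.short (k : Fr form R c V wt) {ρ i j : A} (hρ : ρ ∈ R) (hi : i ∈ V) (hj : j ∈ V)
    (hij : i ≠ j) (hw : wt ρ = Finsupp.single i 1) (hn : form ρ ρ = c) :
    ρ + (ρ - (i - j)) ∈ R ∧ wt (ρ + (ρ - (i - j))) = Finsupp.single i 1 + Finsupp.single j 1 := by
  constructor
  · have h1 : -(i - j) ∈ R := k.h.neg (k.dR hi hj)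
    have := k.h.refl_mem hρ (by rw [hn]; exact k.fr.1) h1 (n := -2) (by
      rw [k.h.sf.neg_left, k.h.sf.symm, k.wf _ i hi j hj, hw, hn]
      simp [hij, hij.symm])
    convert this using 1
    module
  · rw [map_add, (k.mv hρ hi hj hw).2.1, hw]

theorem Fr.short_eq (k : Fr form R c V wt) {T ρ i : A} (hT : Pr R V wt T) (hρ : ρ ∈ R) (hi : i ∈ V)
    (hw : wt ρ = Finsupp.single i 1) (hn : form ρ ρ = c) : ρ + ρ = T + i + i := by
  obtain ⟨j, hj, hj'⟩ := inf_avoid k.inf {i}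
  simp only [Finset.mem_singleton] at hj'
  obtain ⟨h1, h2⟩ := k.short hρ hi hj (Ne.symm hj') hw hn
  have := k.pr_uniq hT h1 hi hj (Ne.symm hj') h2
  have e : ρ + ρ = (ρ + (ρ - (i - j))) + (i - j) := by abel
  rw [e, this]; abel

/-- classification up to sign -/
theorem Fr.cls' (k : Fr form R c V wt) {β : A} (hβ : β ∈ R) (h0 : wt β ≠ 0) :
    ∃ γ ∈ R, (β = γ ∨ β = -γ) ∧ (
    (∃ i ∈ V, wt γ = Finsupp.single i 1 ∧ (form γ γ = 0 ∨ form γ γ = c)) ∨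
    (∃ i ∈ V, wt γ = Finsupp.single i 2) ∨
    (∃ i ∈ V, ∃ j ∈ V, i ≠ j ∧ wt γ = Finsupp.single i 1 + Finsupp.single j 1) ∨
    (∃ i ∈ V, ∃ j ∈ V, i ≠ j ∧ γ = i - j)) := by
  classical
  have hneg : form (-β) (-β) = form β β := by rw [k.h.sf.neg_left, k.h.sf.neg_right, neg_neg]
  rcases k.cls hβ with h | ⟨a, ha, s, rfl | rfl, hw, hn⟩ | ⟨a, ha, s, rfl | rfl, hw, hn⟩ |
    ⟨a, ha, b, hb, hab, s, t, rfl | rfl, rfl | rfl, hw, hn⟩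
  · exact absurd h h0
  · exact ⟨β, hβ, Or.inl rfl, Or.inl ⟨a, ha, hw, hn⟩⟩
  · exact ⟨-β, k.h.neg hβ, Or.inr (neg_neg β).symm, Or.inl ⟨a, ha, by
      rw [map_neg, hw]; simp, by rwa [hneg]⟩⟩
  · exact ⟨β, hβ, Or.inl rfl, Or.inr (Or.inl ⟨a, ha, by simpa using hw⟩)⟩
  · exact ⟨-β, k.h.neg hβ, Or.inr (neg_neg β).symm, Or.inr (Or.inl ⟨a, ha, by
      rw [map_neg, hw]; simp⟩)⟩
  · exact ⟨β, hβ, Or.inl rfl, Or.inr (Or.inr (Or.inl ⟨a, ha, b, hb, hab, hw⟩))⟩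
  · exact ⟨β, hβ, Or.inl rfl, Or.inr (Or.inr (Or.inr ⟨a, ha, b, hb, hab,
      k.eq_diff hβ ha hb hab (by rw [hw]; simp [sub_eq_add_neg])⟩))⟩
  · exact ⟨β, hβ, Or.inl rfl, Or.inr (Or.inr (Or.inr ⟨b, hb, a, ha, hab.symm,
      k.eq_diff hβ hb ha hab.symm (by rw [hw]; simp [sub_eq_add_neg, add_comm])⟩))⟩
  · exact ⟨-β, k.h.neg hβ, Or.inr (neg_neg β).symm, Or.inr (Or.inr (Or.inl ⟨a, ha, b, hb, hab, by
      rw [map_neg, hw]; simp [add_comm]⟩))⟩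

end Types


set_option linter.unusedSimpArgs false
set_option linter.unusedVariables false

section TypeA

variable {F : Type*} [Field F] [CharZero F] {A : Type*} [AddCommGroup A] {form : A → A → F}
  {R : Set A} {c : F} {V : Set A} {wt : A →+ (A →₀ ℤ)}

/-- isotropic roots of weight `o` -/
def NSS (form : A → A → F) (R : Set A) (wt : A →+ (A →₀ ℤ)) (o : A) : Set A :=
  {φ | φ ∈ R ∧ wt φ = Finsupp.single o 1 ∧ form φ φ = 0}

theorem Fr.wt_zero (k : Fr form R c V wt) (hc : IsConnectedSet form (R \ formRadical form))
    {o δ : A} (ho : o ∈ V) (hδ : δ ∈ R) (hδ0 : δ ≠ 0) (hw : wt δ = 0) :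
    ∃ φ ∈ NSS form R wt o, ∃ ψ ∈ R, wt ψ = Finsupp.single o 1 ∧ (δ = ψ - φ ∨ δ = φ - ψ) := by
  classical
  have hf := k.h.sf
  obtain ⟨x, hx, hx'⟩ := inf_avoid k.inf {o}
  simp only [Finset.mem_singleton] at hx'
  have hox : o ≠ x := Ne.symm hx'
  have hox0 : o - x ≠ 0 := sub_ne_zero.2 hox
  obtain ⟨t, ht, h1, h2⟩ := k.h.diam hc (k.dR ho hx) hox0 hδ hδ0
  have hwt : wt t ≠ 0 := by
    intro e
    apply h1
    rw [hf.symm, k.wf _ o ho x hx, e]; simp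
  have hpr : ∀ T, Pr R V wt T → ∀ i ∈ V, ∀ j ∈ V, i ≠ j → form δ (T + i + j) = 0 := by
    intro T hT i hi j hj hij
    rw [k.pr_form hT hi hj hij, hw]; simp
  have hpr2 : ∀ T, Pr R V wt T → ∀ i ∈ V, form δ (T + i + i) = 0 := by
    intro T hT i hi
    rw [k.pr_form2 hT hi, hw]; simp
  obtain ⟨γ, hγ, htγ, hcl⟩ := k.cls' ht hwt
  have hγδ : form δ γ ≠ 0 := by
    rcases htγ with rfl | rfl
    · rwa [hf.symm]
    · rw [hf.neg_left, hf.symm] at h2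
      exact fun e => h2 (by rw [e, neg_zero])
  have hφ : ∃ i ∈ V, wt γ = Finsupp.single i 1 ∧ form γ γ = 0 := by
    rcases hcl with ⟨i, hi, hwi, hn | hn⟩ | ⟨i, hi, hwi⟩ | ⟨i, hi, j, hj, hij, hwi⟩ |
      ⟨i, hi, j, hj, hij, rfl⟩
    · exact ⟨i, hi, hwi, hn⟩
    · exfalso
      obtain ⟨j, hj, hj'⟩ := inf_avoid k.inf {i}
      simp only [Finset.mem_singleton] at hj'
      obtain ⟨h3, h4⟩ := k.short hγ hi hj (Ne.symm hj') hwi hn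
      obtain ⟨T, hT, _⟩ := k.exists_pr h3 hi hj (Ne.symm hj') h4
      have := hpr2 T hT i hi
      rw [← k.short_eq hT hγ hi hwi hn, hf.add_right, ← two_mul] at this
      exact hγδ ((mul_eq_zero.1 this).resolve_left two_ne_zero)
    · exfalso
      obtain ⟨j, hj, hj'⟩ := inf_avoid k.inf {i}
      simp only [Finset.mem_singleton] at hj'
      obtain ⟨h3, h4⟩ := k.dbl hγ hi hj (Ne.symm hj') hwi
      obtain ⟨T, hT, _⟩ := k.exists_pr h3 hi hj (Ne.symm hj') h4
      have := hpr2 T hT i hi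
      rw [← k.dbl_eq hT hγ hi hwi] at this
      exact hγδ this
    · exfalso
      obtain ⟨T, hT, rfl⟩ := k.exists_pr hγ hi hj hij hwi
      exact hγδ (hpr T hT i hi j hj hij)
    · exfalso
      apply hγδ
      rw [k.wf _ i hi j hj, hw]; simp
  obtain ⟨i, hi, hwi, hn⟩ := hφ
  obtain ⟨h3, h4, h5⟩ := k.mv hγ hi ho hwi
  have h6 : form (γ - (i - o)) δ ≠ 0 := by
    rw [hf.sub_left, hf.symm (i - o), k.wf _ i hi o ho, hw, hf.symm γ]
    simpa using hγδ
  refine ⟨γ - (i - o), ⟨h3, h4, by rw [h5, hn]⟩, ?_⟩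
  rcases k.h.add_or_sub h3 hδ h6 with h7 | h7
  · exact ⟨_, h7, by rw [map_add, h4, hw, add_zero], Or.inl (by abel)⟩
  · exact ⟨_, h7, by rw [map_sub, h4, hw, sub_zero], Or.inr (by abel)⟩

/-- Pairings of isotropic roots of the same weight, general version. -/
theorem Fr.nss_pair (k : Fr form R c V wt) {o i φ φ' : A} (ho : o ∈ V) (hi : i ∈ V) (hoi : o ≠ i)
    (hφ : φ ∈ NSS form R wt o) (hφ' : φ' ∈ NSS form R wt o) (hne : φ ≠ φ') :
    form φ φ' = c ∨ (φ + (φ' - (o - i)) ∈ R ∧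
      wt (φ + (φ' - (o - i))) = Finsupp.single o 1 + Finsupp.single i 1) := by
  have hf := k.h.sf
  obtain ⟨h1, h2, h3⟩ := k.mv hφ'.1 ho hi hφ'.2.1
  by_cases h0 : form φ (φ' - (o - i)) = 0
  · left
    rw [hf.sub_right φ' (o - i) φ, k.wf _ o ho i hi, hφ.2.1] at h0
    simp [hoi, hoi.symm] at h0
    linear_combination h0
  · right
    rcases k.h.add_or_sub hφ.1 h1 h0 with h4 | h4
    · exact ⟨h4, by rw [map_add, h2, hφ.2.1]⟩
    · exfalso
      have := k.eq_diff h4 ho hi hoi (by rw [map_sub, h2, hφ.2.1])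
      apply hne
      have e : φ = (φ - (φ' - (o - i))) + (φ' - (o - i)) := by abel
      rw [e, this]; abel

theorem Fr.typeA (k : Fr form R c V wt) (hc : IsConnectedSet form (R \ formRadical form))
    (hA : ∀ γ ∈ R, ∀ i ∈ V, ∀ j ∈ V, i ≠ j → wt γ ≠ Finsupp.single i 1 + Finsupp.single j 1) :
    Concl form R := by
  classical
  have hf := k.h.sf
  obtain ⟨o, ho⟩ := k.inf.nonempty
  have hA2 : ∀ γ ∈ R, ∀ i ∈ V, wt γ ≠ Finsupp.single i 2 := by
    intro γ hγ i hi hwi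
    obtain ⟨j, hj, hj'⟩ := inf_avoid k.inf {i}
    simp only [Finset.mem_singleton] at hj'
    obtain ⟨h3, h4⟩ := k.dbl hγ hi hj (Ne.symm hj') hwi
    exact hA _ h3 i hi j hj (Ne.symm hj') h4
  have hAs : ∀ γ ∈ R, ∀ i ∈ V, wt γ = Finsupp.single i 1 → form γ γ = 0 ∨ form γ γ = c → form γ γ = 0 := by
    intro γ hγ i hi hwi hn
    refine hn.resolve_right fun hn => ?_
    obtain ⟨j, hj, hj'⟩ := inf_avoid k.inf {i}
    simp only [Finset.mem_singleton] at hj'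
    obtain ⟨h3, h4⟩ := k.short hγ hi hj (Ne.symm hj') hwi hn
    exact hA _ h3 i hi j hj (Ne.symm hj') h4
  have hs : ∀ γ ∈ R, ∀ i ∈ V, wt γ = Finsupp.single i 1 → form γ γ = 0 := by
    intro γ hγ i hi hwi
    refine hAs γ hγ i hi hwi ?_
    have hv : wt γ i = 1 := by rw [hwi]; simp
    rcases k.cls hγ with h | ⟨a, ha, s, hs, hw, hn⟩ | ⟨a, ha, s, hs, hw, hn⟩ |
      ⟨a, ha, b, hb, hab, s, t, hs, ht, hw, hn⟩
    · rw [h] at hv; simp at hv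
    · exact hn
    · exfalso
      rw [hw, Finsupp.single_apply] at hv
      split_ifs at hv <;> omega
    · exfalso
      have h1 : wt γ a ≠ 0 := by
        rw [hw]; simp [hab, hab.symm]; rcases hs with rfl | rfl <;> norm_num
      have h2 : wt γ b ≠ 0 := by
        rw [hw]; simp [hab, hab.symm]; rcases ht with rfl | rfl <;> norm_num
      rw [hwi, Finsupp.single_apply] at h1 h2
      have e1 : i = a := by by_contra e; simp [e] at h1
      have e2 : i = b := by by_contra e; simp [e] at h2
      exact hab (e1.symm.trans e2)
  set Φ := NSS form R wt o with hΦ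
  set D : Set A := (fun x => o - x) '' (V \ {o}) with hD
  have wD : ∀ p ∈ D, ∃ x ∈ V, o ≠ x ∧ p = o - x := by
    rintro p ⟨x, hx, rfl⟩
    exact ⟨x, hx.1, fun e => hx.2 e.symm, rfl⟩
  have nD : ∀ p ∈ D, form p p = 2 * c := by
    intro p hp
    obtain ⟨x, hx, hox, rfl⟩ := wD p hp
    exact k.dN ho hx hox
  have inD : ∀ x ∈ V, o ≠ x → o - x ∈ D := fun x hx hox => ⟨x, ⟨hx, fun e => hox e.symm⟩, rfl⟩
  obtain ⟨i0, hi0, hi0'⟩ := inf_avoid k.inf {o}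
  simp only [Finset.mem_singleton] at hi0'
  have hPair : ∀ φ ∈ Φ, ∀ φ' ∈ Φ, φ ≠ φ' → form φ φ' = c ∧ φ - φ' ∈ R := by
    intro φ hφ φ' hφ' hne
    have h1 : form φ φ' = c := by
      rcases k.nss_pair ho hi0 (Ne.symm hi0') hφ hφ' hne with h1 | ⟨h1, h2⟩
      · exact h1
      · exact absurd h2 (hA _ h1 o ho i0 hi0 (Ne.symm hi0'))
    refine ⟨h1, ?_⟩
    rcases k.h.add_or_sub hφ.1 hφ'.1 (by rw [h1]; exact k.fr.1) with h2 | h2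
    · exfalso
      refine hA2 _ h2 o ho ?_
      rw [map_add, hφ.2.1, hφ'.2.1, ← Finsupp.single_add]; norm_num
    · exact h2
  have hDF : ∀ p ∈ D, ∀ φ ∈ Φ, form p φ = c ∧ φ - p ∈ R := by
    intro p hp φ hφ
    obtain ⟨x, hx, hox, rfl⟩ := wD p hp
    refine ⟨?_, (k.mv hφ.1 ho hx hφ.2.1).1⟩
    rw [hf.symm, k.wf _ o ho x hx, hφ.2.1]; simp [hox, hox.symm]
  refine k.h.finishA k.fr.1 (D ∪ Φ) ?_ ?_ ?_ ?_ ?_ ?_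
  · rintro p (hp | hp)
    · obtain ⟨x, hx, hox, rfl⟩ := wD p hp
      exact k.dR ho hx
    · exact hp.1
  · rintro p (hp | hp) e
    · have := nD p hp
      rw [e, hf.zero_left] at this
      exact k.two_c this.symm
    · have := hp.2.1
      rw [e, map_zero] at this
      have := DFunLike.congr_fun this o
      simp at this
  · rintro p (hp | hp) q (hq | hq) hpq
    · obtain ⟨x, hx, hox, rfl⟩ := wD p hp
      obtain ⟨y, hy, hoy, rfl⟩ := wD q hq
      have hxy : x ≠ y := fun e => hpq (by rw [e])
      refine ⟨k.fr.inner k.h ho hx hy hox hoy hxy, ?_⟩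
      have e : o - x - (o - y) = y - x := by abel
      rw [e]; exact k.dR hy hx
    · exact ⟨(hDF p hp q hq).1, k.h.sub_comm (hDF p hp q hq).2⟩
    · rw [hf.symm]; exact hDF q hq p hp
    · exact hPair p hp q hq hpq
  · rintro p (hp | hp)
    · exact Or.inl (nD p hp)
    · exact Or.inr hp.2.2
  · have h1 : D.Infinite := (k.inf.diff (Set.finite_singleton o)).image (by
      intro x _ y _ e; simpa using e)
    exact h1.mono fun p hp => ⟨Or.inl hp, nD p hp⟩
  · intro α hα hα0
    by_cases hw : wt α = 0
    · obtain ⟨φ, hφ, ψ, hψ, hwψ, hδ⟩ := k.wt_zero hc ho hα hα0 hw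
      have hψ' : ψ ∈ Φ := ⟨hψ, hwψ, hs ψ hψ o ho hwψ⟩
      rcases hδ with e | e
      · refine ⟨ψ, Or.inr hψ', Or.inr (Or.inr ⟨φ, Or.inr hφ, ?_, e⟩)⟩
        rintro rfl; exact hα0 (by rw [e, sub_self])
      · refine ⟨φ, Or.inr hφ, Or.inr (Or.inr ⟨ψ, Or.inr hψ', ?_, e⟩)⟩
        rintro rfl; exact hα0 (by rw [e, sub_self])
    · obtain ⟨γ, hγ, hαγ, hcl⟩ := k.cls' hα hw
      have : ∃ p ∈ D ∪ Φ, γ = p ∨ γ = -p ∨ ∃ q ∈ D ∪ Φ, p ≠ q ∧ γ = p - q := by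
        rcases hcl with ⟨i, hi, hwi, hn⟩ | ⟨i, hi, hwi⟩ | ⟨i, hi, j, hj, hij, hwi⟩ |
          ⟨i, hi, j, hj, hij, rfl⟩
        · have hn' := hAs γ hγ i hi hwi hn
          obtain ⟨h3, h4, h5⟩ := k.mv hγ hi ho hwi
          have hm : γ - (i - o) ∈ Φ := ⟨h3, h4, by rw [h5, hn']⟩
          by_cases hoi : o = i
          · refine ⟨γ, Or.inr ?_, Or.inl rfl⟩
            rw [hoi] at hm; simpa [hoi] using hm
          · refine ⟨_, Or.inr hm, Or.inr (Or.inr ⟨o - i, Or.inl (inD i hi hoi), ?_, by abel⟩)⟩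
            intro e
            have h6 := nD _ (inD i hi hoi)
            rw [← e, h5, hn'] at h6
            exact k.two_c h6.symm
        · exact absurd hwi (hA2 γ hγ i hi)
        · exact absurd hwi (hA γ hγ i hi j hj hij)
        · by_cases hoi : o = i
          · refine ⟨i - j, Or.inl ?_, Or.inl rfl⟩
            rw [← hoi]; exact inD j hj (hoi ▸ hij)
          · by_cases hoj : o = j
            · refine ⟨o - i, Or.inl (inD i hi hoi), Or.inr (Or.inl ?_)⟩
              rw [hoj]; abel
            · refine ⟨o - j, Or.inl (inD j hj hoj), Or.inr (Or.inr ⟨o - i, Or.inl (inD i hi hoi), ?_, by abel⟩)⟩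
              intro e; exact hij (by simpa using e.symm)
      rcases hαγ with rfl | rfl
      · exact this
      · obtain ⟨p, hp, rfl | rfl | ⟨q, hq, hpq, rfl⟩⟩ := this
        · exact ⟨_, hp, Or.inr (Or.inl rfl)⟩
        · exact ⟨_, hp, Or.inl (neg_neg _)⟩
        · exact ⟨q, hq, Or.inr (Or.inr ⟨p, hp, hpq.symm, by abel⟩)⟩

end TypeA


set_option linter.unusedSimpArgs false
set_option linter.unusedVariables false

section TypeBCD

variable {F : Type*} [Field F] [CharZero F] {A : Type*} [AddCommGroup A] {form : A → A → F}
  {R : Set A} {c : F} {V : Set A} {wt : A →+ (A →₀ ℤ)}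

theorem Fr.single_norm (k : Fr form R c V wt) {γ i : A} (hγ : γ ∈ R)
    (hwi : wt γ = Finsupp.single i 1) : form γ γ = 0 ∨ form γ γ = c := by
  classical
  have hv : wt γ i = 1 := by rw [hwi]; simp
  rcases k.cls hγ with h | ⟨a, ha, s, hs, hw, hn⟩ | ⟨a, ha, s, hs, hw, hn⟩ |
    ⟨a, ha, b, hb, hab, s, t, hs, ht, hw, hn⟩
  · rw [h] at hv; simp at hv
  · exact hn
  · exfalso
    rw [hw, Finsupp.single_apply] at hv
    split_ifs at hv <;> omega
  · exfalso
    have h1 : wt γ a ≠ 0 := by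
      rw [hw]; simp [hab, hab.symm]; rcases hs with rfl | rfl <;> norm_num
    have h2 : wt γ b ≠ 0 := by
      rw [hw]; simp [hab, hab.symm]; rcases ht with rfl | rfl <;> norm_num
    rw [hwi, Finsupp.single_apply] at h1 h2
    have e1 : i = a := by by_contra e; simp [e] at h1
    have e2 : i = b := by by_contra e; simp [e] at h2
    exact hab (e1.symm.trans e2)

theorem Fr.dual (k : Fr form R c V wt) {T φ i : A} (hT : Pr R V wt T) (hi : i ∈ V)
    (hφ : φ ∈ NSS form R wt i) : T + i + i - φ ∈ NSS form R wt i := by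
  classical
  have hf := k.h.sf
  obtain ⟨j, hj, hj'⟩ := inf_avoid k.inf {i}
  simp only [Finset.mem_singleton] at hj'
  have hij : i ≠ j := Ne.symm hj'
  obtain ⟨h1, h2⟩ := hT i hi j hj hij
  have hv : form φ (T + i + j) = c := by
    rw [k.pr_form hT hi hj hij, hφ.2.1]; simp [hij, hij.symm]
  have h3 : φ - (T + i + j) ∈ R := by
    refine (k.h.add_or_sub hφ.1 h1 (by rw [hv]; exact k.fr.1)).resolve_left fun h3 => ?_
    have hi2 : wt (φ + (T + i + j)) i = 2 := by
      rw [map_add (f := wt) φ, h2, hφ.2.1]; simp [hij, hij.symm]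
    have hj2 : wt (φ + (T + i + j)) j = 1 := by
      rw [map_add (f := wt) φ, h2, hφ.2.1]; simp [hij, hij.symm]
    have := (k.pairv h3 hij (by rw [hi2]; norm_num) (by rw [hj2]; norm_num)).2.1
    rw [hi2] at this
    omega
  have h4 : T + i + j - φ ∈ R := k.h.sub_comm h3
  have h5 : wt (T + i + j - φ) = Finsupp.single j 1 := by
    rw [map_sub (f := wt), h2, hφ.2.1]; abel
  obtain ⟨h6, h7, _⟩ := k.mv h4 hj hi h5
  have e : T + i + j - φ - (j - i) = T + i + i - φ := by abel
  rw [e] at h6 h7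
  refine ⟨h6, h7, ?_⟩
  rw [hf.sub_left (T + i + i) φ, hf.sub_right (T + i + i) φ, hf.sub_right (T + i + i) φ,
    hf.symm (T + i + i) φ, k.pr_form2 hT hi, k.pr_form2 hT hi, k.pr_wt2 hT hi, hφ.2.1, hφ.2.2]
  simp; ring

theorem Fr.dual_form (k : Fr form R c V wt) {T φ i : A} (hT : Pr R V wt T) (hi : i ∈ V)
    (hφ : φ ∈ NSS form R wt i) : form φ (T + i + i - φ) = 2 * c := by
  rw [k.h.sf.sub_right (T + i + i) φ, k.pr_form2 hT hi, hφ.2.1, hφ.2.2]; simp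

theorem Fr.dual_ne (k : Fr form R c V wt) {T φ i : A} (hT : Pr R V wt T) (hi : i ∈ V)
    (hφ : φ ∈ NSS form R wt i) : T + i + i - φ ≠ φ := by
  intro e
  have := k.dual_form hT hi hφ
  rw [e, hφ.2.2] at this
  exact k.two_c this.symm

theorem Fr.nss_gen (k : Fr form R c V wt) {T φ φ' o : A} (hT : Pr R V wt T) (ho : o ∈ V)
    (hφ : φ ∈ NSS form R wt o) (hφ' : φ' ∈ NSS form R wt o) (h1 : φ ≠ φ')
    (h2 : φ' ≠ T + o + o - φ) : form φ φ' = c ∧ φ - φ' ∈ R := by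
  classical
  obtain ⟨j, hj, hj'⟩ := inf_avoid k.inf {o}
  simp only [Finset.mem_singleton] at hj'
  have hoj : o ≠ j := Ne.symm hj'
  have hv : form φ φ' = c := by
    rcases k.nss_pair ho hj hoj hφ hφ' h1 with h3 | ⟨h3, h4⟩
    · exact h3
    · exfalso
      have := k.pr_uniq hT h3 ho hj hoj h4
      apply h2
      have e : φ' = (φ + (φ' - (o - j))) + (o - j) - φ := by abel
      rw [e, this]; abel
  refine ⟨hv, ?_⟩
  refine (k.h.add_or_sub hφ.1 hφ'.1 (by rw [hv]; exact k.fr.1)).resolve_left fun h3 => ?_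
  have := k.dbl_eq hT h3 ho (by rw [map_add, hφ.2.1, hφ'.2.1, ← Finsupp.single_add]; norm_num)
  apply h2
  rw [← this]; abel

/-- a choice of representatives of isotropic roots modulo duality -/
theorem Fr.reps (k : Fr form R c V wt) {T o : A} (hT : Pr R V wt T) (ho : o ∈ V) :
    ∃ J ⊆ NSS form R wt o, (∀ φ ∈ NSS form R wt o, φ ∈ J ∨ T + o + o - φ ∈ J) ∧
      ∀ φ ∈ J, T + o + o - φ ∉ J := by
  have dd : ∀ φ : A, T + o + o - (T + o + o - φ) = φ := fun φ => by abel
  refine ⟨{φ | φ ∈ NSS form R wt o ∧ WellOrderingRel φ (T + o + o - φ)}, fun φ h => h.1, ?_, ?_⟩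
  · intro φ hφ
    rcases trichotomous_of (WellOrderingRel) φ (T + o + o - φ) with h | h | h
    · exact Or.inl ⟨hφ, h⟩
    · exact absurd h.symm (k.dual_ne hT ho hφ)
    · exact Or.inr ⟨k.dual hT ho hφ, by rw [dd]; exact h⟩
  · rintro φ ⟨_, h⟩ ⟨_, h'⟩
    rw [dd] at h'
    exact asymm_of WellOrderingRel h h'

end TypeBCD


set_option linter.unusedSimpArgs false
set_option linter.unusedVariables false

section TypeB

variable {F : Type*} [Field F] [CharZero F] {A : Type*} [AddCommGroup A] {form : A → A → F}
  {R : Set A} {c : F} {V : Set A} {wt : A →+ (A →₀ ℤ)}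

theorem Fr.typeB (k : Fr form R c V wt) (hc : IsConnectedSet form (R \ formRadical form))
    {T o ε : A} (hT : Pr R V wt T) (ho : o ∈ V) (hε : ε ∈ R) (hwε : wt ε = Finsupp.single o 1)
    (hnε : form ε ε = c) : Concl form R := by
  classical
  have hf := k.h.sf
  have hε2 : ε + ε = T + o + o := k.short_eq hT hε ho hwε hnε
  obtain ⟨J, hJ, hJ1, hJ2⟩ := k.reps hT ho
  set E : A → A := fun i => ε - (o - i) with hE
  have EE : ∀ i ∈ V, E i ∈ R ∧ wt (E i) = Finsupp.single i 1 ∧ form (E i) (E i) = c := by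
    intro i hi
    obtain ⟨h1, h2, h3⟩ := k.mv hε ho hi hwε
    exact ⟨h1, h2, h3.trans hnε⟩
  have E2 : ∀ i ∈ V, E i + E i = T + i + i := fun i hi =>
    k.short_eq hT (EE i hi).1 hi (EE i hi).2.1 (EE i hi).2.2
  have Eij : ∀ i j, E i - E j = i - j := fun i j => by simp only [hE]; abel
  have Eij' : ∀ i j, E i + E j = T + i + j := fun i j => by
    have e : E i + E j = (ε + ε) - (o - i) - (o - j) := by simp only [hE]; abel
    rw [e, hε2]; abel
  have fE : ∀ a, ∀ i ∈ V, form a (E i) = c * (wt a i : F) := by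
    intro a i hi
    have h1 := k.pr_form2 hT hi a
    rw [← E2 i hi, hf.add_right] at h1
    have h2 : (2 : F) * (form a (E i) - c * (wt a i : F)) = 0 := by linear_combination h1
    exact sub_eq_zero.1 ((mul_eq_zero.1 h2).resolve_left two_ne_zero)
  have Eo : E o = ε := by simp [hE]
  have hφε : ∀ φ ∈ NSS form R wt o, form φ ε = c := by
    intro φ hφ
    have := fE φ o ho
    rw [Eo, hφ.2.1] at this
    rw [this]; simp
  have hη : ∀ φ ∈ NSS form R wt o, φ - ε ∈ R := by
    intro φ hφ
    refine (k.h.add_or_sub hφ.1 hε (by rw [hφε φ hφ]; exact k.fr.1)).resolve_left fun h3 => ?_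
    have h4 := k.dbl_eq hT h3 ho (by rw [map_add, hφ.2.1, hwε, ← Finsupp.single_add]; norm_num)
    rw [← hε2] at h4
    have h5 : φ = ε := add_right_cancel h4
    have h6 := hφ.2.2
    rw [h5, hnε] at h6
    exact k.fr.1 h6
  have ηη : ∀ φ ∈ NSS form R wt o, ∀ φ' ∈ NSS form R wt o,
      form (φ - ε) (φ' - ε) = form φ φ' - c := by
    intro φ hφ φ' hφ'
    rw [hf.sub_left, hf.sub_right φ' ε φ, hf.sub_right φ' ε ε, hφε φ hφ, hf.symm ε φ', hφε φ' hφ', hnε]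
    ring
  have wη : ∀ φ ∈ NSS form R wt o, wt (φ - ε) = 0 := by
    intro φ hφ
    rw [map_sub, hφ.2.1, hwε, sub_self]
  have ηd : ∀ φ : A, T + o + o - φ - ε = -(φ - ε) := by
    intro φ; rw [← hε2]; abel
  -- cross pairs
  have cross : ∀ i ∈ V, ∀ φ ∈ NSS form R wt o,
      form (E i) (φ - ε) = 0 ∧ E i + (φ - ε) ∈ R ∧ E i - (φ - ε) ∈ R := by
    intro i hi φ hφ
    obtain ⟨h1, h2, h3⟩ := k.mv hφ.1 ho hi hφ.2.1
    have e1 : E i + (φ - ε) = φ - (o - i) := by simp only [hE]; abel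
    have e2 : E i - (φ - ε) = T + i + i - (φ - (o - i)) := by rw [← E2 i hi]; simp only [hE]; abel
    refine ⟨?_, ?_, ?_⟩
    · rw [hf.symm, fE _ i hi, wη φ hφ]; simp
    · rw [e1]; exact h1
    · rw [e2]; exact (k.dual hT hi ⟨h1, h2, h3.trans hφ.2.2⟩).1
  set P : Set A := E '' V ∪ (fun φ => φ - ε) '' J with hP
  have wP : ∀ p ∈ P, (∃ i ∈ V, p = E i) ∨ ∃ φ ∈ J, p = φ - ε := by
    rintro p (⟨i, hi, rfl⟩ | ⟨φ, hφ, rfl⟩)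
    · exact Or.inl ⟨i, hi, rfl⟩
    · exact Or.inr ⟨φ, hφ, rfl⟩
  set S : A → Prop := fun s => s ∈ P ∨ -s ∈ P with hS
  have SE : ∀ i ∈ V, S (E i) := fun i hi => Or.inl (Or.inl ⟨i, hi, rfl⟩)
  have Sη : ∀ φ ∈ NSS form R wt o, S (φ - ε) := by
    intro φ hφ
    rcases hJ1 φ hφ with h | h
    · exact Or.inl (Or.inr ⟨φ, h, rfl⟩)
    · exact Or.inr (Or.inr ⟨_, h, ηd φ⟩)
  have Sn : ∀ s, S s → S (-s) := by
    rintro s (h | h)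
    · exact Or.inr (by rwa [neg_neg])
    · exact Or.inl h
  refine k.h.finishB P ?_ ?_ ?_ ?_ ?_
  · intro p hp
    rcases wP p hp with ⟨i, hi, rfl⟩ | ⟨φ, hφ, rfl⟩
    · exact (EE i hi).1
    · exact hη φ (hJ hφ)
  · intro p hp q hq hpq
    rcases wP p hp with ⟨i, hi, rfl⟩ | ⟨φ, hφ, rfl⟩ <;> rcases wP q hq with ⟨j, hj, rfl⟩ | ⟨φ', hφ', rfl⟩
    · have hij : i ≠ j := fun e => hpq (by rw [e])
      refine ⟨?_, ?_, ?_⟩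
      · rw [fE _ j hj, (EE i hi).2.1]; simp [hij, hij.symm]
      · rw [Eij']; exact (hT i hi j hj hij).1
      · rw [Eij]; exact k.dR hi hj
    · exact cross i hi φ' (hJ hφ')
    · obtain ⟨h1, h2, h3⟩ := cross j hj φ (hJ hφ)
      exact ⟨by rw [hf.symm]; exact h1, by rw [add_comm]; exact h2, k.h.sub_comm h3⟩
    · have hne : φ ≠ φ' := fun e => hpq (by rw [e])
      have hd : φ' ≠ T + o + o - φ := fun e => hJ2 φ hφ (e ▸ hφ')
      obtain ⟨h1, h2⟩ := k.nss_gen hT ho (hJ hφ) (hJ hφ') hne hd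
      have hφd := k.dual hT ho (hJ hφ')
      have hne' : φ ≠ T + o + o - φ' := fun e => hd (by rw [e]; abel)
      obtain ⟨h3, h4⟩ := k.nss_gen hT ho (hJ hφ) hφd hne' (fun e => hne (sub_right_injective e).symm)
      refine ⟨by rw [ηη _ (hJ hφ) _ (hJ hφ'), h1, sub_self], ?_, ?_⟩
      · have e : φ - ε + (φ' - ε) = φ - (T + o + o - φ') := by rw [← hε2]; abel
        rw [e]; exact h4
      · have e : φ - ε - (φ' - ε) = φ - φ' := by abel
        rw [e]; exact h2
  · intro p hp
    rcases wP p hp with ⟨i, hi, rfl⟩ | ⟨φ, hφ, rfl⟩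
    · rw [(EE i hi).2.2]; exact k.fr.1
    · rw [ηη _ (hJ hφ) _ (hJ hφ), (hJ hφ).2.2, zero_sub]; exact neg_ne_zero.2 k.fr.1
  · exact ⟨_, Or.inl ⟨o, ho, rfl⟩⟩
  · have key : ∀ α ∈ R, α ≠ 0 → S α ∨ ∃ s t, S s ∧ S t ∧ α = s + t := by
      intro α hα hα0
      have kneg : ∀ β, (S β ∨ ∃ s t, S s ∧ S t ∧ β = s + t) → (S (-β) ∨ ∃ s t, S s ∧ S t ∧ -β = s + t) := by
        rintro β (h | ⟨s, t, hs, ht, rfl⟩)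
        · exact Or.inl (Sn _ h)
        · exact Or.inr ⟨-s, -t, Sn _ hs, Sn _ ht, by abel⟩
      by_cases hw : wt α = 0
      · obtain ⟨φ, hφ, ψ, hψ, hwψ, hδ⟩ := k.wt_zero hc ho hα hα0 hw
        have h1 : S (ψ - φ) ∨ ∃ s t, S s ∧ S t ∧ ψ - φ = s + t := by
          rcases k.single_norm hψ hwψ with h | h
          · exact Or.inr ⟨_, _, Sη ψ ⟨hψ, hwψ, h⟩, Sn _ (Sη φ hφ), by abel⟩
          · have h2 := k.short_eq hT hψ ho hwψ h
            have h3 : ψ - ε = 0 := by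
              refine k.h.zsmul_eq_zero (n := 2) two_ne_zero ?_
              rw [two_zsmul]
              have e : ψ - ε + (ψ - ε) = (ψ + ψ) - (ε + ε) := by abel
              rw [e, h2, hε2, sub_self]
            rw [sub_eq_zero.1 h3]
            have := Sn _ (Sη φ hφ)
            rw [neg_sub] at this
            exact Or.inl this
        rcases hδ with rfl | rfl
        · exact h1
        · have := kneg _ h1
          rwa [neg_sub] at this
      · obtain ⟨γ, hγ, hαγ, hcl⟩ := k.cls' hα hw
        have h1 : S γ ∨ ∃ s t, S s ∧ S t ∧ γ = s + t := by
          rcases hcl with ⟨i, hi, hwi, hn | hn⟩ | ⟨i, hi, hwi⟩ | ⟨i, hi, j, hj, hij, hwi⟩ |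
            ⟨i, hi, j, hj, hij, rfl⟩
          · obtain ⟨h3, h4, h5⟩ := k.mv hγ hi ho hwi
            refine Or.inr ⟨_, _, SE i hi, Sη _ ⟨h3, h4, h5.trans hn⟩, ?_⟩
            simp only [hE]; abel
          · left
            have h2 := k.short_eq hT hγ hi hwi hn
            have h3 : γ - E i = 0 := by
              refine k.h.zsmul_eq_zero (n := 2) two_ne_zero ?_
              rw [two_zsmul]
              have e : γ - E i + (γ - E i) = (γ + γ) - (E i + E i) := by abel
              rw [e, h2, E2 i hi, sub_self]
            rw [sub_eq_zero.1 h3]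
            exact SE i hi
          · exact Or.inr ⟨_, _, SE i hi, SE i hi, by rw [E2 i hi]; exact k.dbl_eq hT hγ hi hwi⟩
          · exact Or.inr ⟨_, _, SE i hi, SE j hj, by rw [Eij']; exact k.pr_uniq hT hγ hi hj hij hwi⟩
          · exact Or.inr ⟨_, _, SE i hi, Sn _ (SE j hj), by rw [← sub_eq_add_neg, Eij]⟩
        rcases hαγ with rfl | rfl
        · exact h1
        · exact kneg _ h1
    intro α hα hα0
    rcases key α hα hα0 with (h | h) | ⟨s, t, hs, ht, rfl⟩
    · exact ⟨α, Or.inl rfl, α, h, Or.inl rfl⟩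
    · exact ⟨-α, Or.inr (neg_neg _).symm, -α, h, Or.inl rfl⟩
    · rcases hs with hs | hs <;> rcases ht with ht | ht
      · by_cases e : s = t
        · exact ⟨s + t, Or.inl rfl, s, hs, Or.inr (Or.inl (by rw [e]))⟩
        · exact ⟨s + t, Or.inl rfl, s, hs, Or.inr (Or.inr ⟨t, ht, e, Or.inl rfl⟩)⟩
      · refine ⟨s + t, Or.inl rfl, s, hs, Or.inr (Or.inr ⟨-t, ht, ?_, Or.inr (by abel)⟩)⟩
        intro e; exact hα0 (by rw [e]; abel)
      · refine ⟨s + t, Or.inl rfl, t, ht, Or.inr (Or.inr ⟨-s, hs, ?_, Or.inr (by abel)⟩)⟩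
        intro e; exact hα0 (by rw [e]; abel)
      · by_cases e : s = t
        · exact ⟨-(s + t), Or.inr (neg_neg _).symm, -s, hs, Or.inr (Or.inl (by rw [e]; abel))⟩
        · exact ⟨-(s + t), Or.inr (neg_neg _).symm, -s, hs,
            Or.inr (Or.inr ⟨-t, ht, fun e' => e (neg_injective e'), Or.inl (by abel)⟩)⟩

end TypeB


set_option linter.unusedSimpArgs false
set_option linter.unusedVariables false

section TypeCD

variable {F : Type*} [Field F] [CharZero F] {A : Type*} [AddCommGroup A] {form : A → A → F}
  {R : Set A} {c : F} {V : Set A} {wt : A →+ (A →₀ ℤ)}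

/-- forms of differences in terms of the orthogonal system `T + x + x` -/
theorem IsSymForm.four (hf : IsSymForm form) (T a x y : A) :
    4 * form (a - x) (a - y) = form (T + a + a) (T + a + a) - form (T + a + a) (T + y + y) -
      form (T + x + x) (T + a + a) + form (T + x + x) (T + y + y) := by
  simp only [hf.sub_left, hf.sub_right, hf.add_left, hf.add_right]
  ring

theorem IsSymForm.two (hf : IsSymForm form) (T a x : A) :
    2 * form (T + a + a) (a - x) = form (T + a + a) (T + a + a) - form (T + a + a) (T + x + x) := by
  simp only [hf.sub_left, hf.sub_right, hf.add_left, hf.add_right]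
  ring

theorem IsLFRSS.typeCabs (h : IsLFRSS form R) {T a : A} {W : Set A} (ha : a ∈ W)
    (hE : T + a + a ∈ R)
    (hN : ∀ x ∈ W, form (T + x + x) (T + x + x) ≠ 0)
    (hO : ∀ x ∈ W, ∀ y ∈ W, x ≠ y → form (T + x + x) (T + y + y) = 0)
    (hR : ∀ x ∈ W, ∀ y ∈ W, x ≠ y → x - y ∈ R ∧ T + x + y ∈ R)
    (hroots : ∀ α ∈ R, α ≠ 0 → ∃ x ∈ W, ∃ y ∈ W, α = x - y ∨ α = T + x + y ∨ α = -(T + x + y)) :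
    Concl form R := by
  have hf := h.sf
  obtain ⟨d, hd⟩ : ∃ d, form (T + a + a) (T + a + a) = 4 * d :=
    ⟨form (T + a + a) (T + a + a) / 4, by field_simp⟩
  have hd0 : d ≠ 0 := by
    rintro rfl
    exact hN a ha (by rw [hd, mul_zero])
  have four0 : (4 : F) ≠ 0 := by norm_num
  set P : Set A := {p | ∃ x ∈ W, x ≠ a ∧ p = a - x} with hP
  have mP : ∀ x ∈ W, x ≠ a → a - x ∈ P := fun x hx hxa => ⟨x, hx, hxa, rfl⟩
  refine h.finishC hd0 (T + a + a) P hE ?_ hd ?_ ?_ ?_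
  · rintro p ⟨x, hx, hxa, rfl⟩
    exact (hR a ha x hx hxa.symm).1
  · rintro p ⟨x, hx, hxa, rfl⟩
    refine ⟨?_, ?_, ?_⟩
    · have := hf.two T a x
      rw [hd, hO a ha x hx hxa.symm] at this
      have h2 : (2 : F) * (form (T + a + a) (a - x) - 2 * d) = 0 := by linear_combination this
      exact sub_eq_zero.1 ((mul_eq_zero.1 h2).resolve_left two_ne_zero)
    · intro e
      have := hf.four T a x x
      rw [hd, hO a ha x hx hxa.symm, hO x hx a ha hxa, e] at this
      exact hN x hx (by linear_combination -this)
    · have e : T + a + a - (a - x) = T + a + x := by abel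
      rw [e]; exact (hR a ha x hx hxa.symm).2
  · rintro p ⟨x, hx, hxa, rfl⟩ q ⟨y, hy, hya, rfl⟩ hpq
    have hxy : x ≠ y := fun e => hpq (by rw [e])
    have := hf.four T a x y
    rw [hd, hO a ha y hy hya.symm, hO x hx a ha hxa, hO x hx y hy hxy] at this
    have h2 : (4 : F) * (form (a - x) (a - y) - d) = 0 := by linear_combination this
    exact sub_eq_zero.1 ((mul_eq_zero.1 h2).resolve_left four0)
  · intro α hα hα0
    have key : ∀ x ∈ W, ∀ y ∈ W, (T + x + y = T + a + a ∨ ∃ p ∈ P, T + x + y = p ∨ T + x + y = T + a + a - p ∨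
        T + x + y = T + a + a - p - p ∨
        ∃ q ∈ P, p ≠ q ∧ (T + x + y = p - q ∨ T + x + y = T + a + a - p - q)) := by
      intro x hx y hy
      by_cases hxa : x = a
      · by_cases hya : y = a
        · left; rw [hxa, hya]
        · right
          refine ⟨_, mP y hy hya, Or.inr (Or.inl ?_)⟩
          rw [hxa]; abel
      · right
        refine ⟨_, mP x hx hxa, ?_⟩
        by_cases hya : y = a
        · refine Or.inr (Or.inl ?_)
          rw [hya]; abel
        · by_cases hxy : x = y
          · refine Or.inr (Or.inr (Or.inl ?_))
            rw [hxy]; abel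
          · refine Or.inr (Or.inr (Or.inr ⟨_, mP y hy hya, fun e => hxy (sub_right_injective e), Or.inr ?_⟩))
            abel
    obtain ⟨x, hx, y, hy, e | e | e⟩ := hroots α hα hα0
    · have hxy : x ≠ y := by rintro rfl; exact hα0 (by rw [e, sub_self])
      by_cases hxa : x = a
      · exact ⟨α, Or.inl rfl, Or.inr ⟨_, mP y hy (hxa ▸ hxy.symm), Or.inl (by rw [e, hxa])⟩⟩
      · by_cases hya : y = a
        · exact ⟨-α, Or.inr (neg_neg _).symm, Or.inr ⟨_, mP x hx hxa, Or.inl (by rw [e, hya]; abel)⟩⟩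
        · refine ⟨α, Or.inl rfl, Or.inr ⟨_, mP y hy hya, Or.inr (Or.inr (Or.inr ⟨_, mP x hx hxa, ?_, Or.inl ?_⟩))⟩⟩
          · exact fun e => hxy (sub_right_injective e).symm
          · rw [e]; abel
    · exact ⟨_, Or.inl e, key x hx y hy⟩
    · exact ⟨_, Or.inr e, key x hx y hy⟩

theorem IsLFRSS.typeDabs (h : IsLFRSS form R) (hc0 : c ≠ 0) {T a : A} {W : Set A} (hW : W.Infinite) (ha : a ∈ W)
    (hE : ∀ x ∈ W, T + x + x ∉ R)
    (hN : ∀ x ∈ W, form (T + x + x) (T + x + x) = 4 * c)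
    (hO : ∀ x ∈ W, ∀ y ∈ W, x ≠ y → form (T + x + x) (T + y + y) = 0)
    (hR : ∀ x ∈ W, ∀ y ∈ W, x ≠ y → x - y ∈ R ∧ T + x + y ∈ R)
    (hroots : ∀ α ∈ R, α ≠ 0 → ∃ x ∈ W, ∃ y ∈ W, α = x - y ∨ α = T + x + y ∨ α = -(T + x + y)) :
    Concl form R := by
  classical
  have hf := h.sf
  have four0 : (4 : F) ≠ 0 := by norm_num
  set P : Set A := {p | ∃ x ∈ W, x ≠ a ∧ p = a - x} with hP
  have mP : ∀ x ∈ W, x ≠ a → a - x ∈ P := fun x hx hxa => ⟨x, hx, hxa, rfl⟩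
  obtain ⟨x1, hx1, h1⟩ := inf_avoid hW {a}
  obtain ⟨x2, hx2, h2⟩ := inf_avoid hW {a, x1}
  simp only [Finset.mem_singleton] at h1
  simp only [Finset.mem_insert, Finset.mem_singleton, not_or] at h2
  refine h.finishD hc0 (T + a + a) P ?_ (hN a ha) ?_ ?_ (mP x1 hx1 h1) (mP x2 hx2 h2.1)
    (fun e => h2.2 (sub_right_injective e).symm) ?_
  · rintro p ⟨x, hx, hxa, rfl⟩
    exact (hR a ha x hx hxa.symm).1
  · rintro p ⟨x, hx, hxa, rfl⟩
    refine ⟨?_, ?_, ?_⟩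
    · have := hf.two T a x
      rw [hN a ha, hO a ha x hx hxa.symm] at this
      have h2 : (2 : F) * (form (T + a + a) (a - x) - 2 * c) = 0 := by linear_combination this
      exact sub_eq_zero.1 ((mul_eq_zero.1 h2).resolve_left two_ne_zero)
    · have := hf.four T a x x
      rw [hN a ha, hN x hx, hO a ha x hx hxa.symm, hO x hx a ha hxa] at this
      have h2 : (4 : F) * (form (a - x) (a - x) - 2 * c) = 0 := by linear_combination this
      exact sub_eq_zero.1 ((mul_eq_zero.1 h2).resolve_left four0)
    · have e : T + a + a - (a - x) = T + a + x := by abel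
      rw [e]; exact (hR a ha x hx hxa.symm).2
  · rintro p ⟨x, hx, hxa, rfl⟩ q ⟨y, hy, hya, rfl⟩ hpq
    have hxy : x ≠ y := fun e => hpq (by rw [e])
    have := hf.four T a x y
    rw [hN a ha, hO a ha y hy hya.symm, hO x hx a ha hxa, hO x hx y hy hxy] at this
    have h2 : (4 : F) * (form (a - x) (a - y) - c) = 0 := by linear_combination this
    refine ⟨sub_eq_zero.1 ((mul_eq_zero.1 h2).resolve_left four0), ?_⟩
    have e : T + a + a - (a - x) - (a - y) = T + x + y := by abel
    rw [e]; exact (hR x hx y hy hxy).2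
  · intro α hα hα0
    have key : ∀ x ∈ W, ∀ y ∈ W, x ≠ y → (∃ p ∈ P, T + x + y = p ∨ T + x + y = T + a + a - p ∨
        ∃ q ∈ P, p ≠ q ∧ (T + x + y = p - q ∨ T + x + y = T + a + a - p - q)) := by
      intro x hx y hy hxy
      by_cases hxa : x = a
      · refine ⟨_, mP y hy (fun e => hxy (hxa.trans e.symm)), Or.inr (Or.inl ?_)⟩
        rw [hxa]; abel
      · refine ⟨_, mP x hx hxa, ?_⟩
        by_cases hya : y = a
        · refine Or.inr (Or.inl ?_)
          rw [hya]; abel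
        · refine Or.inr (Or.inr ⟨_, mP y hy hya, fun e => hxy (sub_right_injective e), Or.inr ?_⟩)
          abel
    obtain ⟨x, hx, y, hy, e | e | e⟩ := hroots α hα hα0
    · have hxy : x ≠ y := by rintro rfl; exact hα0 (by rw [e, sub_self])
      by_cases hxa : x = a
      · exact ⟨α, Or.inl rfl, _, mP y hy (hxa ▸ hxy.symm), Or.inl (by rw [e, hxa])⟩
      · by_cases hya : y = a
        · exact ⟨-α, Or.inr (neg_neg _).symm, _, mP x hx hxa, Or.inl (by rw [e, hya]; abel)⟩
        · refine ⟨α, Or.inl rfl, _, mP y hy hya, Or.inr (Or.inr ⟨_, mP x hx hxa, ?_, Or.inl ?_⟩)⟩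
          · exact fun e => hxy (sub_right_injective e).symm
          · rw [e]; abel
    · refine ⟨_, Or.inl e, key x hx y hy ?_⟩
      rintro rfl
      exact hE x hx (e ▸ hα)
    · refine ⟨_, Or.inr e, key x hx y hy ?_⟩
      rintro rfl
      refine hE x hx ?_
      have := h.neg hα
      rwa [e, neg_neg] at this

theorem Fr.typeCD (k : Fr form R c V wt) (hc : IsConnectedSet form (R \ formRadical form))
    {T : A} (hT : Pr R V wt T)
    (hs : ∀ γ ∈ R, ∀ i ∈ V, wt γ = Finsupp.single i 1 → form γ γ = 0) : Concl form R := by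
  classical
  have hf := k.h.sf
  obtain ⟨o, ho⟩ := k.inf.nonempty
  obtain ⟨J, hJ, hJ1, hJ2⟩ := k.reps hT ho
  have four0 : (4 : F) ≠ 0 := by norm_num
  set W : Set A := V ∪ (fun φ => o - φ) '' J with hW
  have wW : ∀ x ∈ W, x ∈ V ∨ ∃ φ ∈ J, x = o - φ := by
    rintro x (hx | ⟨φ, hφ, rfl⟩)
    · exact Or.inl hx
    · exact Or.inr ⟨φ, hφ, rfl⟩
  have Gf : ∀ φ ∈ NSS form R wt o, ∀ φ' ∈ NSS form R wt o,
      form (T + (o - φ) + (o - φ)) (T + (o - φ') + (o - φ')) = 4 * (form φ φ' - c) := by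
    intro φ hφ φ' hφ'
    have e1 : ∀ ψ : A, T + (o - ψ) + (o - ψ) = (T + o + o) - (ψ + ψ) := fun ψ => by abel
    have g1 : ∀ ψ ∈ NSS form R wt o, form ψ (T + o + o) = 2 * c := by
      intro ψ hψ; rw [k.pr_form2 hT ho, hψ.2.1]; simp
    have g2 : form (T + o + o) (T + o + o) = 4 * c := by
      rw [k.pr_form2 hT ho, k.pr_wt2 hT ho]; simp; ring
    rw [e1, e1]
    generalize T + o + o = D at *
    rw [hf.sub_left D, hf.sub_right D, hf.sub_right D, hf.symm D (φ' + φ'), hf.add_left φ' φ' D,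
      hf.add_left φ φ D, hf.add_left φ φ, hf.add_right φ φ' φ', g1 _ hφ, g1 _ hφ', g2]
    ring
  have Gw : ∀ φ ∈ NSS form R wt o, wt (T + (o - φ) + (o - φ)) = 0 := by
    intro φ hφ
    have e1 : T + (o - φ) + (o - φ) = (T + o + o) - (φ + φ) := by abel
    rw [e1, map_sub (f := wt), map_add (f := wt) φ, k.pr_wt2 hT ho, hφ.2.1, ← Finsupp.single_add]
    norm_num
  have cross : ∀ x ∈ V, ∀ φ ∈ NSS form R wt o,
      form (T + (o - φ) + (o - φ)) (T + x + x) = 0 ∧ x - (o - φ) ∈ R ∧ T + x + (o - φ) ∈ R := by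
    intro x hx φ hφ
    obtain ⟨h1, h2, h3⟩ := k.mv hφ.1 ho hx hφ.2.1
    refine ⟨by rw [k.pr_form2 hT hx, Gw φ hφ]; simp, ?_, ?_⟩
    · have e : x - (o - φ) = φ - (o - x) := by abel
      rw [e]; exact h1
    · have e : T + x + (o - φ) = T + x + x - (φ - (o - x)) := by abel
      rw [e]; exact (k.dual hT hx ⟨h1, h2, h3.trans hφ.2.2⟩).1
  have NV : ∀ x ∈ V, form (T + x + x) (T + x + x) = 4 * c := by
    intro x hx
    rw [k.pr_form2 hT hx, k.pr_wt2 hT hx]; simp; ring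
  have hO : ∀ x ∈ W, ∀ y ∈ W, x ≠ y →
      form (T + x + x) (T + y + y) = 0 ∧ x - y ∈ R ∧ T + x + y ∈ R := by
    intro x hx y hy hxy
    rcases wW x hx with hx' | ⟨φ, hφ, rfl⟩ <;> rcases wW y hy with hy' | ⟨φ', hφ', rfl⟩
    · refine ⟨?_, k.dR hx' hy', (hT x hx' y hy' hxy).1⟩
      rw [k.pr_form2 hT hy', k.pr_wt2 hT hx']; simp [hxy, hxy.symm]
    · obtain ⟨h1, h2, h3⟩ := cross x hx' φ' (hJ hφ')
      exact ⟨by rw [hf.symm]; exact h1, h2, h3⟩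
    · obtain ⟨h1, h2, h3⟩ := cross y hy' φ (hJ hφ)
      refine ⟨h1, k.h.sub_comm h2, ?_⟩
      have e : T + (o - φ) + y = T + y + (o - φ) := by abel
      rw [e]; exact h3
    · have hne : φ ≠ φ' := fun e => hxy (by rw [e])
      have hd : φ' ≠ T + o + o - φ := fun e => hJ2 φ hφ (e ▸ hφ')
      obtain ⟨h1, h2⟩ := k.nss_gen hT ho (hJ hφ) (hJ hφ') hne hd
      have hφd := k.dual hT ho (hJ hφ')
      have hne' : φ ≠ T + o + o - φ' := fun e => hd (by rw [e]; abel)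
      obtain ⟨h3, h4⟩ := k.nss_gen hT ho (hJ hφ) hφd hne' (fun e => hne (sub_right_injective e).symm)
      refine ⟨by rw [Gf _ (hJ hφ) _ (hJ hφ'), h1, sub_self, mul_zero], ?_, ?_⟩
      · have e : o - φ - (o - φ') = φ' - φ := by abel
        rw [e]; exact k.h.sub_comm h2
      · have e : T + (o - φ) + (o - φ') = T + o + o - φ' - φ := by abel
        rw [e]; exact k.h.sub_comm h4
  have hN : ∀ x ∈ W, form (T + x + x) (T + x + x) ≠ 0 := by
    intro x hx
    rcases wW x hx with hx' | ⟨φ, hφ, rfl⟩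
    · rw [NV x hx']; exact mul_ne_zero four0 k.fr.1
    · rw [Gf _ (hJ hφ) _ (hJ hφ), (hJ hφ).2.2, zero_sub]
      exact mul_ne_zero four0 (neg_ne_zero.2 k.fr.1)
  have rep : ∀ φ ∈ NSS form R wt o, ∃ w ∈ W, o - φ = w ∨ o - φ = -T - w := by
    intro φ hφ
    rcases hJ1 φ hφ with h | h
    · exact ⟨_, Or.inr ⟨φ, h, rfl⟩, Or.inl rfl⟩
    · exact ⟨_, Or.inr ⟨_, h, rfl⟩, Or.inr (by dsimp only; abel)⟩
  have hroots : ∀ α ∈ R, α ≠ 0 → ∃ x ∈ W, ∃ y ∈ W, α = x - y ∨ α = T + x + y ∨ α = -(T + x + y) := by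
    intro α hα hα0
    have kneg : ∀ β, (∃ x ∈ W, ∃ y ∈ W, β = x - y ∨ β = T + x + y ∨ β = -(T + x + y)) →
        (∃ x ∈ W, ∃ y ∈ W, -β = x - y ∨ -β = T + x + y ∨ -β = -(T + x + y)) := by
      rintro β ⟨x, hx, y, hy, rfl | rfl | rfl⟩
      · exact ⟨y, hy, x, hx, Or.inl (by abel)⟩
      · exact ⟨x, hx, y, hy, Or.inr (Or.inr rfl)⟩
      · exact ⟨x, hx, y, hy, Or.inr (Or.inl (neg_neg _))⟩
    by_cases hw : wt α = 0
    · obtain ⟨φ, hφ, ψ, hψ, hwψ, hδ⟩ := k.wt_zero hc ho hα hα0 hw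
      have hψ' : ψ ∈ NSS form R wt o := ⟨hψ, hwψ, hs ψ hψ o ho hwψ⟩
      have h1 : ∃ x ∈ W, ∃ y ∈ W, ψ - φ = x - y ∨ ψ - φ = T + x + y ∨ ψ - φ = -(T + x + y) := by
        have e : ψ - φ = (o - φ) - (o - ψ) := by abel
        rw [e]
        obtain ⟨x, hx, ex | ex⟩ := rep φ hφ <;> obtain ⟨y, hy, ey | ey⟩ := rep ψ hψ' <;> rw [ex, ey]
        · exact ⟨x, hx, y, hy, Or.inl rfl⟩
        · exact ⟨x, hx, y, hy, Or.inr (Or.inl (by abel))⟩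
        · exact ⟨x, hx, y, hy, Or.inr (Or.inr (by abel))⟩
        · exact ⟨y, hy, x, hx, Or.inl (by abel)⟩
      rcases hδ with rfl | rfl
      · exact h1
      · have := kneg _ h1
        rwa [neg_sub] at this
    · obtain ⟨γ, hγ, hαγ, hcl⟩ := k.cls' hα hw
      have h1 : ∃ x ∈ W, ∃ y ∈ W, γ = x - y ∨ γ = T + x + y ∨ γ = -(T + x + y) := by
        rcases hcl with ⟨i, hi, hwi, hn⟩ | ⟨i, hi, hwi⟩ | ⟨i, hi, j, hj, hij, hwi⟩ |
          ⟨i, hi, j, hj, hij, rfl⟩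
        · obtain ⟨h3, h4, h5⟩ := k.mv hγ hi ho hwi
          have h6 : γ - (i - o) ∈ NSS form R wt o := ⟨h3, h4, h5.trans (hs γ hγ i hi hwi)⟩
          have e : γ = i - (o - (γ - (i - o))) := by abel
          rw [e]
          obtain ⟨x, hx, ex | ex⟩ := rep _ h6 <;> rw [ex]
          · exact ⟨i, Or.inl hi, x, hx, Or.inl rfl⟩
          · exact ⟨i, Or.inl hi, x, hx, Or.inr (Or.inl (by abel))⟩
        · exact ⟨i, Or.inl hi, i, Or.inl hi, Or.inr (Or.inl (k.dbl_eq hT hγ hi hwi))⟩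
        · exact ⟨i, Or.inl hi, j, Or.inl hj, Or.inr (Or.inl (k.pr_uniq hT hγ hi hj hij hwi))⟩
        · exact ⟨i, Or.inl hi, j, Or.inl hj, Or.inl rfl⟩
      rcases hαγ with rfl | rfl
      · exact h1
      · exact kneg _ h1
  by_cases hC : ∃ a ∈ W, T + a + a ∈ R
  · obtain ⟨a, ha, hE⟩ := hC
    exact k.h.typeCabs ha hE hN (fun x hx y hy hxy => (hO x hx y hy hxy).1)
      (fun x hx y hy hxy => (hO x hx y hy hxy).2) hroots
  · push Not at hC
    have hJe : ∀ φ ∈ J, False := by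
      intro φ hφ
      have hd := k.dual hT ho (hJ hφ)
      rcases k.h.add_or_sub (hJ hφ).1 hd.1 (by rw [k.dual_form hT ho (hJ hφ)]; exact k.two_c) with h1 | h1
      · refine hC o (Or.inl ho) ?_
        have e : φ + (T + o + o - φ) = T + o + o := by abel
        rwa [e] at h1
      · refine hC (o - φ) (Or.inr ⟨φ, hφ, rfl⟩) ?_
        have e : T + (o - φ) + (o - φ) = T + o + o - φ - φ := by abel
        rw [e]; exact k.h.sub_comm h1
    refine k.h.typeDabs k.fr.1 (k.inf.mono fun x hx => Or.inl hx) (Or.inl ho : o ∈ W) hC ?_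
      (fun x hx y hy hxy => (hO x hx y hy hxy).1)
      (fun x hx y hy hxy => (hO x hx y hy hxy).2) hroots
    intro x hx
    rcases wW x hx with hx' | ⟨φ, hφ, rfl⟩
    · exact NV x hx'
    · exact (hJe φ hφ).elim

theorem IsLFRSS.main (h : IsLFRSS form R) (hc : IsConnectedSet form (R \ formRadical form))
    (hinf : R.Infinite) : Concl form R := by
  obtain ⟨c, V, wt, k⟩ := h.exists_fr (h.hasFrame hc hinf)
  by_cases hA : ∃ γ ∈ R, ∃ i ∈ V, ∃ j ∈ V, i ≠ j ∧ wt γ = Finsupp.single i 1 + Finsupp.single j 1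
  · obtain ⟨γ, hγ, i, hi, j, hj, hij, hw⟩ := hA
    obtain ⟨T, hT, _⟩ := k.exists_pr hγ hi hj hij hw
    by_cases hB : ∃ ρ ∈ R, ∃ l ∈ V, wt ρ = Finsupp.single l 1 ∧ form ρ ρ = c
    · obtain ⟨ρ, hρ, l, hl, hwρ, hn⟩ := hB
      exact k.typeB hc hT hl hρ hwρ hn
    · refine k.typeCD hc hT fun ρ hρ l hl hwρ => ?_
      exact (k.single_norm hρ hwρ).resolve_right fun hn => hB ⟨ρ, hρ, l, hl, hwρ, hn⟩
  · push Not at hA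
    exact k.typeA hc hA

end TypeCD

theorem stmt13 {F : Type*} [Field F] [CharZero F] {A : Type*} [AddCommGroup A]
    (form : A → A → F) (R : Set A) (h : IsLFRSS form R)
    (hirr : IsIrreducibleRSS form R) (hinf : R.Infinite) :
    (∃ P : Set A, IsBase form R P ∧
      ∃ 𝒞 : Set (Set A),
        (∀ S ∈ 𝒞, S.Finite ∧ IsSubSupersystem form R S ∧ IsIrreducibleRSS form S ∧
          R ∩ (Submodule.span ℤ S : Set A) = S) ∧
        (∀ S ∈ 𝒞, ∀ T ∈ 𝒞, ∃ U ∈ 𝒞, S ⊆ U ∧ T ⊆ U) ∧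
        R = (⋃ S ∈ 𝒞, S) ∧
        (∀ S ∈ 𝒞, IsBase form S (P ∩ S))) ∧
    ∀ X : Set A, X ⊆ R → X.Finite →
      ∃ S : Set A, S.Finite ∧ IsSubSupersystem form R S ∧
        R ∩ (Submodule.span ℤ S : Set A) = S ∧ X ⊆ S :=
  h.main hirr.2 hinf
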